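/- Let κ be an infinite cardinal and let X be a connected metrizable manifold modeled on ℓ₂^f(κ), i.e., every point of X has an open neighborhood homeomorphic to an open subset of ℓ₂^f(κ). Then the hyperspace Fin(X) of nonempty finite subsets of X with the Vietoris topology is homeomorphic to ℓ₂^f(κ). -/

import Mathlib

/-- The hyperspace of nonempty finite subsets of a metric space `X`, equipped with
the Hausdorff metric induced by the metric of `X` (which induces the Vietoris topology). -/
def FinHyp (X : Type*) [MetricSpace X] : Type _ :=
  {A : TopologicalSpace.NonemptyCompacts X // (A : Set X).Finite}

noncomputable instance (X : Type*) [MetricSpace X] : MetricSpace (FinHyp X) :=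
  Subtype.metricSpace

/-- The underlying set of a member of the hyperspace of nonempty finite subsets. -/
def FinHyp.toSet {X : Type*} [MetricSpace X] (A : FinHyp X) : Set X := A.1

/-- A closed subset `A` of a space `Y` is a strong `Z`-set provided that for every open
cover `𝒰` of `Y` there is a continuous map `f : Y → Y` which is `𝒰`-close to the identity
and whose image has closure disjoint from `A`. -/
def IsStrongZSet {Y : Type*} [TopologicalSpace Y] (A : Set Y) : Prop :=
  IsClosed A ∧
    ∀ 𝒰 : Set (Set Y), (∀ U ∈ 𝒰, IsOpen U) → ⋃₀ 𝒰 = Set.univ →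
      ∃ f : Y → Y, Continuous f ∧ (∀ y, ∃ U ∈ 𝒰, y ∈ U ∧ f y ∈ U) ∧
        closure (Set.range f) ∩ A = ∅

/-- `ℓ₂^f(κ)`: the linear span of the canonical orthonormal basis in the Hilbert space
`ℓ₂(κ)` of square-summable real-valued functions on an index set `κ`, i.e. the subspace
of finitely supported elements, with the subspace topology inherited from `ℓ₂(κ)`. -/
def l2Fin (ι : Type*) : Type _ :=
  {f : lp (fun _ : ι => ℝ) 2 // (Function.support (⇑f : ι → ℝ)).Finite}

noncomputable instance (ι : Type*) : TopologicalSpace (l2Fin ι) :=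
  instTopologicalSpaceSubtype

open Set Metric Filter TopologicalSpace

/-- Finitely supported families in a normed group, with the supremum norm. -/
def C00 (ι E : Type*) [NormedAddCommGroup E] : Type _ := ι →₀ E

/-- Finitely supported families in a normed group, with the `ℓ₁`-norm. -/
def L1 (ι E : Type*) [NormedAddCommGroup E] : Type _ := ι →₀ E

section C00basic

variable {ι E : Type*} [NormedAddCommGroup E]

namespace C00

noncomputable instance : AddCommGroup (C00 ι E) := inferInstanceAs (AddCommGroup (ι →₀ E))
noncomputable instance [NormedSpace ℝ E] : Module ℝ (C00 ι E) :=
  inferInstanceAs (Module ℝ (ι →₀ E))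
instance : FunLike (C00 ι E) ι E := inferInstanceAs (FunLike (ι →₀ E) ι E)

/-- The underlying finitely supported function. -/
def toF (f : C00 ι E) : ι →₀ E := f

@[simp] lemma toF_apply (f : C00 ι E) (i : ι) : f.toF i = f i := rfl
@[simp] lemma zero_apply (i : ι) : (0 : C00 ι E) i = 0 := rfl
@[simp] lemma add_apply (f g : C00 ι E) (i : ι) : (f + g) i = f i + g i := rfl
@[simp] lemma sub_apply (f g : C00 ι E) (i : ι) : (f - g) i = f i - g i := rfl
@[simp] lemma neg_apply (f : C00 ι E) (i : ι) : (-f) i = - f i := rfl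
@[simp] lemma smul_apply [NormedSpace ℝ E] (c : ℝ) (f : C00 ι E) (i : ι) :
    (c • f) i = c • f i := rfl

@[ext] lemma ext {f g : C00 ι E} (h : ∀ i, f i = g i) : f = g := DFunLike.ext _ _ h

noncomputable instance : Norm (C00 ι E) := ⟨fun f => (f.toF.support.sup fun i => ‖f i‖₊ : NNReal)⟩

lemma norm_def (f : C00 ι E) : ‖f‖ = (f.toF.support.sup fun i => ‖f i‖₊ : NNReal) := rfl

lemma norm_nonneg' (f : C00 ι E) : 0 ≤ ‖f‖ := NNReal.coe_nonneg _

lemma norm_apply_le (f : C00 ι E) (i : ι) : ‖f i‖ ≤ ‖f‖ := by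
  by_cases h : f i = 0
  · rw [h, norm_zero]; exact norm_nonneg' f
  · rw [norm_def, ← coe_nnnorm, NNReal.coe_le_coe]
    exact Finset.le_sup (f := fun i => ‖f i‖₊) (by simpa using h)

lemma norm_le_iff {f : C00 ι E} {r : ℝ} (hr : 0 ≤ r) : ‖f‖ ≤ r ↔ ∀ i, ‖f i‖ ≤ r := by
  refine ⟨fun h i => (norm_apply_le f i).trans h, fun h => ?_⟩
  lift r to NNReal using hr
  rw [norm_def, NNReal.coe_le_coe]
  exact Finset.sup_le fun i _ => by exact_mod_cast h i

noncomputable instance : NormedAddCommGroup (C00 ι E) :=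
  AddGroupNorm.toNormedAddCommGroup
    { toFun := fun f => ‖f‖
      map_zero' := le_antisymm ((norm_le_iff le_rfl).2 (by simp)) (norm_nonneg' _)
      add_le' := fun f g => (norm_le_iff (add_nonneg (norm_nonneg' _) (norm_nonneg' _))).2
        fun i => (norm_add_le _ _).trans (add_le_add (norm_apply_le _ _) (norm_apply_le _ _))
      neg' := fun f => le_antisymm
        ((norm_le_iff (norm_nonneg' _)).2 fun i => by simpa using norm_apply_le f i)
        ((norm_le_iff (norm_nonneg' _)).2 fun i => by simpa using norm_apply_le (-f) i)
      eq_zero_of_map_eq_zero' := fun f hf => ext fun i => by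
        simpa using (norm_apply_le f i).trans hf.le }

noncomputable instance [NormedSpace ℝ E] : NormedSpace ℝ (C00 ι E) where
  norm_smul_le c f := (norm_le_iff (by positivity)).2 fun i => by
    rw [smul_apply, norm_smul]
    exact mul_le_mul_of_nonneg_left (norm_apply_le f i) (norm_nonneg _)

lemma finite_support (f : C00 ι E) : {i | f i ≠ 0}.Finite :=
  f.toF.hasFiniteSupport

/-- Build a finitely supported family from a function. -/
noncomputable def mk (f : ι → E) (h : {i | f i ≠ 0}.Finite) : C00 ι E :=
  Finsupp.ofSupportFinite f h

@[simp] lemma mk_apply (f : ι → E) (h) (i : ι) : mk f h i = f i := rfl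

lemma continuous_apply (i : ι) : Continuous fun f : C00 ι E => f i :=
  (LipschitzWith.of_dist_le_mul (K := 1) fun f g => by
    simpa [dist_eq_norm] using norm_apply_le (f - g) i).continuous

lemma tendsto_of {α : Type*} {l : Filter α} {F : α → C00 ι E} {z : C00 ι E}
    (h1 : ∀ i, Tendsto (fun a => F a i) l (nhds (z i)))
    (h2 : ∀ ε > 0, ∃ J : Set ι, J.Finite ∧ ∀ᶠ a in l, ∀ i ∉ J, ‖F a i‖ ≤ ε) :
    Tendsto F l (nhds z) := by
  rw [Metric.tendsto_nhds]
  intro ε hε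
  obtain ⟨J, hJ, h⟩ := h2 (ε / 2) (half_pos hε)
  have h3 : ∀ᶠ a in l, ∀ i ∈ J ∪ {i | z i ≠ 0}, dist (F a i) (z i) < ε / 2 :=
    (Filter.eventually_all_finite (hJ.union z.finite_support)).2 fun i _ =>
      Metric.tendsto_nhds.1 (h1 i) _ (half_pos hε)
  filter_upwards [h, h3] with a ha hb
  refine lt_of_le_of_lt ?_ (half_lt_self hε)
  rw [dist_eq_norm, norm_le_iff (half_pos hε).le]
  intro i
  by_cases hi : i ∈ J ∪ {i | z i ≠ 0}
  · simpa [dist_eq_norm] using (hb i hi).le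
  · have : z i = 0 := by simp at hi; exact hi.2
    simpa [this] using ha i (fun h => hi (Or.inl h))

/-- The converse: norm-small tails near a point. -/
lemma eventually_tail (z : C00 ι E) {ε : ℝ} (hε : 0 < ε) :
    ∀ᶠ f in nhds z, ∀ i, z i = 0 → ‖f i‖ < ε := by
  filter_upwards [Metric.ball_mem_nhds z hε] with f hf i hi
  have := norm_apply_le (f - z) i
  rw [mem_ball, dist_eq_norm] at hf
  simpa [hi] using this.trans_lt hf

end C00

namespace L1

noncomputable instance : AddCommGroup (L1 ι E) := inferInstanceAs (AddCommGroup (ι →₀ E))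
noncomputable instance [NormedSpace ℝ E] : Module ℝ (L1 ι E) :=
  inferInstanceAs (Module ℝ (ι →₀ E))
instance : FunLike (L1 ι E) ι E := inferInstanceAs (FunLike (ι →₀ E) ι E)

/-- The underlying finitely supported function. -/
def toF (f : L1 ι E) : ι →₀ E := f

@[simp] lemma toF_apply (f : L1 ι E) (i : ι) : f.toF i = f i := rfl
@[simp] lemma zero_apply (i : ι) : (0 : L1 ι E) i = 0 := rfl
@[simp] lemma add_apply (f g : L1 ι E) (i : ι) : (f + g) i = f i + g i := rfl
@[simp] lemma sub_apply (f g : L1 ι E) (i : ι) : (f - g) i = f i - g i := rfl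
@[simp] lemma neg_apply (f : L1 ι E) (i : ι) : (-f) i = - f i := rfl
@[simp] lemma smul_apply [NormedSpace ℝ E] (c : ℝ) (f : L1 ι E) (i : ι) :
    (c • f) i = c • f i := rfl

@[ext] lemma ext {f g : L1 ι E} (h : ∀ i, f i = g i) : f = g := DFunLike.ext _ _ h

noncomputable instance : Norm (L1 ι E) := ⟨fun f => ∑ i ∈ f.toF.support, ‖f i‖⟩

lemma norm_eq_sum (f : L1 ι E) {s : Finset ι} (hs : ∀ i ∉ s, f i = 0) :
    ‖f‖ = ∑ i ∈ s, ‖f i‖ := by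
  refine Finset.sum_subset (fun i hi => ?_) fun i _ hi => ?_
  · by_contra h; exact (Finsupp.mem_support_iff.1 hi) (hs i h)
  · have : f i = 0 := by simpa using hi
    rw [this, norm_zero]

lemma norm_nonneg' (f : L1 ι E) : 0 ≤ ‖f‖ := Finset.sum_nonneg fun _ _ => norm_nonneg _

lemma norm_apply_le (f : L1 ι E) (i : ι) : ‖f i‖ ≤ ‖f‖ := by
  by_cases h : f i = 0
  · rw [h, norm_zero]; exact norm_nonneg' f
  · exact Finset.single_le_sum (f := fun i => ‖f i‖) (fun _ _ => norm_nonneg _)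
      (by simpa using h)

noncomputable instance : NormedAddCommGroup (L1 ι E) :=
  AddGroupNorm.toNormedAddCommGroup
    { toFun := fun f => ‖f‖
      map_zero' := by rw [norm_eq_sum (s := ∅) _ (by simp)]; simp
      add_le' := fun f g => by
        classical
        have h : ∀ i ∉ f.toF.support ∪ g.toF.support, f i = 0 ∧ g i = 0 := by
          intro i hi; simpa using hi
        rw [norm_eq_sum (f + g) (s := f.toF.support ∪ g.toF.support)
            fun i hi => by simp [(h i hi).1, (h i hi).2],
          norm_eq_sum f fun i hi => (h i hi).1, norm_eq_sum g fun i hi => (h i hi).2,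
          ← Finset.sum_add_distrib]
        exact Finset.sum_le_sum fun i _ => norm_add_le _ _
      neg' := fun f => by
        have h : ∀ i ∉ f.toF.support, f i = 0 := by intro i hi; simpa using hi
        rw [norm_eq_sum f h, norm_eq_sum (-f) (s := f.toF.support) fun i hi => by simp [h i hi]]
        simp
      eq_zero_of_map_eq_zero' := fun f hf => ext fun i => by
        simpa using (norm_apply_le f i).trans hf.le }

noncomputable instance [NormedSpace ℝ E] : NormedSpace ℝ (L1 ι E) where
  norm_smul_le c f := by
    have h : ∀ i ∉ f.toF.support, f i = 0 := by intro i hi; simpa using hi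
    rw [norm_eq_sum f h, norm_eq_sum (c • f) (s := f.toF.support) fun i hi => by simp [h i hi], Finset.mul_sum]
    simp [norm_smul]

lemma finite_support (f : L1 ι E) : {i | f i ≠ 0}.Finite :=
  f.toF.hasFiniteSupport

/-- Build a finitely supported family from a function. -/
noncomputable def mk (f : ι → E) (h : {i | f i ≠ 0}.Finite) : L1 ι E :=
  Finsupp.ofSupportFinite f h

@[simp] lemma mk_apply (f : ι → E) (h) (i : ι) : mk f h i = f i := rfl

lemma continuous_apply (i : ι) : Continuous fun f : L1 ι E => f i :=
  (LipschitzWith.of_dist_le_mul (K := 1) fun f g => by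
    simpa [dist_eq_norm] using norm_apply_le (f - g) i).continuous

/-- The part of a family supported in `J`. -/
noncomputable def restr (J : Set ι) (f : L1 ι E) : L1 ι E :=
  mk (J.indicator f) (f.finite_support.subset fun i hi => by
    rw [mem_ofPred_eq] at hi ⊢; exact fun h => hi (by simp [indicator, h]))

lemma restr_apply_mem {J : Set ι} (f : L1 ι E) {i : ι} (hi : i ∈ J) : restr J f i = f i :=
  indicator_of_mem hi _

lemma restr_apply_notMem {J : Set ι} (f : L1 ι E) {i : ι} (hi : i ∉ J) : restr J f i = 0 :=
  indicator_of_notMem hi _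

lemma norm_restr_add (J : Set ι) (f : L1 ι E) : ‖restr J f‖ + ‖restr Jᶜ f‖ = ‖f‖ := by
  have h : ∀ i ∉ f.toF.support, f i = 0 := by intro i hi; simpa using hi
  have h' : ∀ J : Set ι, ∀ i ∉ f.toF.support, restr J f i = 0 := fun J i hi => by
    by_cases hJ : i ∈ J
    · rw [restr_apply_mem f hJ, h i hi]
    · exact restr_apply_notMem f hJ
  rw [norm_eq_sum _ (h' J), norm_eq_sum _ (h' Jᶜ), norm_eq_sum _ h, ← Finset.sum_add_distrib]
  refine Finset.sum_congr rfl fun i _ => ?_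
  by_cases hJ : i ∈ J
  · rw [restr_apply_mem f hJ, restr_apply_notMem f (notMem_compl_iff.2 hJ)]; simp
  · rw [restr_apply_notMem f hJ, restr_apply_mem f (mem_compl hJ)]; simp

lemma norm_restr_finset (s : Finset ι) (f : L1 ι E) :
    ‖restr (s : Set ι) f‖ = ∑ i ∈ s, ‖f i‖ := by
  rw [norm_eq_sum (s := s) _ fun i hi => restr_apply_notMem f (by simpa using hi)]
  exact Finset.sum_congr rfl fun i hi => by rw [restr_apply_mem f (by simpa using hi)]

lemma restr_add_restr_compl (J : Set ι) (f : L1 ι E) : restr J f + restr Jᶜ f = f := by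
  ext i
  by_cases hJ : i ∈ J
  · rw [add_apply, restr_apply_mem f hJ, restr_apply_notMem f (notMem_compl_iff.2 hJ), add_zero]
  · rw [add_apply, restr_apply_notMem f hJ, restr_apply_mem f (mem_compl hJ), zero_add]

/-- Scheffé's lemma: coordinatewise convergence with convergence of norms is convergence. -/
lemma tendsto_of {α : Type*} {l : Filter α} {F : α → L1 ι E} {z : L1 ι E}
    (h1 : ∀ i, Tendsto (fun a => F a i) l (nhds (z i)))
    (h2 : Tendsto (fun a => ‖F a‖) l (nhds ‖z‖)) :
    Tendsto F l (nhds z) := by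
  set s := z.toF.support
  have hz : ∀ i ∉ s, z i = 0 := by intro i hi; simpa [s] using hi
  have h3 : Tendsto (fun a => ∑ i ∈ s, ‖F a i‖) l (nhds (∑ i ∈ s, ‖z i‖)) :=
    tendsto_finsetSum _ fun i _ => (h1 i).norm
  have h4 : Tendsto (fun a => ∑ i ∈ s, ‖F a i - z i‖) l (nhds 0) := by
    have := tendsto_finsetSum s fun i _ => ((h1 i).sub_const (z i)).norm
    simpa using this
  have h5 := h4.add (h2.sub h3)
  rw [← norm_eq_sum z hz, sub_self, add_zero] at h5
  rw [tendsto_iff_norm_sub_tendsto_zero]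
  refine h5.congr fun a => ?_
  rw [← norm_restr_add (s : Set ι) (F a - z), norm_restr_finset, ← norm_restr_finset s (F a)]
  rw [← norm_restr_add (s : Set ι) (F a), add_sub_cancel_left]
  congr 2
  ext i
  by_cases hi : i ∈ (s : Set ι)
  · rw [restr_apply_notMem _ (notMem_compl_iff.2 hi), restr_apply_notMem _ (notMem_compl_iff.2 hi)]
  · rw [restr_apply_mem _ (mem_compl hi), restr_apply_mem _ (mem_compl hi)]
    simp [hz i (by simpa using hi)]

end L1

end C00basic

lemma isClosedEmbedding_of_subseq {X Y : Type*} [MetricSpace X] [MetricSpace Y] {f : X → Y}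
    (hf : Continuous f) (hinj : Function.Injective f)
    (h : ∀ (u : ℕ → X) (z : Y), Tendsto (fun n => f (u n)) atTop (nhds z) →
      ∃ (x : X) (φ : ℕ → ℕ), StrictMono φ ∧ Tendsto (fun n => u (φ n)) atTop (nhds x)) :
    Topology.IsClosedEmbedding f := by
  refine .of_continuous_injective_isClosedMap hf hinj fun C hC => ?_
  refine IsSeqClosed.isClosed fun v z hv hz => ?_
  choose u hu huv using hv
  obtain ⟨x, φ, hφ, hx⟩ := h u z (by simpa [huv] using hz)
  refine ⟨x, hC.mem_of_tendsto hx (Eventually.of_forall fun n => hu _), ?_⟩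
  refine tendsto_nhds_unique ((hf.tendsto x).comp hx) ?_
  simpa [Function.comp_def, huv] using hz.comp hφ.tendsto_atTop

/-- Continuity with convergent sequences gives a closed embedding; injectivity is automatic. -/
lemma isClosedEmbedding_of_seq {X Y : Type*} [MetricSpace X] [MetricSpace Y] {f : X → Y}
    (hf : Continuous f)
    (h : ∀ (u : ℕ → X) (z : Y), Tendsto (fun n => f (u n)) atTop (nhds z) →
      ∃ x, Tendsto u atTop (nhds x)) :
    Topology.IsClosedEmbedding f := by
  refine isClosedEmbedding_of_subseq hf (fun a b hab => ?_) fun u z hu => ?_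
  · obtain ⟨x, hx⟩ := h (fun n => if Even n then a else b) (f a) (by
      refine tendsto_const_nhds.congr fun n => ?_
      split_ifs <;> simp [hab])
    have ha : Tendsto (fun n : ℕ => 2 * n) atTop atTop :=
      tendsto_atTop_mono (fun n => by simp only [id]; omega) tendsto_id
    have hb : Tendsto (fun n : ℕ => 2 * n + 1) atTop atTop := (tendsto_add_atTop_nat 1).comp ha
    have h1 := hx.comp ha
    have h2 := hx.comp hb
    simp only [Function.comp_def, even_two, Even.mul_right, if_true] at h1
    have h3 : ∀ n : ℕ, ¬ Even (2 * n + 1) := fun n => by simp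
    simp only [Function.comp_def, h3, if_false] at h2
    exact (tendsto_nhds_unique tendsto_const_nhds h1).trans
      (tendsto_nhds_unique h2 tendsto_const_nhds)
  · obtain ⟨x, hx⟩ := h u z hu
    exact ⟨x, id, strictMono_id, hx⟩

section MazurMap

/-- Build an element of `l2Fin` from a finitely supported function. -/
noncomputable def l2Fin.mk {ι : Type*} (f : ι → ℝ) (h : {i | f i ≠ 0}.Finite) : l2Fin ι :=
  ⟨⟨(f : PreLp fun _ : ι => ℝ), memℓp_gen (summable_of_hasFiniteSupport (h.subset fun i hi => by
    rw [Function.mem_support] at hi; rw [mem_ofPred_eq]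
    exact fun h => hi (by simp [h])))⟩, h⟩

@[simp] lemma l2Fin.mk_apply {ι : Type*} (f : ι → ℝ) (h) (i : ι) : (l2Fin.mk f h).1 i = f i := rfl

lemma l2Fin.continuous_apply {ι : Type*} (i : ι) : Continuous fun x : l2Fin ι => x.1 i := by
  have : LipschitzWith 1 fun x : lp (fun _ : ι => ℝ) 2 => x i :=
    LipschitzWith.of_dist_le_mul fun x y => by
      simpa [dist_eq_norm] using lp.norm_apply_le_norm (by norm_num) (x - y) i
  exact this.continuous.comp continuous_subtype_val

lemma l2Fin.norm_sq {ι : Type*} (x : l2Fin ι) {s : Finset ι} (hs : ∀ i ∉ s, x.1 i = 0) :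
    ‖x.1‖ ^ 2 = ∑ i ∈ s, x.1 i ^ 2 := by
  rw [← real_inner_self_eq_norm_sq, lp.inner_eq_tsum, tsum_eq_sum (s := s)]
  · simp [sq]
  · intro i hi; simp [hs i hi]

lemma l2Fin.tendsto_of {ι α : Type*} {l : Filter α} {F : α → l2Fin ι} {z : l2Fin ι}
    (h1 : ∀ i, Tendsto (fun a => (F a).1 i) l (nhds (z.1 i)))
    (h2 : Tendsto (fun a => ‖(F a).1‖ ^ 2) l (nhds (‖z.1‖ ^ 2))) :
    Tendsto F l (nhds z) := by
  refine Topology.IsInducing.subtypeVal.tendsto_nhds_iff.2 ?_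
  rw [tendsto_iff_norm_sub_tendsto_zero]
  set s := z.2.toFinset
  have hz : ∀ i ∉ s, z.1 i = 0 := by intro i hi; simpa [s] using hi
  have h3 : Tendsto (fun a => inner ℝ (F a).1 z.1) l (nhds (inner ℝ z.1 z.1)) := by
    have : ∀ x : l2Fin ι, inner ℝ x.1 z.1 = ∑ i ∈ s, x.1 i * z.1 i := fun x => by
      rw [lp.inner_eq_tsum, tsum_eq_sum (s := s)]
      · simp [mul_comm]
      · intro i hi; simp [hz i hi]
    simp only [this]
    exact tendsto_finsetSum _ fun i _ => (h1 i).mul_const _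
  have h4 : Tendsto (fun a => ‖(F a).1 - z.1‖ ^ 2) l (nhds 0) := by
    have := (h2.sub (h3.const_mul 2)).add_const (‖z.1‖ ^ 2)
    rw [real_inner_self_eq_norm_sq] at this
    convert this using 2
    · rw [norm_sub_sq_real]
    · ring
  have := h4.sqrt
  simp only [Real.sqrt_sq (norm_nonneg _), Real.sqrt_zero] at this
  exact this

/-- The coordinatewise signed square root. -/
noncomputable def mazurInv {ι : Type*} (y : L1 ι ℝ) : l2Fin ι :=
  l2Fin.mk (fun i => SignType.sign (y i) * √|y i|)
    (y.finite_support.subset fun i hi => by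
      rw [mem_ofPred_eq] at hi ⊢; exact fun h => hi (by simp [h]))

/-- The Mazur homeomorphism between the finitely supported parts of `ℓ₂` and `ℓ₁`. -/
noncomputable def mazurHomeo (ι : Type*) : l2Fin ι ≃ₜ L1 ι ℝ where
  toFun x := L1.mk (fun i => x.1 i * |x.1 i|) (x.2.subset fun i hi => by
    rw [mem_ofPred_eq] at hi; simp; exact fun h => hi (by simp [h]))
  invFun := mazurInv
  left_inv x := by
    apply Subtype.ext; ext i
    show (SignType.sign (x.1 i * |x.1 i|) : ℝ) * √(abs (x.1 i * |x.1 i|)) = x.1 i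
    rcases lt_trichotomy (x.1 i) 0 with h | h | h
    · rw [abs_of_neg h, sign_neg (by nlinarith), abs_of_neg (by nlinarith)]
      rw [show -(x.1 i * -x.1 i) = (-x.1 i) ^ 2 by ring, Real.sqrt_sq (by linarith)]
      simp
    · simp [h]
    · rw [abs_of_pos h, sign_pos (by nlinarith), abs_of_pos (by nlinarith)]
      rw [Real.sqrt_mul_self h.le]; simp
  right_inv y := by
    ext i
    show (SignType.sign (y i) : ℝ) * √|y i| * abs ((SignType.sign (y i) : ℝ) * √|y i|) = y i
    rcases lt_trichotomy (y i) 0 with h | h | h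
    · rw [sign_neg h]; simp [abs_of_nonneg (Real.sqrt_nonneg _), abs_of_neg h, Real.mul_self_sqrt, h.le]
    · simp [h]
    · rw [sign_pos h]; simp [abs_of_nonneg (Real.sqrt_nonneg _), abs_of_pos h, Real.mul_self_sqrt, h.le]
  continuous_toFun := by
    rw [continuous_iff_continuousAt]
    intro z
    refine L1.tendsto_of (fun i => ?_) ?_
    · have := (l2Fin.continuous_apply i).tendsto z
      exact this.mul this.abs
    · have : ∀ (x : l2Fin _) h, ‖(L1.mk (fun i => x.1 i * |x.1 i|) h : L1 ι ℝ)‖ = ‖x.1‖ ^ 2 := by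
        intro x h
        have hx : ∀ i ∉ x.2.toFinset, x.1 i = 0 := by intro i hi; simpa using hi
        rw [l2Fin.norm_sq x hx, L1.norm_eq_sum _ (s := x.2.toFinset)]
        · exact Finset.sum_congr rfl fun i _ => by simp [sq]
        · intro i hi; simp [hx i hi]
      simp only [this]
      exact ((continuous_subtype_val.tendsto z).norm).pow 2
  continuous_invFun := by
    rw [continuous_iff_continuousAt]
    intro z
    refine l2Fin.tendsto_of (fun i => ?_) ?_
    · have hc : Continuous fun t : ℝ => (SignType.sign t : ℝ) * √|t| := by
        have : (fun t : ℝ => (SignType.sign t : ℝ) * √|t|) = fun t => √(max t 0) - √(max (-t) 0) := by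
          ext t
          rcases lt_trichotomy t 0 with h | h | h
          · simp [sign_neg h, h.le, abs_of_neg h]
          · simp [h]
          · simp [sign_pos h, h.le, abs_of_pos h]
        rw [this]; fun_prop
      exact (hc.tendsto _).comp ((L1.continuous_apply i).tendsto z)
    · have : ∀ (x : l2Fin ι) (y : L1 ι ℝ), (∀ i, x.1 i = SignType.sign (y i) * √|y i|) →
          ‖x.1‖ ^ 2 = ‖y‖ := by
        intro x y h
        have hx : ∀ i ∉ y.toF.support, y i = 0 := by intro i hi; simpa using hi
        rw [L1.norm_eq_sum y hx, l2Fin.norm_sq (s := y.toF.support)]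
        · refine Finset.sum_congr rfl fun i hi => ?_
          have : y i ≠ 0 := by simpa using hi
          rw [h, mul_pow, Real.sq_sqrt (abs_nonneg _)]
          rcases this.lt_or_gt with h | h
          · simp [sign_neg h]
          · simp [sign_pos h]
        · intro i hi; simp [h, hx i hi]
      simp only [fun y => this (mazurInv y) y fun i => rfl]
      exact (continuous_norm (E := L1 ι ℝ)).tendsto z

end MazurMap

section LayerMap

variable {ι : Type*}

/-- The sum of all absolute values of a family, truncated at the value at `i`. -/
noncomputable def layer (y : L1 ι ℝ) (i : ι) : ℝ := ∑ j ∈ y.toF.support, min |y j| |y i|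

lemma layer_eq_sum (y : L1 ι ℝ) (i : ι) {s : Finset ι} (hs : ∀ j ∉ s, y j = 0) :
    layer y i = ∑ j ∈ s, min |y j| |y i| := by
  refine Finset.sum_subset (fun j hj => ?_) fun j _ hj => ?_
  · by_contra h; exact (Finsupp.mem_support_iff.1 hj) (hs j h)
  · have : y j = 0 := by simpa using hj
    rw [this, abs_zero, min_eq_left (abs_nonneg _)]

lemma layer_nonneg (y : L1 ι ℝ) (i : ι) : 0 ≤ layer y i :=
  Finset.sum_nonneg fun _ _ => le_min (abs_nonneg _) (abs_nonneg _)

lemma layer_eq_zero {y : L1 ι ℝ} {i : ι} (h : y i = 0) : layer y i = 0 :=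
  Finset.sum_eq_zero fun j _ => by rw [h, abs_zero, min_eq_right (abs_nonneg _)]

lemma abs_le_layer (y : L1 ι ℝ) (i : ι) : |y i| ≤ layer y i := by
  by_cases h : y i = 0
  · simp [h, layer_nonneg]
  · have := Finset.single_le_sum (f := fun j => min |y j| |y i|) (s := y.toF.support) (a := i)
      (fun _ _ => le_min (abs_nonneg _) (abs_nonneg _)) (by simpa using h)
    rwa [min_self] at this

lemma layer_mono {y : L1 ι ℝ} {i k : ι} (h : |y k| ≤ |y i|) :
    layer y k + (|y i| - |y k|) ≤ layer y i := by
  by_cases hi : y i = 0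
  · have hk : y k = 0 := by simpa [hi] using h
    simp [hi, hk, layer_eq_zero]
  · classical
    have hm : i ∈ y.toF.support := by simpa using hi
    rw [layer, layer, ← Finset.sum_erase_add _ _ hm, ← Finset.sum_erase_add _ _ hm, min_self,
      min_eq_right h]
    have := Finset.sum_le_sum (s := y.toF.support.erase i) fun j _ =>
      min_le_min_left |y j| h
    linarith

lemma layer_le (y z : L1 ι ℝ) (i : ι) (hi : z i = 0) :
    layer y i ≤ (z.toF.support.card + 1) * ‖y - z‖ := by
  classical
  have h : ∀ j ∉ y.toF.support ∪ z.toF.support, y j = 0 ∧ z j = 0 := by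
    intro j hj; simpa using hj
  have hyi : |y i| ≤ ‖y - z‖ := by simpa [hi] using L1.norm_apply_le (y - z) i
  rw [layer_eq_sum y i fun j hj => (h j hj).1]
  calc _ ≤ ∑ j ∈ y.toF.support ∪ z.toF.support,
        ((if j ∈ z.toF.support then ‖y - z‖ else 0) + ‖(y - z) j‖) := by
        refine Finset.sum_le_sum fun j _ => ?_
        split_ifs with hj
        · exact (min_le_right _ _).trans (hyi.trans (by simp))
        · have : z j = 0 := by simpa using hj
          simp [this]
    _ = _ := by
        rw [Finset.sum_add_distrib, ← L1.norm_eq_sum (y - z) fun j hj => by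
          simp [(h j hj).1, (h j hj).2], Finset.sum_ite_mem, Finset.union_inter_cancel_right]
        simp; ring

lemma tendsto_layer (z : L1 ι ℝ) (i : ι) :
    Tendsto (fun y => layer y i) (nhds z) (nhds (layer z i)) := by
  classical
  set s := z.toF.support
  have h0 : Tendsto (fun y : L1 ι ℝ => ∑ j ∈ s, min |y j| |y i|) (nhds z) (nhds (layer z i)) :=
    tendsto_finsetSum _ fun j _ => ((L1.continuous_apply j).tendsto z).abs.min
      ((L1.continuous_apply i).tendsto z).abs
  have h1 : Tendsto (fun y : L1 ι ℝ => (∑ j ∈ s, min |y j| |y i|) + ‖y - z‖) (nhds z)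
      (nhds (layer z i)) := by
    have : Tendsto (fun y : L1 ι ℝ => ‖y - z‖) (nhds z) (nhds 0) := by
      have : Continuous fun y : L1 ι ℝ => ‖y - z‖ := by fun_prop
      simpa using this.tendsto z
    simpa using h0.add this
  have hsub : ∀ y : L1 ι ℝ, layer y i = (∑ j ∈ s, min |y j| |y i|) +
      ∑ j ∈ y.toF.support \ s, min |y j| |y i| := fun y => by
    rw [layer_eq_sum y i (s := y.toF.support ∪ s) (by intro j hj; simp at hj; exact hj.1),
      ← Finset.sdiff_union_self_eq_union, Finset.sum_union Finset.sdiff_disjoint, add_comm]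
  refine tendsto_of_tendsto_of_tendsto_of_le_of_le h0 h1 (fun y => ?_) fun y => ?_
  · simp only [hsub y]
    exact le_add_of_nonneg_right
      (Finset.sum_nonneg fun _ _ => le_min (abs_nonneg _) (abs_nonneg _))
  · simp only [hsub y]
    refine add_le_add_right ?_ _
    rw [L1.norm_eq_sum (s := y.toF.support ∪ s) (y - z) (by
      intro j hj; simp [s] at hj; simp [hj.1, hj.2])]
    refine (Finset.sum_le_sum fun j hj => ?_).trans (Finset.sum_le_sum_of_subset_of_nonneg
      (Finset.sdiff_subset.trans Finset.subset_union_left) fun _ _ _ => norm_nonneg _)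
    have : z j = 0 := by have := (Finset.mem_sdiff.1 hj).2; simpa [s] using this
    simp [this]

/-- The signed version of `layer`, as a map into `C00`. -/
noncomputable def layerMap (y : L1 ι ℝ) : C00 ι ℝ :=
  C00.mk (fun i => SignType.sign (y i) * layer y i) (y.finite_support.subset fun i hi => by
    rw [mem_ofPred_eq] at hi ⊢; exact fun h => hi (by simp [h]))

lemma abs_layerMap (y : L1 ι ℝ) (i : ι) : |layerMap y i| = layer y i := by
  rw [layerMap, C00.mk_apply]
  rcases lt_trichotomy (y i) 0 with h | h | h
  · simp [sign_neg h, abs_of_nonneg (layer_nonneg y i)]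
  · simp [h, layer_eq_zero h]
  · simp [sign_pos h, abs_of_nonneg (layer_nonneg y i)]

lemma sign_layerMap (y : L1 ι ℝ) (i : ι) :
    SignType.sign (layerMap y i) = SignType.sign (y i) := by
  have h1 := abs_le_layer y i
  rw [layerMap, C00.mk_apply]
  rcases lt_trichotomy (y i) 0 with h | h | h
  · have : 0 < layer y i := (abs_pos.2 h.ne).trans_le h1
    simp [sign_neg h, this]
  · simp [h]
  · have : 0 < layer y i := (abs_pos.2 h.ne').trans_le h1
    simp [sign_pos h, this]

lemma continuous_layerMap : Continuous (layerMap : L1 ι ℝ → C00 ι ℝ) := by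
  rw [continuous_iff_continuousAt]
  intro z
  have h0 : Tendsto (fun y : L1 ι ℝ => (z.toF.support.card + 1) * ‖y - z‖) (nhds z) (nhds 0) := by
    have : Continuous fun y : L1 ι ℝ => (z.toF.support.card + 1) * ‖y - z‖ := by fun_prop
    simpa using this.tendsto z
  refine C00.tendsto_of (fun i => ?_) fun ε hε => ⟨{i | z i ≠ 0}, z.finite_support, ?_⟩
  · by_cases hi : z i = 0
    · have : layerMap z i = 0 := by simp [layerMap, hi]
      rw [this]
      refine squeeze_zero_norm (fun y => ?_) h0
      rw [Real.norm_eq_abs, abs_layerMap]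
      exact layer_le y z i hi
    · refine Tendsto.mul ?_ (tendsto_layer z i)
      have h1 := (continuousAt_sign_of_ne_zero hi).tendsto.comp ((L1.continuous_apply i).tendsto z)
      exact ((continuous_of_discreteTopology (f := fun s : SignType => (s : ℝ))).tendsto _).comp h1
  · filter_upwards [h0.eventually (gt_mem_nhds hε)] with y hy i hi
    rw [Real.norm_eq_abs, abs_layerMap]
    exact (layer_le y z i (by simpa using hi)).trans hy.le

lemma injective_layerMap : Function.Injective (layerMap : L1 ι ℝ → C00 ι ℝ) := by
  classical
  intro y z h
  have hS : ∀ i, layer y i = layer z i := fun i => by rw [← abs_layerMap, h, abs_layerMap]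
  have hs : ∀ i, SignType.sign (y i) = SignType.sign (z i) := fun i => by
    rw [← sign_layerMap, h, sign_layerMap]
  have hsupp : ∀ i, y i = 0 ↔ z i = 0 := fun i => by
    rw [← sign_eq_zero_iff, hs, sign_eq_zero_iff]
  have key : ∀ i, |y i| = |z i| := by
    by_contra! hne
    have hfin : {i | |y i| ≠ |z i|}.Finite := y.finite_support.subset fun i hi => by
      rw [mem_ofPred_eq] at hi ⊢
      exact fun h => hi (by rw [h, (hsupp i).1 h])
    obtain ⟨i, hi, hmin⟩ := hfin.exists_minimalFor (layer y) _ hne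
    have hlt : ∀ w : L1 ι ℝ, ∀ j, layer w i ≤ layer w j → |w i| ≤ |w j| := fun w j hj => by
      by_contra! hlt; have := layer_mono hlt.le; linarith
    have hlt' : ∀ w : L1 ι ℝ, ∀ j, layer w j < layer w i → |w j| ≤ |w i| := fun w j hj => by
      by_contra! hlt; have := layer_mono hlt.le; linarith
    have e : ∀ w : L1 ι ℝ, (∀ j, layer w j = layer y j) → (∀ j ∉ y.toF.support, w j = 0) →
        layer y i = (∑ j ∈ y.toF.support with layer y j < layer y i, |w j|) +
          (y.toF.support.filter fun j => ¬ layer y j < layer y i).card * |w i| := by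
      intro w hw hw0
      have e0 : layer y i = ∑ j ∈ y.toF.support, min |w j| |w i| := by
        rw [← hw i, layer_eq_sum w i hw0]
      refine e0.trans ?_
      rw [← Finset.sum_filter_add_sum_filter_not _ (fun j => layer y j < layer y i)]
      congr 1
      · refine Finset.sum_congr rfl fun j hj => min_eq_left (hlt' w j ?_)
        rw [hw, hw]; exact (Finset.mem_filter.1 hj).2
      · rw [← nsmul_eq_mul, ← Finset.sum_const]
        refine Finset.sum_congr rfl fun j hj => min_eq_right (hlt w j ?_)
        rw [hw, hw]; simpa using (Finset.mem_filter.1 hj).2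
    have e1 := e y (fun _ => rfl) (by intro j hj; simpa using hj)
    have e2 := e z (fun j => (hS j).symm) (by intro j hj; rw [← hsupp]; simpa using hj)
    have e3 : ∑ j ∈ y.toF.support with layer y j < layer y i, |y j| =
        ∑ j ∈ y.toF.support with layer y j < layer y i, |z j| := by
      refine Finset.sum_congr rfl fun j hj => ?_
      by_contra hj'
      have := hmin hj' (Finset.mem_filter.1 hj).2.le
      exact absurd (Finset.mem_filter.1 hj).2 (not_lt.2 this)
    have hpos : 0 < (y.toF.support.filter fun j => ¬ layer y j < layer y i).card := by
      refine Finset.card_pos.2 ⟨i, Finset.mem_filter.2 ⟨?_, lt_irrefl _⟩⟩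
      rw [Finsupp.mem_support_iff]
      intro h0
      have h0 : y i = 0 := h0
      exact hi (by rw [h0, (hsupp i).1 h0])
    rw [e3] at e1
    have hpos' : (0 : ℝ) < (y.toF.support.filter fun j => ¬ layer y j < layer y i).card := by
      exact_mod_cast hpos
    exact hi (mul_left_cancel₀ hpos'.ne' (by linarith))
  ext i
  have h1 := sign_mul_abs (y i)
  have h2 := sign_mul_abs (z i)
  rw [key, hs] at h1
  rw [← h1, ← h2]; simp

lemma exists_sum_min_eq (s : Finset ι) (x : ι → ℝ) (h0 : ∀ i, 0 ≤ x i)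
    (hs : ∀ i ∉ s, x i = 0) :
    ∃ y : ι → ℝ, (∀ i, 0 ≤ y i) ∧ (∀ i ∉ s, y i = 0) ∧
      ∀ i, ∑ j ∈ s, min (y j) (y i) = x i := by
  classical
  induction s using Finset.strongInduction generalizing x with
  | H s ih =>
    rcases s.eq_empty_or_nonempty with rfl | hne
    · exact ⟨0, by simp, by simp, fun i => by simp [hs i]⟩
    obtain ⟨i₀, hi₀, hmin⟩ := s.exists_min_image x hne
    obtain ⟨y, hy0, hys, hy⟩ := ih (s.erase i₀) (Finset.erase_ssubset hi₀)
      (fun i => if i ∈ s then x i - x i₀ else 0)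
      (fun i => by
        show 0 ≤ if i ∈ s then x i - x i₀ else 0
        split_ifs with h
        · linarith [hmin i h]
        · exact le_rfl)
      (fun i hi => by
        by_cases h : i = i₀
        · simp [h]
        · have : i ∉ s := fun h' => hi (Finset.mem_erase.2 ⟨h, h'⟩)
          simp [this])
    have hcard : (0 : ℝ) < s.card := by exact_mod_cast hne.card_pos
    refine ⟨fun i => if i ∈ s then y i + x i₀ / s.card else 0, fun i => ?_, fun i hi => by simp [hi],
      fun i => ?_⟩
    · show 0 ≤ if i ∈ s then y i + x i₀ / s.card else 0
      split_ifs
      · exact add_nonneg (hy0 i) (div_nonneg (h0 _) hcard.le)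
      · exact le_rfl
    · by_cases hi : i ∈ s
      · simp only [hi, if_true]
        have h1 : ∀ j ∈ s, min (if j ∈ s then y j + x i₀ / s.card else 0) (y i + x i₀ / s.card) =
            min (y j) (y i) + x i₀ / s.card := fun j hj => by
          rw [if_pos hj, min_add_add_right]
        rw [Finset.sum_congr rfl h1, Finset.sum_add_distrib, ← Finset.sum_erase_add _ _ hi₀,
          hy i, hys i₀ (by simp), min_eq_left (hy0 i)]
        simp only [hi, if_true, Finset.sum_const, nsmul_eq_mul]
        field_simp
        ring
      · simp only [hi, if_false]
        rw [hs i hi]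
        refine Finset.sum_eq_zero fun j hj => min_eq_right ?_
        rw [if_pos hj]
        exact add_nonneg (hy0 j) (div_nonneg (h0 _) hcard.le)

lemma surjective_layerMap : Function.Surjective (layerMap : L1 ι ℝ → C00 ι ℝ) := by
  intro x
  obtain ⟨y, hy0, hys, hy⟩ := exists_sum_min_eq x.toF.support (fun i => |x i|)
    (fun _ => abs_nonneg _) (by intro i hi; simpa using hi)
  have hx : ∀ i, x i = 0 → y i = 0 := fun i hi => hys i (by simpa using hi)
  have habs : ∀ i, |SignType.sign (x i) * y i| = y i := fun i => by
    rcases lt_trichotomy (x i) 0 with h | h | h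
    · simp [sign_neg h, abs_of_nonneg (hy0 i)]
    · simp [h, hx]
    · simp [sign_pos h, abs_of_nonneg (hy0 i)]
  refine ⟨L1.mk (fun i => SignType.sign (x i) * y i) (x.finite_support.subset fun i hi => by
    rw [mem_ofPred_eq] at hi ⊢; exact fun h => hi (by simp [h])), ?_⟩
  ext i
  rw [layerMap, C00.mk_apply, layer_eq_sum (s := x.toF.support)]
  · simp only [L1.mk_apply, habs, hy]
    rcases eq_or_ne (x i) 0 with h | h
    · simp [h]
    have hpos : 0 < y i := by
      refine (hy0 i).lt_of_ne fun h' => h ?_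
      have := hy i
      rw [← h', Finset.sum_eq_zero fun j _ => min_eq_right (hy0 j)] at this
      simpa using this.symm
    rcases h.lt_or_gt with h | h
    · rw [sign_neg h, sign_neg (by simpa using hpos), abs_of_neg h]; simp
    · rw [sign_pos h, sign_pos (by simpa using hpos), abs_of_pos h]; simp
  · intro j hj
    have : x j = 0 := by simpa using hj
    simp [this]

lemma norm_restr_compl_le (y : L1 ι ℝ) (J : Set ι) {r : ℝ} (hr : 0 ≤ r)
    (h : ∀ i ∉ J, layer y i ≤ r) : ‖L1.restr Jᶜ y‖ ≤ r := by
  classical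
  set w := L1.restr Jᶜ y
  rcases w.toF.support.eq_empty_or_nonempty with h0 | hne
  · rw [L1.norm_eq_sum (s := ∅) w (by intro i _; rw [← h0] at *; simp_all)]
    simpa
  obtain ⟨i, hi, hmax⟩ := w.toF.support.exists_max_image (fun i => |y i|) hne
  have hmem : ∀ j ∈ w.toF.support, j ∉ J := fun j hj hJ => by
    rw [Finsupp.mem_support_iff] at hj
    exact hj (L1.restr_apply_notMem y (notMem_compl_iff.2 hJ))
  refine le_trans ?_ (h i (hmem i hi))
  have hsub : w.toF.support ⊆ y.toF.support := fun j hj => by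
    have h1 := hmem j hj
    rw [Finsupp.mem_support_iff] at hj ⊢
    rwa [L1.toF_apply, L1.restr_apply_mem y (mem_compl h1)] at hj
  rw [L1.norm_eq_sum (s := w.toF.support) w (by intro j hj; simpa using hj)]
  refine le_trans (Finset.sum_le_sum fun j hj => ?_) (Finset.sum_le_sum_of_subset_of_nonneg hsub
    fun _ _ _ => le_min (abs_nonneg _) (abs_nonneg _))
  rw [L1.restr_apply_mem y (mem_compl (hmem j hj)), min_eq_left (hmax j hj)]; rfl

lemma isClosedEmbedding_layerMap : Topology.IsClosedEmbedding (layerMap : L1 ι ℝ → C00 ι ℝ) := by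
  refine isClosedEmbedding_of_subseq continuous_layerMap injective_layerMap fun u z hu => ?_
  set s := z.toF.support
  have hzs : ∀ i ∉ s, z i = 0 := by intro i hi; simpa [s] using hi
  obtain ⟨C, hC⟩ := hu.norm.bddAbove_range
  have hb : ∀ n i, |u n i| ≤ C := fun n i => (abs_le_layer _ _).trans <| by
    rw [← abs_layerMap]
    exact (C00.norm_apply_le _ i).trans (hC ⟨n, rfl⟩)
  obtain ⟨a, -, φ, hφ, ha⟩ := tendsto_subseq_of_bounded (x := fun n (i : s) => u n i)
    (isBounded_closedBall (x := (0 : s → ℝ)) (r := C)) (fun n => by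
      rw [mem_closedBall, dist_zero_right, pi_norm_le_iff_of_nonneg ((norm_nonneg _).trans (hC ⟨0, rfl⟩))]
      exact fun i => hb n i)
  classical
  set y : L1 ι ℝ := L1.mk (fun i => if h : i ∈ s then a ⟨i, h⟩ else 0)
    (s.finite_toSet.subset fun i hi => by
      rw [mem_ofPred_eq] at hi; by_contra h; exact hi (dif_neg (by simpa using h)))
  have hys : ∀ i ∉ s, y i = 0 := fun i hi => dif_neg hi
  refine ⟨y, φ, hφ, ?_⟩
  have htail : Tendsto (fun n => ‖L1.restr (s : Set ι)ᶜ (u (φ n))‖) atTop (nhds 0) := by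
    have h0 : Tendsto (fun n => ‖layerMap (u (φ n)) - z‖) atTop (nhds 0) :=
      (tendsto_iff_norm_sub_tendsto_zero.1 hu).comp hφ.tendsto_atTop
    refine squeeze_zero (fun _ => norm_nonneg _) (fun n => ?_) h0
    refine norm_restr_compl_le _ _ (norm_nonneg _) fun i hi => ?_
    have := C00.norm_apply_le (layerMap (u (φ n)) - z) i
    rwa [C00.sub_apply, hzs i (by simpa using hi), sub_zero, Real.norm_eq_abs,
      abs_layerMap] at this
  have hcoord : ∀ i, Tendsto (fun n => u (φ n) i) atTop (nhds (y i)) := fun i => by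
    by_cases hi : i ∈ s
    · have : y i = a ⟨i, hi⟩ := dif_pos hi
      rw [this]
      exact (tendsto_pi_nhds.1 ha) ⟨i, hi⟩
    · rw [hys i hi]
      refine squeeze_zero_norm (fun n => ?_) htail
      have := L1.norm_apply_le (L1.restr (s : Set ι)ᶜ (u (φ n))) i
      rwa [L1.restr_apply_mem _ (by simpa using hi)] at this
  refine L1.tendsto_of hcoord ?_
  have : Tendsto (fun n => ∑ i ∈ s, ‖u (φ n) i‖ + ‖L1.restr (s : Set ι)ᶜ (u (φ n))‖) atTop
      (nhds (∑ i ∈ s, ‖y i‖ + 0)) :=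
    (tendsto_finsetSum _ fun i _ => (hcoord i).norm).add htail
  rw [add_zero, ← L1.norm_eq_sum y hys] at this
  refine this.congr fun n => ?_
  rw [← L1.norm_restr_finset, L1.norm_restr_add]

/-- The `ℓ₁`- and the `c₀`-norm on finitely supported sequences give homeomorphic spaces. -/
noncomputable def layerHomeo (ι : Type*) : L1 ι ℝ ≃ₜ C00 ι ℝ :=
  isClosedEmbedding_layerMap.isEmbedding.toHomeomorphOfSurjective surjective_layerMap

end LayerMap

section Reindex

variable {ι κ E : Type*} [NormedAddCommGroup E]

namespace C00

/-- Extension by zero along an injection. -/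
noncomputable def emb (e : ι ↪ κ) (f : C00 ι E) : C00 κ E :=
  mk (Function.extend e f 0) ((f.finite_support.image e).subset fun k hk => by
    rw [mem_ofPred_eq] at hk
    by_cases hk' : ∃ i, e i = k
    · obtain ⟨i, rfl⟩ := hk'
      rw [e.injective.extend_apply] at hk
      exact ⟨i, hk, rfl⟩
    · exact (hk (Function.extend_apply' _ _ _ hk')).elim)

@[simp] lemma emb_apply (e : ι ↪ κ) (f : C00 ι E) (i : ι) : emb e f (e i) = f i :=
  e.injective.extend_apply _ _ _

lemma emb_apply_notMem (e : ι ↪ κ) (f : C00 ι E) {k : κ} (hk : k ∉ range e) : emb e f k = 0 :=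
  Function.extend_apply' _ _ _ hk

lemma isometry_emb (e : ι ↪ κ) : Isometry (emb e : C00 ι E → C00 κ E) := by
  refine Isometry.of_dist_eq fun f g => ?_
  rw [dist_eq_norm, dist_eq_norm]
  refine le_antisymm ((norm_le_iff (norm_nonneg _)).2 fun k => ?_)
    ((norm_le_iff (norm_nonneg _)).2 fun i => ?_)
  · by_cases hk : k ∈ range e
    · obtain ⟨i, rfl⟩ := hk
      simpa using norm_apply_le (f - g) i
    · simp [emb_apply_notMem e _ hk]
  · simpa using norm_apply_le (emb e f - emb e g) (e i)

lemma isClosedEmbedding_emb (e : ι ↪ κ) :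
    Topology.IsClosedEmbedding (emb e : C00 ι E → C00 κ E) := by
  refine ⟨(isometry_emb e).isEmbedding, ?_⟩
  have : range (emb e : C00 ι E → C00 κ E) = ⋂ k ∈ (range e)ᶜ, {f | f k = 0} := by
    ext f
    simp only [mem_iInter]
    constructor
    · rintro ⟨g, rfl⟩ k hk
      exact emb_apply_notMem e g hk
    · intro h
      refine ⟨mk (fun i => f (e i)) (f.finite_support.preimage e.injective.injOn), ?_⟩
      ext k
      by_cases hk : k ∈ range e
      · obtain ⟨i, rfl⟩ := hk; simp
      · rw [emb_apply_notMem e _ hk]; exact (h k hk).symm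
  rw [this]
  exact isClosed_biInter fun k _ => isClosed_eq (continuous_apply k) continuous_const

/-- Reindexing along a bijection. -/
noncomputable def congrHomeo (e : ι ≃ κ) : C00 ι E ≃ₜ C00 κ E :=
  (isometry_emb e.toEmbedding).isEmbedding.toHomeomorphOfSurjective fun g =>
    ⟨mk (fun i => g (e i)) (g.finite_support.preimage e.injective.injOn), by
      ext k
      obtain ⟨i, rfl⟩ := e.surjective k
      exact emb_apply e.toEmbedding _ i⟩

/-- Families of families are doubly indexed families. -/
noncomputable def uncurry (f : C00 ι (C00 κ E)) : C00 (ι × κ) E :=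
  mk (fun p => f p.1 p.2)
    ((f.finite_support.biUnion fun i _ => ((f i).finite_support.image (Prod.mk i))).subset
      fun p hp => by
        rw [mem_ofPred_eq] at hp
        refine mem_biUnion (x := p.1) ?_ ⟨p.2, hp, rfl⟩
        rw [mem_ofPred_eq]; intro h; exact hp (by simp [h]))

@[simp] lemma uncurry_apply (f : C00 ι (C00 κ E)) (p : ι × κ) : uncurry f p = f p.1 p.2 := rfl

/-- Currying is an isometry. -/
noncomputable def curryHomeo : C00 ι (C00 κ E) ≃ₜ C00 (ι × κ) E := by
  have h : Isometry (uncurry : C00 ι (C00 κ E) → C00 (ι × κ) E) := by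
    refine Isometry.of_dist_eq fun f g => ?_
    rw [dist_eq_norm, dist_eq_norm]
    refine le_antisymm ((norm_le_iff (norm_nonneg _)).2 fun p => ?_)
      ((norm_le_iff (norm_nonneg _)).2 fun i => (norm_le_iff (norm_nonneg _)).2 fun k => ?_)
    · simpa using (norm_apply_le ((f - g) p.1) p.2).trans (norm_apply_le (f - g) p.1)
    · simpa using norm_apply_le (uncurry f - uncurry g) (i, k)
  refine h.isEmbedding.toHomeomorphOfSurjective fun g => ?_
  refine ⟨mk (fun i => mk (fun k => g (i, k))
    (g.finite_support.preimage (Prod.mk_right_injective i).injOn))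
    ((g.finite_support.image Prod.fst).subset fun i hi => ?_), ?_⟩
  · rw [mem_ofPred_eq] at hi
    by_contra h
    refine hi (ext fun k => ?_)
    by_contra h'
    exact h ⟨(i, k), h', rfl⟩
  · ext p; simp

end C00

namespace L1

/-- Families of families are doubly indexed families. -/
noncomputable def uncurry (f : L1 ι (L1 κ E)) : L1 (ι × κ) E :=
  mk (fun p => f p.1 p.2)
    ((f.finite_support.biUnion fun i _ => ((f i).finite_support.image (Prod.mk i))).subset
      fun p hp => by
        rw [mem_ofPred_eq] at hp
        refine mem_biUnion (x := p.1) ?_ ⟨p.2, hp, rfl⟩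
        rw [mem_ofPred_eq]; intro h; exact hp (by simp [h]))

@[simp] lemma uncurry_apply (f : L1 ι (L1 κ E)) (p : ι × κ) : uncurry f p = f p.1 p.2 := rfl

lemma norm_uncurry (f : L1 ι (L1 κ E)) : ‖uncurry f‖ = ‖f‖ := by
  classical
  set s := f.toF.support
  have hs : ∀ i ∉ s, f i = 0 := by intro i hi; simpa [s] using hi
  set t := s.biUnion fun i => (f i).toF.support
  have ht : ∀ i, ∀ k ∉ t, f i k = 0 := by
    intro i k hk
    by_cases hi : i ∈ s
    · by_contra h
      exact hk (Finset.mem_biUnion.2 ⟨i, hi, by simpa using h⟩)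
    · simp [hs i hi]
  rw [norm_eq_sum f hs, norm_eq_sum (s := s ×ˢ t) (uncurry f), Finset.sum_product]
  · exact Finset.sum_congr rfl fun i _ => (norm_eq_sum (f i) (ht i)).symm
  · intro p hp
    rw [Finset.mem_product, not_and_or] at hp
    rcases hp with hp | hp
    · simp [hs _ hp]
    · simp [ht _ _ hp]

/-- Currying is an isometry. -/
noncomputable def curryHomeo : L1 ι (L1 κ E) ≃ₜ L1 (ι × κ) E := by
  have h : Isometry (uncurry : L1 ι (L1 κ E) → L1 (ι × κ) E) := by
    refine Isometry.of_dist_eq fun f g => ?_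
    rw [dist_eq_norm, dist_eq_norm, ← norm_uncurry (f - g)]
    exact congrArg norm (ext fun p => by simp)
  refine h.isEmbedding.toHomeomorphOfSurjective fun g => ?_
  refine ⟨mk (fun i => mk (fun k => g (i, k))
    (g.finite_support.preimage (Prod.mk_right_injective i).injOn))
    ((g.finite_support.image Prod.fst).subset fun i hi => ?_), ?_⟩
  · rw [mem_ofPred_eq] at hi
    by_contra h
    refine hi (ext fun k => ?_)
    by_contra h'
    exact h ⟨(i, k), h', rfl⟩
  · ext p; simp

end L1

/-- A square-like decomposition of an infinite-dimensional `C00`. -/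
noncomputable def C00.natHomeo (κ : Type*) [Infinite κ] : C00 ℕ (C00 κ ℝ) ≃ₜ C00 κ ℝ :=
  C00.curryHomeo.trans (C00.congrHomeo (Classical.choice (by
    rw [← Cardinal.eq]
    simp [Cardinal.aleph0_le_mk])))

/-- A decomposition of an infinite-dimensional `L1`. -/
noncomputable def L1.natHomeo (κ : Type*) [Infinite κ] : L1 ℕ (L1 κ ℝ) ≃ₜ L1 κ ℝ :=
  L1.curryHomeo.trans (((layerHomeo _).trans (C00.congrHomeo (Classical.choice (by
    rw [← Cardinal.eq]
    simp [Cardinal.aleph0_le_mk])))).trans (layerHomeo κ).symm)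

end Reindex

section OpenGauge

variable {X : Type*} [MetricSpace X]

/-- A bounded `1`-Lipschitz function measuring the distance to the complement of `Ω`. -/
noncomputable def openGauge (Ω : Set X) (p : X) : ℝ := (min 1 (infEDist p Ωᶜ)).toReal

lemma openGauge_nonneg (Ω : Set X) (p : X) : 0 ≤ openGauge Ω p := ENNReal.toReal_nonneg

lemma openGauge_le_add (Ω : Set X) (p q : X) : openGauge Ω p ≤ openGauge Ω q + dist p q := by
  have h : min 1 (infEDist p Ωᶜ) ≤ min 1 (infEDist q Ωᶜ) + edist p q := by
    rw [← min_add_add_right]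
    exact min_le_min le_self_add infEDist_le_infEDist_add_edist
  have hq : min 1 (infEDist q Ωᶜ) ≠ ⊤ := ne_top_of_le_ne_top ENNReal.one_ne_top (min_le_left _ _)
  have := ENNReal.toReal_mono (ENNReal.add_ne_top.2 ⟨hq, edist_ne_top p q⟩) h
  rwa [ENNReal.toReal_add hq (edist_ne_top p q), ← dist_edist] at this

lemma openGauge_pos {Ω : Set X} (hΩ : IsOpen Ω) {p : X} : 0 < openGauge Ω p ↔ p ∈ Ω := by
  rw [openGauge, ENNReal.toReal_pos_iff, lt_min_iff]
  have h : min 1 (infEDist p Ωᶜ) < ⊤ := (min_le_left _ _).trans_lt ENNReal.one_lt_top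
  simp only [zero_lt_one, true_and, h, and_true]
  rw [pos_iff_ne_zero, Ne, ← mem_closure_iff_infEDist_zero, hΩ.isClosed_compl.closure_eq]
  simp

lemma abs_openGauge_sub_le (Ω : Set X) (p q : X) :
    |openGauge Ω p - openGauge Ω q| ≤ dist p q := by
  rw [abs_sub_le_iff]
  have h1 := openGauge_le_add Ω p q
  have h2 := openGauge_le_add Ω q p
  rw [dist_comm] at h2
  constructor <;> linarith

lemma continuous_openGauge (Ω : Set X) : Continuous (openGauge Ω) :=
  (LipschitzWith.of_dist_le_mul (K := 1) fun p q => by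
    simpa [Real.dist_eq] using abs_openGauge_sub_le Ω p q).continuous

lemma openGauge_eq_zero {Ω : Set X} (hΩ : IsOpen Ω) {p : X} (hp : p ∉ Ω) : openGauge Ω p = 0 :=
  le_antisymm (not_lt.1 fun h => hp ((openGauge_pos hΩ).1 h)) (openGauge_nonneg _ _)

end OpenGauge

section Radial

variable {A E : Type*} [NormedAddCommGroup E] [NormedSpace ℝ E]

/-- The fibrewise radial map with radial profile `μ a`. -/
noncomputable def radial (μ : A → ℝ → ℝ) (a : A) (w : E) : E := (μ a ‖w‖ / ‖w‖) • w

lemma norm_radial {μ : A → ℝ → ℝ} {a : A} (h0 : μ a 0 = 0) (hμ : ∀ t, 0 ≤ t → 0 ≤ μ a t) (w : E) :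
    ‖radial μ a w‖ = μ a ‖w‖ := by
  rcases eq_or_ne w 0 with rfl | hw
  · simp [radial, h0]
  · have : ‖w‖ ≠ 0 := norm_ne_zero_iff.2 hw
    rw [radial, norm_smul, Real.norm_eq_abs, abs_div, abs_norm, div_mul_cancel₀ _ this,
      abs_of_nonneg (hμ _ (norm_nonneg _))]

@[simp] lemma radial_zero (μ : A → ℝ → ℝ) (a : A) : radial μ a (0 : E) = 0 := by simp [radial]

lemma radial_radial {μ ν : A → ℝ → ℝ} {a : A} (h0 : μ a 0 = 0) (hμ : ∀ t, 0 ≤ t → 0 ≤ μ a t)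
    (h : ∀ t, 0 ≤ t → ν a (μ a t) = t) (w : E) : radial ν a (radial μ a w) = w := by
  rcases eq_or_ne w 0 with rfl | hw
  · simp
  have hn : ‖w‖ ≠ 0 := norm_ne_zero_iff.2 hw
  have hn' : μ a ‖w‖ ≠ 0 := fun h' => hn (by
    have h1 := h _ (norm_nonneg w)
    have h2 := h 0 le_rfl
    rw [h0] at h2; rw [h', h2] at h1; exact h1.symm)
  conv_lhs => rw [radial, norm_radial h0 hμ, h _ (norm_nonneg w), radial, smul_smul]
  rw [div_mul_div_comm, mul_comm, div_self (mul_ne_zero hn' hn), one_smul]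

lemma continuous_radial [TopologicalSpace A] {μ : A → ℝ → ℝ} (hc : Continuous fun p : A × ℝ => μ p.1 p.2)
    (h0 : ∀ a, μ a 0 = 0) (hμ : ∀ a t, 0 ≤ t → 0 ≤ μ a t) :
    Continuous fun p : A × E => radial μ p.1 p.2 := by
  have hc' : Continuous fun p : A × E => μ p.1 ‖p.2‖ :=
    hc.comp (continuous_fst.prodMk continuous_snd.norm)
  rw [continuous_iff_continuousAt]
  rintro ⟨a, w⟩
  rcases eq_or_ne w 0 with rfl | hw
  · have : Tendsto (fun p : A × E => ‖radial μ p.1 p.2‖) (nhds (a, 0)) (nhds 0) := by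
      simp only [norm_radial (h0 _) (hμ _)]
      have := hc'.tendsto (a, 0)
      simpa [h0] using this
    rw [ContinuousAt]
    simpa using tendsto_zero_iff_norm_tendsto_zero.2 this
  · have hn : ‖w‖ ≠ 0 := norm_ne_zero_iff.2 hw
    exact (hc'.continuousAt.div continuous_snd.norm.continuousAt hn).smul continuous_snd.continuousAt

end Radial

section FibrewiseInverse

lemma continuous_invFun_param {A : Type*} [TopologicalSpace A] {m : A → ℝ → ℝ}
    (hc : Continuous fun p : A × ℝ => m p.1 p.2) (hm : ∀ a, StrictMono (m a))
    (hs : ∀ a, Function.Surjective (m a)) :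
    Continuous fun p : A × ℝ => Function.invFun (m p.1) p.2 := by
  have hr : ∀ a u, m a (Function.invFun (m a) u) = u := fun a u =>
    Function.rightInverse_invFun (hs a) u
  rw [continuous_iff_continuousAt]
  rintro ⟨a, u⟩
  refine tendsto_order.2 ⟨fun c hc' => ?_, fun c hc' => ?_⟩
  · have h1 : m a c < u := by rw [← hr a u]; exact hm a hc'
    have h2 : Continuous fun p : A × ℝ => m p.1 c := hc.comp (continuous_fst.prodMk continuous_const)
    filter_upwards [(isOpen_lt h2 continuous_snd).mem_nhds h1] with p hp
    exact (hm p.1).lt_iff_lt.1 (by rw [hr]; exact hp)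
  · have h1 : u < m a c := by rw [← hr a u]; exact hm a hc'
    have h2 : Continuous fun p : A × ℝ => m p.1 c := hc.comp (continuous_fst.prodMk continuous_const)
    filter_upwards [(isOpen_lt continuous_snd h2).mem_nhds h1] with p hp
    exact (hm p.1).lt_iff_lt.1 (by rw [hr]; exact hp)

end FibrewiseInverse

section FactorGauge

variable {A E : Type*} [TopologicalSpace A] [NormedAddCommGroup E]

/-- Scales controlling how far a retraction `r` of `E` onto `i A` moves points near `i A`. -/
structure RetractScale (i : A → E) (r : E → A) where
  /-- the scales -/
  t : ℕ → A → ℝ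
  continuous_t : ∀ k, Continuous (t k)
  t_pos : ∀ k a, 0 < t k a
  t_zero_le : ∀ a, t 0 a ≤ 1
  t_succ_le : ∀ k a, t (k + 1) a ≤ t k a / 8
  t_le_add : ∀ k a b, t k a ≤ t k b + ‖i a - i b‖ / 2
  dist_retract : ∀ k a p, ‖p - i a‖ < t (k + 1) a → ‖i (r p) - i a‖ < t k a / 4

/-- The scale functions on the ambient space. -/
noncomputable def scaleFun (i : A → E) (r : E → A) : ℕ → E → ℝ
  | 0 => fun _ => 1
  | k + 1 => fun p => min (scaleFun i r k p / 8)
      (openGauge {q | ‖i (r q) - q‖ < scaleFun i r k q / 32} p / 2)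

omit [TopologicalSpace A] in
lemma scaleFun_le_add (i : A → E) (r : E → A) (k : ℕ) (p q : E) :
    scaleFun i r k p ≤ scaleFun i r k q + ‖p - q‖ / 2 := by
  induction k with
  | zero => simp only [scaleFun]; linarith [norm_nonneg (p - q)]
  | succ k ih =>
    have h := openGauge_le_add {q | ‖i (r q) - q‖ < scaleFun i r k q / 32} p q
    rw [dist_eq_norm] at h
    simp only [scaleFun]
    rw [← min_add_add_right]
    exact min_le_min (by linarith [norm_nonneg (p - q)]) (by linarith)

omit [TopologicalSpace A] in
lemma continuous_scaleFun (i : A → E) (r : E → A) (k : ℕ) : Continuous (scaleFun i r k) := by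
  refine (LipschitzWith.of_dist_le_mul (K := 1) fun p q => ?_).continuous
  rw [Real.dist_eq, abs_sub_le_iff, NNReal.coe_one, one_mul, dist_eq_norm]
  have h1 := scaleFun_le_add i r k p q
  have h2 := scaleFun_le_add i r k q p
  rw [norm_sub_rev] at h2
  constructor <;> linarith [norm_nonneg (p - q)]

lemma scaleFun_pos {i : A → E} {r : E → A} (hi : Continuous i) (hr : Continuous r)
    (hir : ∀ a, r (i a) = a) (k : ℕ) (a : A) : 0 < scaleFun i r k (i a) := by
  induction k with
  | zero => simp [scaleFun]
  | succ k ih =>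
    refine lt_min (by linarith) (half_pos ((openGauge_pos ?_).2 ?_))
    · exact isOpen_lt ((hi.comp hr).sub continuous_id).norm
        ((continuous_scaleFun i r k).div_const _)
    · rw [mem_ofPred_eq, hir, sub_self, norm_zero]; linarith

/-- Scales exist for every retraction. -/
noncomputable def RetractScale.ofRetract {i : A → E} {r : E → A} (hi : Continuous i)
    (hr : Continuous r) (hir : ∀ a, r (i a) = a) : RetractScale i r where
  t k a := scaleFun i r k (i a)
  continuous_t k := (continuous_scaleFun i r k).comp hi
  t_pos := scaleFun_pos hi hr hir
  t_zero_le a := by simp [scaleFun]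
  t_succ_le k a := min_le_left _ _
  t_le_add k a b := scaleFun_le_add i r k _ _
  dist_retract k a p hp := by
    have h0 := scaleFun_pos hi hr hir k a
    have h1 := scaleFun_le_add i r (k + 1) (i a) p
    rw [norm_sub_rev] at h1
    have h2 : 0 < scaleFun i r (k + 1) p := by
      linarith [norm_nonneg (p - i a)]
    have h3 : 0 < openGauge {q | ‖i (r q) - q‖ < scaleFun i r k q / 32} p := by
      have := h2.trans_le (min_le_right _ _); linarith
    have h4 : ‖i (r p) - p‖ < scaleFun i r k p / 32 :=
      (openGauge_pos (isOpen_lt ((hi.comp hr).sub continuous_id).norm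
        ((continuous_scaleFun i r k).div_const _))).1 h3
    have h5 := scaleFun_le_add i r k p (i a)
    have h6 : scaleFun i r (k + 1) (i a) ≤ scaleFun i r k (i a) / 8 := min_le_left _ _
    have h7 := norm_add_le (i (r p) - p) (p - i a)
    rw [sub_add_sub_cancel] at h7
    linarith

namespace RetractScale

variable {i : A → E} {r : E → A} (S : RetractScale i r)
include S

lemma t_le_pow (k : ℕ) (a : A) : S.t k a ≤ (1 / 8) ^ k := by
  induction k with
  | zero => simpa using S.t_zero_le a
  | succ k ih => rw [pow_succ]; linarith [S.t_succ_le k a]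

lemma t_add_le (k j : ℕ) (a : A) : S.t (k + j) a ≤ (1 / 8) ^ j * S.t k a := by
  induction j with
  | zero => simp
  | succ j ih =>
    rw [pow_succ, ← add_assoc]; linarith [S.t_succ_le (k + j) a]

/-- The gauge measuring distances to `i a` on the scales `t k a`. -/
noncomputable def gauge (a : A) (u : ℝ) : ℝ :=
  u + ∑' k : ℕ, (1 / 2) ^ k * min 1 (max 0 (u / S.t k a))

lemma gauge_term_nonneg (a : A) (u : ℝ) (k : ℕ) :
    0 ≤ (1 / 2 : ℝ) ^ k * min 1 (max 0 (u / S.t k a)) :=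
  mul_nonneg (by positivity) (le_min zero_le_one (le_max_left _ _))

lemma gauge_term_le (a : A) (u : ℝ) (k : ℕ) :
    (1 / 2 : ℝ) ^ k * min 1 (max 0 (u / S.t k a)) ≤ (1 / 2) ^ k :=
  mul_le_of_le_one_right (by positivity) (min_le_left _ _)

lemma summable_gauge (a : A) (u : ℝ) :
    Summable fun k : ℕ => (1 / 2 : ℝ) ^ k * min 1 (max 0 (u / S.t k a)) :=
  Summable.of_nonneg_of_le (S.gauge_term_nonneg a u) (S.gauge_term_le a u) summable_geometric_two

lemma continuous_gauge : Continuous fun p : A × ℝ => S.gauge p.1 p.2 := by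
  refine continuous_snd.add (continuous_tsum (u := fun k => (1 / 2 : ℝ) ^ k) (fun k => ?_)
    summable_geometric_two fun k p => ?_)
  · exact continuous_const.mul (continuous_const.min (continuous_const.max
      (continuous_snd.div ((S.continuous_t k).comp continuous_fst) fun p => (S.t_pos k _).ne')))
  · rw [Real.norm_eq_abs, abs_of_nonneg (S.gauge_term_nonneg _ _ _)]
    exact S.gauge_term_le _ _ _

lemma strictMono_gauge (a : A) : StrictMono (S.gauge a) := fun u v huv =>
  add_lt_add_of_lt_of_le huv <| (S.summable_gauge a u).tsum_le_tsum (fun k =>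
    mul_le_mul_of_nonneg_left (min_le_min le_rfl (max_le_max le_rfl
      (div_le_div_of_nonneg_right huv.le (S.t_pos k a).le))) (by positivity)) (S.summable_gauge a v)

lemma le_gauge (a : A) (u : ℝ) : u ≤ S.gauge a u :=
  le_add_of_nonneg_right (tsum_nonneg (S.gauge_term_nonneg a u))

lemma gauge_zero (a : A) : S.gauge a 0 = 0 := by simp [gauge]

lemma gauge_nonneg (a : A) (u : ℝ) (hu : 0 ≤ u) : 0 ≤ S.gauge a u := hu.trans (S.le_gauge a u)

lemma surjective_gauge (a : A) : Function.Surjective (S.gauge a) := by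
  refine Continuous.surjective (S.continuous_gauge.comp (Continuous.prodMk_right a))
    (tendsto_atTop_mono (S.le_gauge a) tendsto_id) ?_
  refine tendsto_atBot_mono (fun u => (?_ : S.gauge a u ≤ u + 2))
    (tendsto_atBot_add_const_right _ _ tendsto_id)
  refine add_le_add_right ?_ _
  exact ((S.summable_gauge a u).tsum_le_tsum (S.gauge_term_le a u)
    summable_geometric_two).trans tsum_geometric_two.le

lemma lt_of_gauge_lt {a : A} {u : ℝ} {K : ℕ} (h : S.gauge a u < (1 / 2) ^ K) :
    u < S.t K a := by
  by_contra! hu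
  have h0 : 0 ≤ u := (S.t_pos K a).le.trans hu
  have h1 : (1 / 2 : ℝ) ^ K ≤ ∑' k : ℕ, (1 / 2 : ℝ) ^ k * min 1 (max 0 (u / S.t k a)) := by
    refine le_trans ?_ ((S.summable_gauge a u).le_tsum K fun k _ => S.gauge_term_nonneg a u k)
    rw [min_eq_left, mul_one]
    exact le_max_of_le_right ((one_le_div (S.t_pos K a)).2 hu)
  rw [gauge] at h
  linarith

lemma sum_pow_div_le (a : A) (K : ℕ) :
    ∑ k ∈ Finset.range K, (1 / 2 : ℝ) ^ k / S.t k a ≤ (1 / 2) ^ K / S.t K a := by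
  induction K with
  | zero => simpa using (S.t_pos 0 a).le
  | succ K ih =>
    rw [Finset.sum_range_succ]
    have h0 := S.t_pos K a
    have h1 := S.t_pos (K + 1) a
    have : 2 * ((1 / 2 : ℝ) ^ K / S.t K a) ≤ (1 / 2) ^ (K + 1) / S.t (K + 1) a := by
      rw [← mul_div_assoc, div_le_div_iff₀ h0 h1, pow_succ]
      have h2 := S.t_succ_le K a
      have h3 : (0 : ℝ) < (1 / 2) ^ K := by positivity
      nlinarith
    linarith

lemma gauge_le {a : A} {u : ℝ} {K : ℕ} (h0 : 0 ≤ u) (h : u < S.t K a) :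
    S.gauge a u ≤ 4 * (1 / 2) ^ K := by
  have hK := S.t_pos K a
  have h1 : ∑ k ∈ Finset.range K, (1 / 2 : ℝ) ^ k * min 1 (max 0 (u / S.t k a)) ≤ (1 / 2) ^ K := by
    calc _ ≤ ∑ k ∈ Finset.range K, u * ((1 / 2 : ℝ) ^ k / S.t k a) := by
          refine Finset.sum_le_sum fun k _ => ?_
          have : min 1 (max 0 (u / S.t k a)) ≤ u / S.t k a :=
            (min_le_right _ _).trans (max_le (div_nonneg h0 (S.t_pos k a).le) le_rfl)
          calc _ ≤ (1 / 2 : ℝ) ^ k * (u / S.t k a) := mul_le_mul_of_nonneg_left this (by positivity)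
            _ = _ := by ring
      _ ≤ S.t K a * ((1 / 2) ^ K / S.t K a) := by
          rw [← Finset.mul_sum]
          exact mul_le_mul h.le (S.sum_pow_div_le a K)
            (Finset.sum_nonneg fun k _ => div_nonneg (by positivity) (S.t_pos k a).le) hK.le
      _ = _ := by field_simp
  have h2 : ∑' k : ℕ, (1 / 2 : ℝ) ^ (k + K) * min 1 (max 0 (u / S.t (k + K) a)) ≤
      2 * (1 / 2) ^ K := by
    have hs : Summable fun k : ℕ => (1 / 2 : ℝ) ^ (k + K) := by
      simp only [pow_add]; exact summable_geometric_two.mul_right _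
    calc _ ≤ ∑' k : ℕ, (1 / 2 : ℝ) ^ (k + K) :=
          ((summable_nat_add_iff K).2 (S.summable_gauge a u)).tsum_le_tsum
            (fun k => S.gauge_term_le a u _) hs
      _ = _ := by simp only [pow_add]; rw [tsum_mul_right, tsum_geometric_two]
  have h3 : S.t K a ≤ (1 / 2) ^ K :=
    (S.t_le_pow K a).trans (pow_le_pow_left₀ (by norm_num) (by norm_num) K)
  rw [gauge, ← (S.summable_gauge a u).sum_add_tsum_nat_add K]
  linarith

/-- The inverse gauge. -/
noncomputable def invGauge (a : A) : ℝ → ℝ := Function.invFun (S.gauge a)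

lemma gauge_invGauge (a : A) (u : ℝ) : S.gauge a (S.invGauge a u) = u :=
  Function.rightInverse_invFun (S.surjective_gauge a) u

lemma invGauge_gauge (a : A) (u : ℝ) : S.invGauge a (S.gauge a u) = u :=
  Function.leftInverse_invFun (S.strictMono_gauge a).injective u

lemma invGauge_zero (a : A) : S.invGauge a 0 = 0 := by
  have := S.invGauge_gauge a 0
  rwa [S.gauge_zero] at this

lemma invGauge_nonneg (a : A) (u : ℝ) (hu : 0 ≤ u) : 0 ≤ S.invGauge a u := by
  rw [← (S.strictMono_gauge a).le_iff_le, S.gauge_zero, S.gauge_invGauge]; exact hu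

lemma continuous_invGauge : Continuous fun p : A × ℝ => S.invGauge p.1 p.2 :=
  continuous_invFun_param S.continuous_gauge S.strictMono_gauge S.surjective_gauge

variable [NormedSpace ℝ E]

/-- Fibrewise rescaling by the gauge. -/
noncomputable def scale (a : A) (w : E) : E := radial S.gauge a w

/-- The inverse of `scale`. -/
noncomputable def unscale (a : A) (w : E) : E := radial S.invGauge a w

lemma continuous_scale : Continuous fun p : A × E => S.scale p.1 p.2 :=
  continuous_radial S.continuous_gauge S.gauge_zero S.gauge_nonneg

lemma continuous_unscale : Continuous fun p : A × E => S.unscale p.1 p.2 :=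
  continuous_radial S.continuous_invGauge S.invGauge_zero S.invGauge_nonneg

@[simp] lemma scale_unscale (a : A) (w : E) : S.scale a (S.unscale a w) = w :=
  radial_radial (S.invGauge_zero a) (S.invGauge_nonneg a) (fun t _ => S.gauge_invGauge a t) w

@[simp] lemma unscale_scale (a : A) (w : E) : S.unscale a (S.scale a w) = w :=
  radial_radial (S.gauge_zero a) (S.gauge_nonneg a) (fun t _ => S.invGauge_gauge a t) w

@[simp] lemma scale_zero (a : A) : S.scale a (0 : E) = 0 := radial_zero _ _

@[simp] lemma unscale_zero (a : A) : S.unscale a (0 : E) = 0 := radial_zero _ _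

lemma norm_scale_le {a : A} {w : E} {K : ℕ} (h : ‖w‖ < S.t K a) :
    ‖S.scale a w‖ ≤ 4 * (1 / 2) ^ K := by
  rw [scale, norm_radial (S.gauge_zero a) (S.gauge_nonneg a)]
  exact S.gauge_le (norm_nonneg _) h

lemma norm_unscale_lt {a : A} {w : E} {K : ℕ} (h : ‖w‖ < (1 / 2) ^ K) :
    ‖S.unscale a w‖ < S.t K a := by
  rw [unscale, norm_radial (S.invGauge_zero a) (S.invGauge_nonneg a)]
  exact S.lt_of_gauge_lt (by rwa [S.gauge_invGauge])

end RetractScale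

end FactorGauge

section FactorTheorem

variable {A E : Type*} [TopologicalSpace A] [NormedAddCommGroup E] [NormedSpace ℝ E]

namespace RetractScale

variable {i : A → E} {r : E → A} (S : RetractScale i r)
include S

/-- The points `i s + w n` determined by a base point and rescaled offsets. -/
noncomputable def offsetPt (s : A) (x : ℕ → E) (n : ℕ) : E :=
  i s + S.unscale s ((1 / 2 : ℝ) ^ n • x n)

omit S [NormedSpace ℝ E] [TopologicalSpace A] in
/-- The retraction of the previous point of a sequence. -/
def prevPt (r : E → A) (p : ℕ → E) : ℕ → A
  | 0 => r 0
  | n + 1 => r (p n)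

/-- The coordinates of a sequence of points relative to the previous retracted points. -/
noncomputable def stepCoord (s : A) (x : ℕ → E) (n : ℕ) : E :=
  (2 : ℝ) ^ n • S.scale (prevPt r (S.offsetPt s x) n)
    (S.offsetPt s x n - i (prevPt r (S.offsetPt s x) n))

/-- The sequence of retracted points recovered from step coordinates. -/
noncomputable def walk (z : ℕ → E) : ℕ → A
  | 0 => r 0
  | n + 1 => r (i (walk z n) + S.unscale (walk z n) ((1 / 2 : ℝ) ^ n • z n))

/-- The sequence of points recovered from step coordinates. -/
noncomputable def walkPt (z : ℕ → E) (n : ℕ) : E :=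
  i (S.walk z n) + S.unscale (S.walk z n) ((1 / 2 : ℝ) ^ n • z n)

lemma walk_succ (z : ℕ → E) (n : ℕ) : S.walk z (n + 1) = r (S.walkPt z n) := rfl

lemma walk_eq_of_le (hir : ∀ a, r (i a) = a) {z : ℕ → E} {N n : ℕ} (hz : ∀ n, N ≤ n → z n = 0)
    (hn : N ≤ n) : S.walk z n = S.walk z N := by
  induction n, hn using Nat.le_induction with
  | base => rfl
  | succ n hn ih => rw [walk_succ, walkPt, hz n hn]; simp [hir, ih]

lemma walkPt_eq_of_le (hir : ∀ a, r (i a) = a) {z : ℕ → E} {N n : ℕ} (hz : ∀ n, N ≤ n → z n = 0)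
    (hn : N ≤ n) : S.walkPt z n = i (S.walk z N) := by
  rw [walkPt, hz n hn, S.walk_eq_of_le hir hz hn]; simp

lemma stepCoord_eq_zero (hir : ∀ a, r (i a) = a) {s : A} {x : ℕ → E} {N n : ℕ}
    (hx : ∀ n, N ≤ n → x n = 0) (hn : N + 1 ≤ n) : S.stepCoord s x n = 0 := by
  obtain ⟨n, rfl⟩ : ∃ m, n = m + 1 := ⟨n - 1, by omega⟩
  simp [stepCoord, prevPt, offsetPt, hx n (by omega), hx (n + 1) (by omega), hir]

lemma walk_stepCoord (s : A) (x : ℕ → E) (n : ℕ) :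
    S.walk (S.stepCoord s x) n = prevPt r (S.offsetPt s x) n ∧
      S.walkPt (S.stepCoord s x) n = S.offsetPt s x n := by
  have key : ∀ n, S.walk (S.stepCoord s x) n = prevPt r (S.offsetPt s x) n →
      S.walkPt (S.stepCoord s x) n = S.offsetPt s x n := by
    intro n hn
    rw [walkPt, hn, stepCoord, smul_smul, ← mul_pow]
    simp
  induction n with
  | zero => exact ⟨rfl, key 0 rfl⟩
  | succ n ih =>
    have h : S.walk (S.stepCoord s x) (n + 1) = prevPt r (S.offsetPt s x) (n + 1) := by
      rw [walk_succ, ih.2, prevPt]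
    exact ⟨h, key _ h⟩

/-- The coordinates of the recovered points relative to `s`. -/
noncomputable def offsetCoord (s : A) (z : ℕ → E) (n : ℕ) : E :=
  (2 : ℝ) ^ n • S.scale s (S.walkPt z n - i s)

lemma offsetPt_offsetCoord (s : A) (z : ℕ → E) : S.offsetPt s (S.offsetCoord s z) = S.walkPt z := by
  ext n
  rw [offsetPt, offsetCoord, smul_smul, ← mul_pow]
  simp

lemma prevPt_walkPt (z : ℕ → E) (n : ℕ) : prevPt r (S.walkPt z) n = S.walk z n := by
  cases n <;> rfl

lemma stepCoord_offsetCoord (s : A) (z : ℕ → E) : S.stepCoord s (S.offsetCoord s z) = z := by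
  ext n
  rw [stepCoord, offsetPt_offsetCoord, prevPt_walkPt, walkPt, add_sub_cancel_left, scale_unscale,
    smul_smul, ← mul_pow]
  simp

lemma norm_stepCoord_le (s : A) (x : ℕ → E) (L n : ℕ) (hL : 0 < L)
    (h0 : ‖x n‖ < (1 / 2) ^ L) (h1 : ‖x (n + 1)‖ < (1 / 2) ^ L) :
    ‖S.stepCoord s x (n + 1)‖ ≤ 16 * (1 / 2) ^ L := by
  obtain ⟨K, hK⟩ : ∃ K, L + n = K + 1 := ⟨L + n - 1, by omega⟩
  have hw : ∀ m, ‖x m‖ < (1 / 2) ^ L → ‖S.offsetPt s x m - i s‖ < S.t (L + m) s := fun m hm => by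
    rw [offsetPt, add_sub_cancel_left]
    refine S.norm_unscale_lt ?_
    rw [norm_smul, norm_pow, pow_add, mul_comm]
    simp only [one_div, norm_inv, Real.norm_ofNat]
    simp only [one_div] at hm
    exact mul_lt_mul_of_pos_right hm (by positivity)
  have h2 := hw n h0
  have h3 := hw (n + 1) h1
  rw [← add_assoc, hK] at h3
  rw [hK] at h2
  set a := prevPt r (S.offsetPt s x) (n + 1) with ha
  have ha' : a = r (S.offsetPt s x n) := rfl
  have h4 := S.dist_retract K s _ h2
  rw [← ha'] at h4
  have h5 := S.t_succ_le K s
  have h6 := S.t_succ_le (K + 1) s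
  have h7 := S.t_le_add K s a
  have h8 := S.t_pos K s
  rw [norm_sub_rev] at h7
  have h9 : ‖S.offsetPt s x (n + 1) - i a‖ < S.t K a := by
    have := norm_sub_le_norm_sub_add_norm_sub (S.offsetPt s x (n + 1)) (i s) (i a)
    rw [norm_sub_rev (i s)] at this
    linarith
  rw [stepCoord, norm_smul]
  have h10 := S.norm_scale_le h9
  simp only [norm_pow, Real.norm_ofNat]
  calc (2 : ℝ) ^ (n + 1) * _ ≤ 2 ^ (n + 1) * (4 * (1 / 2) ^ K) :=
        mul_le_mul_of_nonneg_left h10 (by positivity)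
    _ = 2 ^ n * (16 * (1 / 2) ^ (K + 1)) := by ring
    _ = (2 ^ n * (1 / 2) ^ n) * (16 * (1 / 2) ^ L) := by rw [← hK]; ring
    _ = _ := by rw [← mul_pow]; norm_num

lemma norm_walk_sub_le (z : ℕ → E) (K n : ℕ)
    (h : ∀ j, ‖z (n + j)‖ < (1 / 2) ^ (K + 1) * 2 ^ n) (j : ℕ) :
    ‖i (S.walk z (n + j)) - i (S.walk z n)‖ ≤ (1 - (1 / 8) ^ j) * (S.t K (S.walk z n) / 2) := by
  induction j with
  | zero => simp
  | succ j ih =>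
    have h1 : ‖S.walkPt z (n + j) - i (S.walk z (n + j))‖ < S.t (K + j + 1) (S.walk z (n + j)) := by
      rw [walkPt, add_sub_cancel_left]
      refine S.norm_unscale_lt ?_
      rw [norm_smul, norm_pow]
      calc _ < ‖(1 / 2 : ℝ)‖ ^ (n + j) * ((1 / 2) ^ (K + 1) * 2 ^ n) :=
            mul_lt_mul_of_pos_left (h j) (pow_pos (by norm_num) _)
        _ = (1 / 2) ^ (K + j + 1) * ((1 / 2) ^ n * 2 ^ n) := by
            rw [Real.norm_of_nonneg (by norm_num)]; ring
        _ = _ := by rw [← mul_pow]; norm_num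
    have h2 : ‖i (S.walk z (n + j + 1)) - i (S.walk z (n + j))‖ < S.t (K + j) (S.walk z (n + j)) / 4 :=
      S.dist_retract _ _ _ h1
    have h3 := S.t_add_le K j (S.walk z (n + j))
    have h4 := S.t_le_add K (S.walk z (n + j)) (S.walk z n)
    have h5 := S.t_pos K (S.walk z n)
    have h6 : (0 : ℝ) < (1 / 8) ^ j := by positivity
    have h7 := norm_sub_le_norm_sub_add_norm_sub (i (S.walk z (n + j + 1))) (i (S.walk z (n + j)))
      (i (S.walk z n))
    have h8 : S.t K (S.walk z (n + j)) ≤ 5 / 4 * S.t K (S.walk z n) := by nlinarith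
    rw [← add_assoc, pow_succ]
    nlinarith

lemma norm_offsetCoord_le (hir : ∀ a, r (i a) = a) (z : ℕ → E) (K n N : ℕ)
    (hN : ∀ n, N ≤ n → z n = 0)
    (h : ∀ m, n ≤ m → ‖z m‖ < (1 / 2) ^ (K + 1) * 2 ^ n) :
    ‖i (S.walk z N) - i (S.walk z n)‖ ≤ (1 / 8) ^ K ∧
      ‖S.offsetCoord (S.walk z N) z n‖ ≤ 2 ^ n * (4 * (1 / 2) ^ K) := by
  have h0 : ‖i (S.walk z N) - i (S.walk z n)‖ ≤ S.t K (S.walk z n) / 2 := by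
    rw [← S.walk_eq_of_le hir hN (Nat.le_add_left N n)]
    refine (S.norm_walk_sub_le z K n (fun j => h _ (by omega)) N).trans ?_
    have : (0 : ℝ) < (1 / 8) ^ N := by positivity
    nlinarith [S.t_pos K (S.walk z n)]
  refine ⟨by linarith [S.t_le_pow K (S.walk z n), S.t_pos K (S.walk z n)], ?_⟩
  have h1 : ‖S.walkPt z n - i (S.walk z n)‖ < S.t (K + 1) (S.walk z n) := by
    rw [walkPt, add_sub_cancel_left]
    refine S.norm_unscale_lt ?_
    rw [norm_smul, norm_pow]
    calc _ < ‖(1 / 2 : ℝ)‖ ^ n * ((1 / 2) ^ (K + 1) * 2 ^ n) :=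
          mul_lt_mul_of_pos_left (h n le_rfl) (pow_pos (by norm_num) _)
      _ = (1 / 2) ^ (K + 1) * ((1 / 2) ^ n * 2 ^ n) := by
          rw [Real.norm_of_nonneg (by norm_num)]; ring
      _ = _ := by rw [← mul_pow]; norm_num
  have h2 : ‖S.walkPt z n - i (S.walk z N)‖ < S.t K (S.walk z N) := by
    have h3 := norm_sub_le_norm_sub_add_norm_sub (S.walkPt z n) (i (S.walk z n)) (i (S.walk z N))
    have h4 := S.t_succ_le K (S.walk z n)
    have h5 := S.t_le_add K (S.walk z n) (S.walk z N)
    rw [norm_sub_rev] at h0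
    linarith [S.t_pos K (S.walk z n)]
  rw [offsetCoord, norm_smul]
  simp only [norm_pow, Real.norm_ofNat]
  exact mul_le_mul_of_nonneg_left (S.norm_scale_le h2) (by positivity)

end RetractScale

omit [NormedSpace ℝ E] in
lemma C00.exists_nat_bound (z : C00 ℕ E) : ∃ N, ∀ n, N ≤ n → z n = 0 := by
  obtain ⟨N, hN⟩ := z.finite_support.bddAbove
  refine ⟨N + 1, fun n hn => ?_⟩
  by_contra h
  have := hN h
  omega

set_option maxHeartbeats 1000000 in
/-- A retract `A` of a normed space `E` is a factor of `C00 ℕ E`. -/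
theorem nonempty_prod_homeomorph_of_retract {i : A → E} {r : E → A} (hi : Continuous i)
    (hr : Continuous r) (hir : ∀ a, r (i a) = a) : Nonempty (A × C00 ℕ E ≃ₜ C00 ℕ E) := by
  have S : RetractScale i r := .ofRetract hi hr hir
  choose bd hbd using C00.exists_nat_bound (E := E)
  have hF : ∀ p : A × C00 ℕ E, {n | S.stepCoord p.1 p.2 n ≠ 0}.Finite := fun p =>
    (finite_Iio (bd p.2 + 1)).subset fun n hn => by
      by_contra h
      exact hn (S.stepCoord_eq_zero hir (hbd p.2) (by simpa using h))
  have hG : ∀ z : C00 ℕ E, {n | S.offsetCoord (S.walk z (bd z)) z n ≠ 0}.Finite := fun z =>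
    (finite_Iio (bd z)).subset fun n hn => by
      by_contra h
      refine hn ?_
      rw [RetractScale.offsetCoord, S.walkPt_eq_of_le hir (hbd z) (by simpa using h)]
      simp
  have hcont_off : ∀ n, Continuous fun p : A × C00 ℕ E => S.offsetPt p.1 p.2 n := fun n =>
    (hi.comp continuous_fst).add (S.continuous_unscale.comp (continuous_fst.prodMk
      (((C00.continuous_apply n).comp continuous_snd).const_smul _)))
  have hcont_walk : ∀ n, Continuous (fun z : C00 ℕ E => S.walk z n) ∧
      Continuous fun z : C00 ℕ E => S.walkPt z n := by
    have key : ∀ n, Continuous (fun z : C00 ℕ E => S.walk z n) →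
        Continuous fun z : C00 ℕ E => S.walkPt z n := fun n hn =>
      (hi.comp hn).add (S.continuous_unscale.comp (hn.prodMk
        ((C00.continuous_apply n).const_smul _)))
    intro n
    induction n with
    | zero => exact ⟨continuous_const, key 0 continuous_const⟩
    | succ n ih =>
      have h : Continuous (fun z : C00 ℕ E => S.walk z (n + 1)) := hr.comp ih.2
      exact ⟨h, key _ h⟩
  have hcont_oc : ∀ n, (Continuous fun z : C00 ℕ E => S.walk z (bd z)) →
      Continuous fun z : C00 ℕ E => S.offsetCoord (S.walk z (bd z)) z n := fun n h => by
    have h1 : Continuous fun z : C00 ℕ E => S.walkPt z n - i (S.walk z (bd z)) :=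
      (hcont_walk n).2.sub (hi.comp h)
    exact (S.continuous_scale.comp (h.prodMk h1)).const_smul ((2 : ℝ) ^ n)
  have hpow : ∀ ε > 0, ∃ L, 0 < L ∧ (16 : ℝ) * (1 / 2) ^ L < ε := by
    intro ε hε
    obtain ⟨L, hL⟩ := exists_pow_lt_of_lt_one (show (0 : ℝ) < ε / 16 by positivity)
      (show (1 / 2 : ℝ) < 1 by norm_num)
    refine ⟨L + 1, by omega, ?_⟩
    have : (0 : ℝ) < (1 / 2) ^ L := by positivity
    rw [pow_succ]; linarith
  have htail : ∀ (z₀ : C00 ℕ E) (L : ℕ), ∀ᶠ z in nhds z₀, ∀ n, bd z₀ ≤ n → ‖z n‖ < (1 / 2) ^ L := by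
    intro z₀ L
    filter_upwards [C00.eventually_tail z₀ (show (0 : ℝ) < (1 / 2) ^ L by positivity)]
      with z hz n hn using hz n (hbd z₀ n hn)
  have hcont_base : Continuous fun z : C00 ℕ E => S.walk z (bd z) := by
    suffices h : Continuous fun z : C00 ℕ E => i (S.walk z (bd z)) by
      have := hr.comp h
      simpa [Function.comp_def, hir] using this
    rw [continuous_iff_continuousAt]
    intro z₀
    rw [ContinuousAt, Metric.tendsto_nhds]
    intro ε hε
    obtain ⟨L, hL0, hL⟩ := hpow (ε / 2) (half_pos hε)
    have h2 := Metric.tendsto_nhds.1 ((hi.comp (hcont_walk (bd z₀)).1).tendsto z₀) (ε / 2) (half_pos hε)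
    filter_upwards [htail z₀ (L + 1), h2] with z hz hz2
    have h3 := (S.norm_offsetCoord_le hir z L (bd z₀) (bd z) (hbd z) fun m hm =>
      (hz m hm).trans_le (le_mul_of_one_le_right (by positivity) (one_le_pow₀ (by norm_num)))).1
    have h4 : (1 / 8 : ℝ) ^ L ≤ (1 / 2) ^ L := pow_le_pow_left₀ (by norm_num) (by norm_num) L
    have h5 := dist_triangle (i (S.walk z (bd z))) (i (S.walk z (bd z₀))) (i (S.walk z₀ (bd z₀)))
    rw [dist_eq_norm (i (S.walk z (bd z)))  (i (S.walk z (bd z₀)))] at h5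
    have h6 : (0 : ℝ) < (1 / 2) ^ L := by positivity
    simp only [Function.comp] at hz2
    linarith
  refine ⟨{
    toFun := fun p => C00.mk (S.stepCoord p.1 p.2) (hF p)
    invFun := fun z => (S.walk z (bd z), C00.mk (S.offsetCoord (S.walk z (bd z)) z) (hG z))
    left_inv := fun p => ?_
    right_inv := fun z => ?_
    continuous_toFun := ?_
    continuous_invFun := ?_ }⟩
  · set z := C00.mk (S.stepCoord p.1 p.2) (hF p)
    have hz : (z : ℕ → E) = S.stepCoord p.1 p.2 := rfl
    have h1 : S.walk z (bd z) = p.1 := by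
      rw [← S.walk_eq_of_le hir (hbd z) (show bd z ≤ bd z + bd p.2 + 1 by omega), hz,
        (S.walk_stepCoord _ _ _).1, RetractScale.prevPt, RetractScale.offsetPt,
        hbd p.2 _ (by omega)]
      simp [hir]
    refine Prod.ext h1 (C00.ext fun n => ?_)
    rw [C00.mk_apply, h1, RetractScale.offsetCoord, hz, (S.walk_stepCoord _ _ _).2,
      RetractScale.offsetPt, add_sub_cancel_left, RetractScale.scale_unscale, smul_smul, ← mul_pow]
    simp
  · refine C00.ext fun n => ?_
    have := congrFun (S.stepCoord_offsetCoord (S.walk z (bd z)) z) n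
    exact this
  · rw [continuous_iff_continuousAt]
    rintro ⟨s₀, x₀⟩
    refine C00.tendsto_of (fun n => ?_) fun ε hε => ?_
    · have hp : Continuous fun p : A × C00 ℕ E => RetractScale.prevPt r (S.offsetPt p.1 p.2) n := by
        cases n with
        | zero => exact continuous_const
        | succ n => exact hr.comp (hcont_off n)
      exact Continuous.tendsto ((S.continuous_scale.comp (hp.prodMk
        ((hcont_off n).sub (hi.comp hp)))).const_smul _) (s₀, x₀)
    · obtain ⟨L, hL0, hL⟩ := hpow ε hε
      refine ⟨Iio (bd x₀ + 1), finite_Iio _, ?_⟩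
      filter_upwards [(continuous_snd.tendsto (s₀, x₀)).eventually (htail x₀ L)] with p hp n hn
      obtain ⟨m, rfl⟩ : ∃ m, n = m + 1 := ⟨n - 1, by simp at hn; omega⟩
      simp only [mem_Iio, not_lt, add_le_add_iff_right] at hn
      exact (S.norm_stepCoord_le p.1 p.2 L m hL0 (hp m hn) (hp (m + 1) (by omega))).trans hL.le
  · refine hcont_base.prodMk ?_
    rw [continuous_iff_continuousAt]
    intro z₀
    refine C00.tendsto_of (fun n => ?_) fun ε hε => ?_
    · exact (hcont_oc n hcont_base).tendsto z₀
    · obtain ⟨L, hL0, hL⟩ := hpow ε hε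
      refine ⟨Iio (bd z₀), finite_Iio _, ?_⟩
      filter_upwards [htail z₀ L] with z hz n hn
      rw [mem_Iio, not_lt] at hn
      obtain ⟨K, hK⟩ : ∃ K, L + n = K + 1 := ⟨L + n - 1, by omega⟩
      have e : (1 / 2 : ℝ) ^ (K + 1) * 2 ^ n = (1 / 2) ^ L := by
        rw [← hK, pow_add, mul_assoc, ← mul_pow]; norm_num
      have h1 := (S.norm_offsetCoord_le hir z K n (bd z) (hbd z) fun m hm => by
        rw [e]; exact hz m (hn.trans hm)).2
      refine h1.trans ?_
      have : (2 : ℝ) ^ n * (4 * (1 / 2) ^ K) = 8 * ((1 / 2 : ℝ) ^ (K + 1) * 2 ^ n) := by ring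
      rw [this, e]
      have : (0 : ℝ) < (1 / 2) ^ L := by positivity
      linarith

end FactorTheorem

namespace FinHyp

section Basic

variable {X Y T : Type*} [MetricSpace X] [MetricSpace Y] [TopologicalSpace T]

/-- The member of the hyperspace with a given underlying finite set. -/
def mk (s : Set X) (hne : s.Nonempty) (hs : s.Finite) : FinHyp X :=
  ⟨⟨⟨s, hs.isCompact⟩, hne⟩, hs⟩

@[simp] lemma toSet_mk (s : Set X) (hne : s.Nonempty) (hs : s.Finite) :
    (mk s hne hs).toSet = s := rfl

lemma nonempty_toSet (A : FinHyp X) : A.toSet.Nonempty := A.1.nonempty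

lemma finite_toSet (A : FinHyp X) : A.toSet.Finite := A.2

lemma ext {A B : FinHyp X} (h : A.toSet = B.toSet) : A = B :=
  Subtype.ext (SetLike.coe_injective h)

lemma dist_eq (A B : FinHyp X) : dist A B = hausdorffDist A.toSet B.toSet := rfl

lemma exists_dist_le (A B : FinHyp X) {a : X} (ha : a ∈ A.toSet) :
    ∃ b ∈ B.toSet, dist a b ≤ dist A B := by
  obtain ⟨b, hb, h⟩ := B.finite_toSet.isCompact.exists_infDist_eq_dist B.nonempty_toSet a
  refine ⟨b, hb, h ▸ ?_⟩
  exact infDist_le_hausdorffDist_of_mem ha (hausdorffEDist_ne_top_of_nonempty_of_bounded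
    A.nonempty_toSet B.nonempty_toSet A.finite_toSet.isBounded B.finite_toSet.isBounded)

lemma dist_le {A B : FinHyp X} {r : ℝ} (hr : 0 ≤ r)
    (h1 : ∀ a ∈ A.toSet, ∃ b ∈ B.toSet, dist a b ≤ r)
    (h2 : ∀ b ∈ B.toSet, ∃ a ∈ A.toSet, dist b a ≤ r) : dist A B ≤ r :=
  hausdorffDist_le_of_mem_dist hr h1 h2

omit [TopologicalSpace T] in
lemma tendsto_of {l : Filter T} {F : T → FinHyp X} {A : FinHyp X}
    (h1 : ∀ ε > 0, ∀ᶠ t in l, ∀ x ∈ (F t).toSet, ∃ a ∈ A.toSet, dist x a < ε)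
    (h2 : ∀ a ∈ A.toSet, ∀ ε > 0, ∀ᶠ t in l, ∃ x ∈ (F t).toSet, dist a x < ε) :
    Tendsto F l (nhds A) := by
  rw [Metric.tendsto_nhds]
  intro ε hε
  filter_upwards [h1 (ε / 2) (half_pos hε),
    (eventually_all_finite A.finite_toSet).2 fun a ha => h2 a ha (ε / 2) (half_pos hε)] with t h3 h4
  refine (dist_le (half_pos hε).le (fun a ha => ?_) fun b hb => ?_).trans_lt (half_lt_self hε)
  · exact (h3 a ha).imp fun _ h => ⟨h.1, h.2.le⟩
  · exact (h4 b hb).imp fun _ h => ⟨h.1, h.2.le⟩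

lemma eventually_close (A : FinHyp X) {ε : ℝ} (hε : 0 < ε) : ∀ᶠ B in nhds A,
    (∀ b ∈ B.toSet, ∃ a ∈ A.toSet, dist b a < ε) ∧ ∀ a ∈ A.toSet, ∃ b ∈ B.toSet, dist a b < ε := by
  filter_upwards [ball_mem_nhds A hε] with B hB
  rw [mem_ball] at hB
  refine ⟨fun b hb => ?_, fun a ha => ?_⟩
  · exact (exists_dist_le B A hb).imp fun _ h => ⟨h.1, h.2.trans_lt hB⟩
  · rw [dist_comm] at hB
    exact (exists_dist_le A B ha).imp fun _ h => ⟨h.1, h.2.trans_lt hB⟩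

/-- Properties holding near each point of `A` hold at all points of members near `A`. -/
lemma eventually_forall_mem {A : FinHyp X} {P : X → X → Prop}
    (h : ∀ a ∈ A.toSet, ∀ᶠ x in nhds a, P a x) : ∀ᶠ B in nhds A,
    (∀ b ∈ B.toSet, ∃ a ∈ A.toSet, P a b) ∧ ∀ a ∈ A.toSet, ∃ b ∈ B.toSet, P a b := by
  obtain ⟨ε, hε, h⟩ : ∃ ε > 0, ∀ a ∈ A.toSet, ∀ x, dist x a < ε → P a x := by
    have key : ∀ᶠ ε in nhdsWithin (0 : ℝ) (Ioi 0), ∀ a ∈ A.toSet, ∀ x, dist x a < ε → P a x := by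
      refine (eventually_all_finite A.finite_toSet).2 fun a ha => ?_
      obtain ⟨ε, hε, h1⟩ := Metric.eventually_nhds_iff.1 (h a ha)
      filter_upwards [Ioo_mem_nhdsGT hε] with δ hδ x hx using h1 (hx.trans hδ.2)
    obtain ⟨ε, h1, h2⟩ := (key.and self_mem_nhdsWithin).exists
    exact ⟨ε, h2, h1⟩
  filter_upwards [eventually_close A hε] with B hB
  refine ⟨fun b hb => ?_, fun a ha => ?_⟩
  · obtain ⟨a, ha, hab⟩ := hB.1 b hb
    exact ⟨a, ha, h a ha b hab⟩
  · obtain ⟨b, hb, hab⟩ := hB.2 a ha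
    exact ⟨b, hb, h a ha b (by rwa [dist_comm])⟩

/-- The map of hyperspaces induced by a map. -/
def map (f : X → Y) (A : FinHyp X) : FinHyp Y :=
  mk (f '' A.toSet) (A.nonempty_toSet.image f) (A.finite_toSet.image f)

@[simp] lemma toSet_map (f : X → Y) (A : FinHyp X) : (map f A).toSet = f '' A.toSet := rfl

/-- A jointly continuous family of maps acts continuously on the hyperspace. -/
lemma continuous_map_uncurry {f : T → X → Y} (hf : Continuous fun p : T × X => f p.1 p.2) :
    Continuous fun p : T × FinHyp X => map (f p.1) p.2 := by
  rw [continuous_iff_continuousAt]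
  rintro ⟨t, A⟩
  have h : ∀ ε > 0, ∀ᶠ p in nhds (t, A), (∀ b ∈ p.2.toSet, ∃ a ∈ A.toSet, dist (f p.1 b) (f t a) < ε) ∧
      ∀ a ∈ A.toSet, ∃ b ∈ p.2.toSet, dist (f p.1 b) (f t a) < ε := by
    intro ε hε
    have h1 : ∀ a ∈ A.toSet, ∃ V ∈ nhds t, ∀ᶠ x in nhds a, ∀ s ∈ V, dist (f s x) (f t a) < ε := by
      intro a _
      have := (Metric.tendsto_nhds.1 (hf.tendsto (t, a)) ε hε)
      rw [nhds_prod_eq] at this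
      obtain ⟨V, hV, W, hW, hVW⟩ := Filter.eventually_prod_iff.1 this
      exact ⟨{s | V s}, hV, hW.mono fun x hx s hs => hVW hs hx⟩
    choose! V hV hV2 using h1
    have h2 : ∀ᶠ s in nhds t, ∀ a ∈ A.toSet, s ∈ V a :=
      (eventually_all_finite A.finite_toSet).2 fun a ha => hV a ha
    rw [nhds_prod_eq]
    filter_upwards [h2.prod_mk (eventually_forall_mem hV2)] with p hp
    refine ⟨fun b hb => ?_, fun a ha => ?_⟩
    · obtain ⟨a, ha, hab⟩ := hp.2.1 b hb
      exact ⟨a, ha, hab _ (hp.1 a ha)⟩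
    · obtain ⟨b, hb, hab⟩ := hp.2.2 a ha
      exact ⟨b, hb, hab _ (hp.1 a ha)⟩
  refine tendsto_of (fun ε hε => ?_) fun y hy ε hε => ?_
  · filter_upwards [h ε hε] with p hp
    rintro _ ⟨b, hb, rfl⟩
    obtain ⟨a, ha, hab⟩ := hp.1 b hb
    exact ⟨_, mem_image_of_mem _ ha, hab⟩
  · obtain ⟨a, ha, rfl⟩ := hy
    filter_upwards [h ε hε] with p hp
    obtain ⟨b, hb, hab⟩ := hp.2 a ha
    exact ⟨_, mem_image_of_mem _ hb, by rwa [dist_comm]⟩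

lemma continuous_map {f : X → Y} (hf : Continuous f) : Continuous (map f) :=
  (continuous_map_uncurry (T := Unit) (f := fun _ => f) (hf.comp continuous_snd)).comp
    (Continuous.prodMk_right ())

/-- Homeomorphic spaces have homeomorphic hyperspaces. -/
def congr (e : X ≃ₜ Y) : FinHyp X ≃ₜ FinHyp Y where
  toFun := map e
  invFun := map e.symm
  left_inv A := ext (by simp [image_image])
  right_inv A := ext (by simp [image_image])
  continuous_toFun := continuous_map e.continuous
  continuous_invFun := continuous_map e.symm.continuous

/-- The maximum of a real function on a finite set. -/
noncomputable def sup (f : X → ℝ) (A : FinHyp X) : ℝ := sSup (f '' A.toSet)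

lemma le_sup (f : X → ℝ) {A : FinHyp X} {a : X} (ha : a ∈ A.toSet) : f a ≤ sup f A :=
  le_csSup (A.finite_toSet.image f).bddAbove (mem_image_of_mem f ha)

lemma exists_eq_sup (f : X → ℝ) (A : FinHyp X) : ∃ a ∈ A.toSet, f a = sup f A :=
  (A.nonempty_toSet.image f).csSup_mem (A.finite_toSet.image f)

lemma sup_le {f : X → ℝ} {A : FinHyp X} {r : ℝ} (h : ∀ a ∈ A.toSet, f a ≤ r) : sup f A ≤ r := by
  obtain ⟨a, ha, h1⟩ := exists_eq_sup f A
  exact h1 ▸ h a ha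

/-- The square of a finite set. -/
def sq (A : FinHyp X) : FinHyp (X × X) :=
  mk (A.toSet ×ˢ A.toSet) (A.nonempty_toSet.prod A.nonempty_toSet)
    (A.finite_toSet.prod A.finite_toSet)

end Basic

end FinHyp

section AbsoluteExtensor

/-- A choice of connecting paths that are constant on the diagonal and small for close points. -/
lemma exists_small_paths (X : Type*) [MetricSpace X] [PathConnectedSpace X]
    [LocallyPathConnectedSpace X] : ∃ γ : ∀ x y : X, Path x y, (∀ x t, γ x x t = x) ∧
      ∀ x, ∀ ε > 0, ∃ η > 0, ∀ y ∈ ball x η, ∀ z ∈ ball x η, ∀ t, γ y z t ∈ ball x ε := by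
  classical
  set sizes : X → X → Set ℝ := fun x y => {R | ∃ γ : Path x y, ∀ t, dist (γ t) x ≤ R}
  have hbdd : ∀ x y, BddBelow (sizes x y) := fun x y =>
    ⟨0, fun R ⟨γ, h⟩ => dist_nonneg.trans (h 0)⟩
  have hne : ∀ x y, (sizes x y).Nonempty := fun x y => by
    let γ := PathConnectedSpace.somePath x y
    obtain ⟨R, hR⟩ := (isCompact_range γ.continuous).isBounded.subset_closedBall x
    exact ⟨R, γ, fun t => hR (mem_range_self t)⟩
  have hex : ∀ x y, ∃ γ : Path x y, (∀ t, dist (γ t) x ≤ sInf (sizes x y) + dist x y) ∧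
      (x = y → ∀ t, γ t = x) := by
    intro x y
    rcases eq_or_ne x y with rfl | hxy
    · refine ⟨Path.refl x, fun t => ?_, fun _ t => rfl⟩
      have : 0 ≤ sInf (sizes x x) := Real.sInf_nonneg fun R ⟨γ, h⟩ => dist_nonneg.trans (h 0)
      simpa using this
    · obtain ⟨R, ⟨γ, h⟩, hR⟩ := exists_lt_of_csInf_lt (hne x y)
        (lt_add_of_pos_right (sInf (sizes x y)) (dist_pos.2 hxy))
      exact ⟨γ, fun t => (h t).trans hR.le, fun h => absurd h hxy⟩
  choose γ hγ hγ2 using hex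
  refine ⟨γ, fun x => hγ2 x x rfl, fun x ε hε => ?_⟩
  obtain ⟨V, ⟨hV, hVc⟩, hVs⟩ := (LocallyPathConnectedSpace.path_connected_basis x).mem_iff.1
    (ball_mem_nhds x (show 0 < ε / 16 by positivity))
  obtain ⟨η, hη, hηV⟩ := Metric.mem_nhds_iff.1 hV
  refine ⟨η, hη, fun y hy z hz t => ?_⟩
  have hy' := hVs (hηV hy)
  have hz' := hVs (hηV hz)
  obtain ⟨δ, hδ⟩ := hVc.joinedIn y (hηV hy) z (hηV hz)
  have h1 : sInf (sizes y z) ≤ ε / 8 := csInf_le (hbdd y z) ⟨δ, fun t => by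
    have := hVs (hδ t)
    simp only [id, mem_ball] at *
    linarith [dist_triangle_right (δ t) y x]⟩
  have h2 := hγ y z t
  simp only [id, mem_ball] at *
  linarith [dist_triangle_right y z x, dist_triangle (γ y z t) y x]

/-- Clamp of an affine function. -/
noncomputable def clampMul (c s : ℝ) : unitInterval := projIcc 0 1 zero_le_one (4 * s - c)

lemma continuous_clampMul (c : ℝ) : Continuous (clampMul c) :=
  continuous_projIcc.comp (by fun_prop)

lemma clampMul_of_le {c s : ℝ} (h : 4 * s ≤ c) : clampMul c s = 0 :=
  projIcc_of_le_left _ (by linarith)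

lemma clampMul_of_ge {c s : ℝ} (h : c + 1 ≤ 4 * s) : clampMul c s = 1 :=
  projIcc_of_right_le _ (by linarith)

variable {X E ι : Type*} [MetricSpace X] (γ : ∀ x y : X, Path x y) (A : ι → FinHyp X)

/-- Points interpolating between the finite sets `A j` with weights `w`. -/
def interpSet (w : ι → ℝ) : Set X :=
  {x | ∃ j i a b, 1 / 2 ≤ w j ∧ a ∈ (A j).toSet ∧ b ∈ (A i).toSet ∧ dist a b ≤ dist (A j) (A i) ∧
    x = γ a b (min (clampMul 1 (w i)) (clampMul 2 (w j)))}

lemma finite_interpSet {w : ι → ℝ} (hw : {i | w i ≠ 0}.Finite) : (interpSet γ A w).Finite := by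
  refine (((hw.biUnion fun j _ => hw.biUnion fun i _ => (A j).finite_toSet.biUnion fun a _ =>
    (A i).finite_toSet.image fun b => γ a b (min (clampMul 1 (w i)) (clampMul 2 (w j)))).union
    (hw.biUnion fun j _ => (A j).finite_toSet))).subset ?_
  rintro _ ⟨j, i, a, b, hj, ha, hb, hab, rfl⟩
  have hj' : w j ≠ 0 := by intro h; rw [h] at hj; norm_num at hj
  by_cases hi : w i = 0
  · right
    rw [hi, clampMul_of_le (by norm_num), min_eq_left (show (0 : unitInterval) ≤ _ from bot_le)]
    simp only [mem_iUnion]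
    exact ⟨j, hj', by simpa using ha⟩
  · left
    simp only [mem_iUnion]
    exact ⟨j, hj', i, hi, a, ha, b, hb, rfl⟩

lemma mem_interpSet_self (hγ : ∀ x t, γ x x t = x) {w : ι → ℝ} {j : ι} (hj : 1 / 2 ≤ w j) {a : X}
    (ha : a ∈ (A j).toSet) : a ∈ interpSet γ A w :=
  ⟨j, j, a, a, hj, ha, ha, by simp, (hγ _ _).symm⟩

variable [TopologicalSpace E]

lemma tendsto_interpSet {w : E → ι → ℝ} (hw : ∀ i, Continuous fun p => w p i)
    (hlf : LocallyFinite fun i => Function.support fun p => w p i)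
    (p₀ : E) (h1 : ∃ k, w p₀ k = 1) :
    (∀ ε > 0, ∀ᶠ p in nhds p₀, ∀ x ∈ interpSet γ A (w p),
      ∃ y ∈ interpSet γ A (w p₀), dist x y < ε) ∧
    ∀ y ∈ interpSet γ A (w p₀), ∀ ε > 0, ∀ᶠ p in nhds p₀, ∃ x ∈ interpSet γ A (w p),
      dist y x < ε := by
  have hcont : ∀ (j i : ι) (a b : X), Continuous fun p =>
      γ a b (min (clampMul 1 (w p i)) (clampMul 2 (w p j))) := fun j i a b =>
    (γ a b).continuous.comp (((continuous_clampMul 1).comp (hw i)).min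
      ((continuous_clampMul 2).comp (hw j)))
  constructor
  · intro ε hε
    obtain ⟨V, hV, hVf⟩ := hlf p₀
    set I := {i | ((Function.support fun p => w p i) ∩ V).Nonempty}
    have hI : ∀ p ∈ V, ∀ i, i ∉ I → w p i = 0 := fun p hp i hi => by
      by_contra h
      exact hi ⟨p, h, hp⟩
    have hsmall : ∀ᶠ p in nhds p₀, ∀ j ∈ I, 1 / 2 ≤ w p j → 1 / 2 ≤ w p₀ j := by
      refine (eventually_all_finite hVf).2 fun j _ => ?_
      by_cases h : 1 / 2 ≤ w p₀ j
      · exact Eventually.of_forall fun _ _ => h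
      · filter_upwards [((hw j).tendsto p₀).eventually_lt_const (not_le.1 h)] with p hp h2
        exact absurd h2 (not_le.2 hp)
    have hclose : ∀ᶠ p in nhds p₀, ∀ j ∈ I, ∀ i ∈ I, ∀ a ∈ (A j).toSet, ∀ b ∈ (A i).toSet,
        dist (γ a b (min (clampMul 1 (w p i)) (clampMul 2 (w p j))))
          (γ a b (min (clampMul 1 (w p₀ i)) (clampMul 2 (w p₀ j)))) < ε :=
      (eventually_all_finite hVf).2 fun j _ => (eventually_all_finite hVf).2 fun i _ =>
        (eventually_all_finite (A j).finite_toSet).2 fun a _ =>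
        (eventually_all_finite (A i).finite_toSet).2 fun b _ =>
          Metric.tendsto_nhds.1 ((hcont j i a b).tendsto p₀) ε hε
    filter_upwards [hV, hsmall, hclose] with p hpV hps hpc
    rintro _ ⟨j, i, a, b, hj, ha, hb, hab, rfl⟩
    have hjI : j ∈ I := by
      by_contra h
      rw [hI p hpV j h] at hj
      norm_num at hj
    refine ⟨_, ⟨j, i, a, b, hps j hjI hj, ha, hb, hab, rfl⟩, ?_⟩
    by_cases hi : i ∈ I
    · exact hpc j hjI i hi a ha b hb
    · rw [hI p hpV i hi, hI p₀ (mem_of_mem_nhds hV) i hi, clampMul_of_le (by norm_num),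
        min_eq_left (show (0 : unitInterval) ≤ _ from bot_le),
        min_eq_left (show (0 : unitInterval) ≤ _ from bot_le), dist_self]
      exact hε
  · rintro _ ⟨j, i, a, b, hj, ha, hb, hab, rfl⟩ ε hε
    rcases hj.lt_or_eq with hj | hj
    · filter_upwards [((hw j).tendsto p₀).eventually_const_lt hj,
        Metric.tendsto_nhds.1 ((hcont j i a b).tendsto p₀) ε hε] with p h1 h2
      exact ⟨_, ⟨j, i, a, b, h1.le, ha, hb, hab, rfl⟩, by rwa [dist_comm]⟩
    · obtain ⟨k, hk⟩ := h1
      obtain ⟨a', ha', haa⟩ := FinHyp.exists_dist_le (A j) (A k) ha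
      rw [dist_comm, dist_comm (A j)] at haa
      have e1 : γ a b (min (clampMul 1 (w p₀ i)) (clampMul 2 (w p₀ j))) =
          γ a' a (min (clampMul 1 (w p₀ j)) (clampMul 2 (w p₀ k))) := by
        rw [← hj, hk, clampMul_of_le (c := 2) (by norm_num), clampMul_of_ge (c := 1) (s := 1 / 2) (by norm_num),
          clampMul_of_ge (c := 2) (s := 1) (by norm_num), min_self,
          min_eq_right (show (0 : unitInterval) ≤ _ from bot_le)]
        simp
      rw [e1]
      filter_upwards [((hw k).tendsto p₀).eventually_const_lt
        (show 1 / 2 < w p₀ k by rw [hk]; norm_num),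
        Metric.tendsto_nhds.1 ((hcont k j a' a).tendsto p₀) ε hε] with p h1 h2
      exact ⟨_, ⟨k, j, a', a, h1.le, ha', ha, haa, rfl⟩, by rwa [dist_comm]⟩

end AbsoluteExtensor

/-- Hyperspaces of finite subsets of connected locally path connected spaces are
absolute extensors: they are retracts of metric spaces containing them as closed subsets. -/
theorem FinHyp.exists_retraction {X E : Type*} [MetricSpace X] [PathConnectedSpace X]
    [LocallyPathConnectedSpace X] [MetricSpace E] {i : FinHyp X → E}
    (hi : Topology.IsClosedEmbedding i) :
    ∃ r : E → FinHyp X, Continuous r ∧ ∀ A, r (i A) = A := by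
  classical
  obtain ⟨γ, hγ, hγs⟩ := exists_small_paths X
  set C := range i with hC
  have hCne : C.Nonempty := by
    obtain ⟨x⟩ := (inferInstance : Nonempty X)
    exact ⟨i (mk {x} (singleton_nonempty x) (finite_singleton x)), mem_range_self _⟩
  have hCcl : IsClosed C := hi.isClosed_range
  have hpos : ∀ z : ↥Cᶜ, 0 < infDist (z : E) C := fun z =>
    (hCcl.notMem_iff_infDist_pos hCne).1 z.2
  have hA : ∀ z : ↥Cᶜ, ∃ A, dist (z : E) (i A) < 2 * infDist (z : E) C := by
    intro z
    obtain ⟨_, ⟨A, rfl⟩, h⟩ := (infDist_lt_iff hCne).1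
      (show infDist (z : E) C < 2 * infDist (z : E) C by linarith [hpos z])
    exact ⟨A, h⟩
  choose A hA using hA
  obtain ⟨ψ, hψ⟩ := BumpCovering.exists_isSubordinate (X := ↥Cᶜ) (s := univ) isClosed_univ
    (fun z : ↥Cᶜ => ball z (infDist (z : E) C / 4)) (fun z => isOpen_ball) fun z _ =>
      mem_iUnion.2 ⟨z, mem_ball_self (by linarith [hpos z])⟩
  have hclose : ∀ (p : ↥Cᶜ) (j : ↥Cᶜ), ψ j p ≠ 0 → dist (i (A j)) (p : E) ≤ 3 * infDist (p : E) C := by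
    intro p j hj
    have h1 : p ∈ ball j (infDist (j : E) C / 4) := hψ j (subset_tsupport _ hj)
    rw [mem_ball, Subtype.dist_eq] at h1
    have h2 := hA j
    have h3 := infDist_le_infDist_add_dist (s := C) (x := (j : E)) (y := p)
    rw [dist_comm] at h2 h3
    linarith [dist_triangle_right (i (A j)) (p : E) (j : E)]
  let w : ↥Cᶜ → ↥Cᶜ → ℝ := fun p j => ψ j p
  have hone : ∀ p, ∃ k, w p k = 1 := fun p => ⟨_, ψ.ind_apply p (mem_univ p)⟩
  have hne : ∀ p, (interpSet γ A (w p)).Nonempty := fun p => by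
    obtain ⟨k, hk⟩ := hone p
    obtain ⟨a, ha⟩ := (A k).nonempty_toSet
    exact ⟨a, mem_interpSet_self γ A hγ (by rw [hk]; norm_num) ha⟩
  let r₁ : ↥Cᶜ → FinHyp X := fun p => mk _ (hne p) (finite_interpSet γ A (ψ.point_finite p))
  have hr₁ : Continuous r₁ := by
    rw [continuous_iff_continuousAt]
    intro p₀
    have h := tendsto_interpSet γ A (w := w) (fun j => (ψ j).continuous) ψ.locallyFinite p₀ (hone p₀)
    exact tendsto_of h.1 h.2
  have hinv : ∀ p : E, ¬ p ∈ Cᶜ → ∃ A, i A = p := fun p h => by simpa [hC] using h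
  let r : E → FinHyp X := fun p =>
    if h : p ∈ Cᶜ then r₁ ⟨p, h⟩ else (hinv p h).choose
  have hri : ∀ A, r (i A) = A := fun A => by
    have h : ¬ i A ∈ Cᶜ := by simp [hC]
    simp only [r, dif_neg h]
    exact hi.injective (hinv _ h).choose_spec
  refine ⟨r, ?_, hri⟩
  rw [continuous_iff_continuousAt]
  intro p₀
  by_cases hp₀ : p₀ ∈ Cᶜ
  · have : ContinuousOn r Cᶜ := by
      rw [continuousOn_iff_continuous_domRestrict]
      have h1 : Cᶜ.domRestrict r = r₁ := funext fun p => dif_pos p.2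
      rwa [h1]
    exact this.continuousAt (hCcl.isOpen_compl.mem_nhds hp₀)
  · obtain ⟨A₀, rfl⟩ := hinv p₀ hp₀
    have hinvcont : ∀ ε > 0, ∃ δ > 0, ∀ B, dist (i B) (i A₀) < δ → dist B A₀ < ε := by
      intro ε hε
      have h1 := hi.isInducing.nhds_eq_comap A₀ ▸ ball_mem_nhds A₀ hε
      obtain ⟨V, hV, hVs⟩ := mem_comap.1 h1
      obtain ⟨δ, hδ, h2⟩ := Metric.mem_nhds_iff.1 hV
      exact ⟨δ, hδ, fun B hB => hVs (h2 hB)⟩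
    have hstep : ∀ ε > 0, ∀ᶠ p in nhds (i A₀),
        (∀ h : p ∉ Cᶜ, dist (hinv p h).choose A₀ < ε) ∧
        ∀ (h : p ∈ Cᶜ) (j : ↥Cᶜ), ψ j ⟨p, h⟩ ≠ 0 → dist (A j) A₀ < ε := by
      intro ε hε
      obtain ⟨δ, hδ, h⟩ := hinvcont ε hε
      filter_upwards [ball_mem_nhds (i A₀) (show 0 < δ / 4 by positivity)] with p hp
      rw [mem_ball] at hp
      refine ⟨fun hpC => h _ ?_, fun hpC j hj => h _ ?_⟩
      · rw [(hinv p hpC).choose_spec]; linarith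
      · have h1 := hclose ⟨p, hpC⟩ j hj
        have h2 := infDist_le_dist_of_mem (x := p) (mem_range_self (f := i) A₀)
        rw [← hC] at h2
        simp only at h1
        linarith [dist_triangle (i (A j)) p (i A₀)]
    rw [ContinuousAt, hri]
    have hne0 : ∀ {s : ℝ}, 1 / 2 ≤ s → s ≠ 0 := fun h h0 => by rw [h0] at h; norm_num at h
    refine tendsto_of (fun ε hε => ?_) fun a ha ε hε => ?_
    · have hη : ∀ a ∈ A₀.toSet, ∃ η > 0, ∀ y ∈ ball a η, ∀ z ∈ ball a η, ∀ t, γ y z t ∈ ball a ε :=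
        fun a _ => hγs a ε hε
      choose! η hη0 hη using hη
      obtain ⟨θ, hθ, hθη⟩ : ∃ θ > 0, ∀ a ∈ A₀.toSet, 3 * θ ≤ η a := by
        have key : ∀ᶠ θ in nhdsWithin (0 : ℝ) (Ioi 0), ∀ a ∈ A₀.toSet, 3 * θ ≤ η a := by
          refine (eventually_all_finite A₀.finite_toSet).2 fun a ha => ?_
          filter_upwards [Ioo_mem_nhdsGT (show 0 < η a / 3 by linarith [hη0 a ha])] with θ hθ
          linarith [hθ.2]
        obtain ⟨θ, h1, h2⟩ := (key.and self_mem_nhdsWithin).exists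
        exact ⟨θ, h2, h1⟩
      filter_upwards [hstep (min ε θ) (lt_min hε hθ)] with p hp x hx
      by_cases hpC : p ∈ Cᶜ
      · simp only [r, dif_pos hpC] at hx
        obtain ⟨j, i', a, b, hj, ha, hb, hab, rfl⟩ := hx
        have h1 := (hp.2 hpC j (hne0 hj)).trans_le (min_le_right _ _)
        obtain ⟨a₀, ha₀, haa⟩ := exists_dist_le (A j) A₀ ha
        refine ⟨a₀, ha₀, ?_⟩
        have h3 := hθη a₀ ha₀
        by_cases hi' : ψ i' ⟨p, hpC⟩ = 0
        · have hw0 : w ⟨p, hpC⟩ i' = 0 := hi'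
          rw [hw0, clampMul_of_le (by norm_num),
            min_eq_left (show (0 : unitInterval) ≤ _ from bot_le), (γ a b).source]
          have := hη a₀ ha₀ a (by rw [mem_ball]; linarith) a (by rw [mem_ball]; linarith) 0
          rwa [hγ, mem_ball] at this
        · have h2 := (hp.2 hpC i' hi').trans_le (min_le_right _ _)
          refine hη a₀ ha₀ a (by rw [mem_ball]; linarith) b ?_ _
          rw [mem_ball]
          have h4 := dist_triangle_right (A j) (A i') A₀
          have h5 := dist_triangle_left b a₀ a
          linarith
      · simp only [r, dif_neg hpC] at hx
        obtain ⟨a₀, ha₀, haa⟩ := exists_dist_le _ A₀ hx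
        exact ⟨a₀, ha₀, haa.trans_lt ((hp.1 hpC).trans_le (min_le_left _ _))⟩
    · filter_upwards [hstep ε hε] with p hp
      by_cases hpC : p ∈ Cᶜ
      · simp only [r, dif_pos hpC]
        obtain ⟨k, hk⟩ := hone ⟨p, hpC⟩
        have h1 : 1 / 2 ≤ w ⟨p, hpC⟩ k := by rw [hk]; norm_num
        have h2 := hp.2 hpC k (hne0 h1)
        rw [dist_comm] at h2
        obtain ⟨b, hb, hab⟩ := exists_dist_le A₀ (A k) ha
        exact ⟨b, mem_interpSet_self γ A hγ h1 hb, hab.trans_lt h2⟩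
      · simp only [r, dif_neg hpC]
        have h2 := hp.1 hpC
        rw [dist_comm] at h2
        obtain ⟨b, hb, hab⟩ := exists_dist_le A₀ _ ha
        exact ⟨b, hb, hab.trans_lt h2⟩

namespace FinHyp

section Center

variable {X κ : Type*} [MetricSpace X]

/-- Translation of the vector coordinates of a finite set. -/
noncomputable def translate (v : C00 κ ℝ) (S : FinHyp (X × C00 κ ℝ)) : FinHyp (X × C00 κ ℝ) :=
  map (fun y => (y.1, y.2 + v)) S

lemma continuous_translate :
    Continuous fun p : C00 κ ℝ × FinHyp (X × C00 κ ℝ) => translate p.1 p.2 :=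
  continuous_map_uncurry (T := C00 κ ℝ) (f := fun v (y : X × C00 κ ℝ) => (y.1, y.2 + v))
    (by fun_prop)

lemma translate_translate (v w : C00 κ ℝ) (S : FinHyp (X × C00 κ ℝ)) :
    translate v (translate w S) = translate (w + v) S :=
  ext (by simp [translate, image_image, add_assoc])

lemma translate_zero (S : FinHyp (X × C00 κ ℝ)) : translate 0 S = S :=
  ext (by simp [translate])

/-- The midpoint of the range of a coordinate. -/
noncomputable def centerCoord (S : FinHyp (X × C00 κ ℝ)) (k : κ) : ℝ :=
  (sup (fun y => y.2 k) S - sup (fun y => -y.2 k) S) / 2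

lemma finite_centerCoord (S : FinHyp (X × C00 κ ℝ)) : {k | centerCoord S k ≠ 0}.Finite := by
  refine (S.finite_toSet.biUnion fun y _ => y.2.finite_support).subset fun k hk => ?_
  by_contra h
  simp only [mem_iUnion, not_exists] at h
  have h0 : ∀ y ∈ S.toSet, y.2 k = 0 := fun y hy => by simpa using h y hy
  obtain ⟨a, ha, h1⟩ := exists_eq_sup (fun y : X × C00 κ ℝ => y.2 k) S
  obtain ⟨b, hb, h2⟩ := exists_eq_sup (fun y : X × C00 κ ℝ => -y.2 k) S
  refine hk ?_
  rw [centerCoord, ← h1, ← h2, h0 a ha, h0 b hb]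
  simp

/-- The coordinatewise center of the vector coordinates of a finite set. -/
noncomputable def center (S : FinHyp (X × C00 κ ℝ)) : C00 κ ℝ :=
  C00.mk (centerCoord S) (finite_centerCoord S)

lemma abs_sup_sub_sup_le {Y : Type*} [MetricSpace Y] (f : Y → ℝ)
    (hf : ∀ x y, f x ≤ f y + dist x y) (S T : FinHyp Y) : |sup f S - sup f T| ≤ dist S T := by
  have key : ∀ S T : FinHyp Y, sup f S ≤ sup f T + dist S T := fun S T => by
    refine sup_le fun a ha => ?_
    obtain ⟨b, hb, h⟩ := exists_dist_le S T ha
    linarith [hf a b, le_sup f hb]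
  rw [abs_sub_le_iff]
  constructor
  · linarith [key S T]
  · linarith [key T S, dist_comm S T]

lemma continuous_center : Continuous (center : FinHyp (X × C00 κ ℝ) → C00 κ ℝ) := by
  refine (LipschitzWith.of_dist_le_mul (K := 1) fun S T => ?_).continuous
  rw [dist_eq_norm, NNReal.coe_one, one_mul]
  refine (C00.norm_le_iff dist_nonneg).2 fun k => ?_
  rw [C00.sub_apply]
  have hc : ∀ x y : X × C00 κ ℝ, |x.2 k - y.2 k| ≤ dist x y := fun x y => by
    have h := C00.norm_apply_le (x.2 - y.2) k
    rw [C00.sub_apply, Real.norm_eq_abs, ← dist_eq_norm] at h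
    exact h.trans (le_max_right _ _)
  have h1 := abs_sup_sub_sup_le (fun y : X × C00 κ ℝ => y.2 k)
    (fun x y => by linarith [(abs_le.1 (hc x y)).2]) S T
  have h2 := abs_sup_sub_sup_le (fun y : X × C00 κ ℝ => -y.2 k)
    (fun x y => by linarith [(abs_le.1 (hc x y)).1]) S T
  rw [abs_le] at h1 h2
  change |centerCoord S k - centerCoord T k| ≤ _
  rw [centerCoord, centerCoord, abs_le]
  constructor <;> linarith [h1.1, h1.2, h2.1, h2.2]

lemma sup_map {Y Z : Type*} [MetricSpace Y] [MetricSpace Z] (f : Z → ℝ) (g : Y → Z)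
    (S : FinHyp Y) : sup f (map g S) = sup (fun y => f (g y)) S := by
  simp [sup, image_image]

lemma sup_add_const {Y : Type*} [MetricSpace Y] (f : Y → ℝ) (c : ℝ) (S : FinHyp Y) :
    sup (fun y => f y + c) S = sup f S + c := by
  refine le_antisymm (sup_le fun a ha => by linarith [le_sup f ha]) ?_
  obtain ⟨a, ha, h⟩ := exists_eq_sup f S
  rw [← h]
  exact le_sup (fun y => f y + c) ha

lemma center_translate (v : C00 κ ℝ) (S : FinHyp (X × C00 κ ℝ)) :
    center (translate v S) = center S + v := by
  refine C00.ext fun k => ?_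
  change centerCoord (translate v S) k = centerCoord S k + v k
  simp only [centerCoord, translate, sup_map, C00.add_apply, neg_add, sup_add_const]
  ring

variable (X κ) in
/-- The finite sets whose vector coordinates are centered at the origin. -/
def Centered : Type _ := {S : FinHyp (X × C00 κ ℝ) // center S = 0}

noncomputable instance : MetricSpace (Centered X κ) := Subtype.metricSpace

/-- The centered translate of a finite set. -/
noncomputable def toCentered (S : FinHyp (X × C00 κ ℝ)) : Centered X κ :=
  ⟨translate (-center S) S, by rw [center_translate, add_neg_cancel]⟩

lemma continuous_toCentered : Continuous (toCentered : FinHyp (X × C00 κ ℝ) → Centered X κ) :=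
  (continuous_translate.comp (continuous_center.neg.prodMk continuous_id)).subtype_mk _

lemma toCentered_coe (S : Centered X κ) : toCentered S.1 = S :=
  Subtype.ext (by simp [toCentered, S.2, translate_zero])

/-- A finite set is determined by its center and its centered translate. -/
noncomputable def centerHomeo : FinHyp (X × C00 κ ℝ) ≃ₜ Centered X κ × C00 κ ℝ where
  toFun S := (toCentered S, center S)
  invFun p := translate p.2 p.1.1
  left_inv S := by simp [toCentered, translate_translate, translate_zero]
  right_inv p := by
    have h : center (translate p.2 p.1.1) = p.2 := by rw [center_translate, p.1.2, zero_add]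
    refine Prod.ext (Subtype.ext ?_) h
    simp [toCentered, h, translate_translate, translate_zero]
  continuous_toFun := continuous_toCentered.prodMk continuous_center
  continuous_invFun := continuous_translate.comp
    (continuous_snd.prodMk (continuous_subtype_val.comp continuous_fst))

end Center

/-- The hyperspace of a stable connected space that embeds as a closed set in `C00 κ ℝ` is
homeomorphic to `C00 κ ℝ`. -/
theorem nonempty_homeomorph_of_stable {X κ : Type*} [Infinite κ] [MetricSpace X]
    [PathConnectedSpace X] [LocallyPathConnectedSpace X] (e : X ≃ₜ X × C00 κ ℝ)
    {j : FinHyp X → C00 κ ℝ} (hj : Topology.IsClosedEmbedding j) :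
    Nonempty (FinHyp X ≃ₜ C00 κ ℝ) := by
  obtain ⟨r, hr, hrj⟩ := exists_retraction hj
  obtain ⟨h⟩ := nonempty_prod_homeomorph_of_retract (E := C00 κ ℝ) (A := Centered X κ)
    (i := fun S => j ((congr e).symm S.1)) (r := fun v => toCentered (congr e (r v)))
    (hj.continuous.comp ((congr e).symm.continuous.comp continuous_subtype_val))
    (continuous_toCentered.comp ((congr e).continuous.comp hr))
    fun S => by simp [hrj, toCentered_coe]
  exact ⟨((congr e).trans centerHomeo).trans (((Homeomorph.refl _).prodCongr
    (C00.natHomeo κ).symm).trans (h.trans (C00.natHomeo κ)))⟩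

end FinHyp

section HyperspaceEmbedding

/-- A plateau function. -/
noncomputable def bump01 (t : ℝ) : ℝ := max 0 (min 1 (2 * (1 - t)))

/-- A bump supported in `(1, 5)` that is large on `[2, 4]`. -/
noncomputable def band (t : ℝ) : ℝ := max 0 (min (t - 1) (5 - t))

lemma max_sub_max_le_abs (a b : ℝ) : max 0 a - max 0 b ≤ |a - b| := by
  rcases max_cases 0 a with h | h <;> rcases max_cases 0 b with h' | h' <;>
    cases abs_cases (a - b) <;> linarith

lemma band_nonneg (t : ℝ) : 0 ≤ band t := le_max_left _ _

lemma one_le_band {t : ℝ} (h1 : 2 ≤ t) (h2 : t ≤ 4) : 1 ≤ band t :=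
  le_max_of_le_right (le_min (by linarith) (by linarith))

lemma band_eq_zero {t : ℝ} (h : t ≤ 1 ∨ 5 ≤ t) : band t = 0 :=
  max_eq_left (by rcases h with h | h; exacts [min_le_of_left_le (by linarith), min_le_of_right_le (by linarith)])

lemma band_le (s t : ℝ) : band s ≤ band t + |s - t| := by
  have h := max_sub_max_le_abs (min (s - 1) (5 - s)) (min (t - 1) (5 - t))
  have h2 : |min (s - 1) (5 - s) - min (t - 1) (5 - t)| ≤ |s - t| := by
    refine (abs_min_sub_min_le_max _ _ _ _).trans (max_le ?_ ?_)
    · rw [sub_sub_sub_cancel_right]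
    · rw [sub_sub_sub_cancel_left, abs_sub_comm]
  unfold band; linarith

lemma bump01_nonneg (t : ℝ) : 0 ≤ bump01 t := le_max_left _ _

lemma bump01_le_one (t : ℝ) : bump01 t ≤ 1 := max_le zero_le_one (min_le_left _ _)

lemma bump01_eq_one {t : ℝ} (h : t ≤ 1 / 2) : bump01 t = 1 := by
  rw [bump01, min_eq_left (by linarith), max_eq_right zero_le_one]

lemma bump01_eq_zero {t : ℝ} (h : 1 ≤ t) : bump01 t = 0 :=
  max_eq_left (min_le_of_right_le (by linarith))

lemma abs_bump01_sub_le (s t : ℝ) : |bump01 s - bump01 t| ≤ 2 * |s - t| := by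
  have key : ∀ s t : ℝ, bump01 s - bump01 t ≤ 2 * |s - t| := fun s t => by
    refine (max_sub_max_le_abs _ _).trans ((abs_min_sub_min_le_max _ _ _ _).trans (max_le ?_ ?_))
    · rw [sub_self, abs_zero]; positivity
    · rw [← mul_sub, sub_sub_sub_cancel_left, abs_mul, abs_sub_comm]; norm_num
  rw [abs_sub_le_iff]
  exact ⟨key s t, by rw [abs_sub_comm]; exact key t s⟩

variable {J : Type*}

/-- The vector with given integer coordinates. -/
noncomputable def latticePt (q : J →₀ ℤ) : C00 J ℝ :=
  C00.mk (fun i => (q i : ℝ)) (q.support.finite_toSet.subset fun i hi =>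
    Finsupp.mem_support_iff.2 fun h => hi (by simp [h]))

lemma exists_latticePt (v : C00 J ℝ) : ∃ q, ‖v - latticePt q‖ ≤ 1 / 2 := by
  refine ⟨Finsupp.ofSupportFinite (fun i => round (v i)) (v.finite_support.subset fun i hi h =>
    hi ?_), (C00.norm_le_iff (by norm_num)).2 fun i => ?_⟩
  · simp [h]
  · exact abs_sub_round (v i)

lemma finite_latticePt (v : C00 J ℝ) : {q : J →₀ ℤ | ‖v - latticePt q‖ < 1}.Finite := by
  classical
  set s := v.finite_support.toFinset
  refine (Finset.finite_toSet (s.finsupp fun i => Finset.Icc (⌊v i⌋ - 1) (⌈v i⌉ + 1))).subset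
    fun q hq => ?_
  rw [mem_ofPred_eq] at hq
  have h1 : ∀ i, |v i - q i| < 1 := fun i => (C00.norm_apply_le (v - latticePt q) i).trans_lt hq
  rw [Finset.mem_coe, Finset.mem_finsupp_iff]
  refine ⟨fun i hi => ?_, fun i _ => ?_⟩
  · by_contra h
    have h2 : v i = 0 := by simpa [s] using h
    have h3 := h1 i
    rw [h2, zero_sub, abs_neg] at h3
    have h4 : |q i| < 1 := by exact_mod_cast h3
    exact Finsupp.mem_support_iff.1 hi (Int.abs_lt_one_iff.1 h4)
  · have h2 := abs_lt.1 (h1 i)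
    rw [Finset.mem_Icc]
    constructor
    · have : (⌊v i⌋ : ℝ) ≤ v i := Int.floor_le _
      have : (⌊v i⌋ : ℝ) - 1 < q i + 1 := by linarith
      have : ⌊v i⌋ - 1 < q i + 1 := by exact_mod_cast this
      omega
    · have : v i ≤ (⌈v i⌉ : ℝ) := Int.le_ceil _
      have : (q i : ℝ) < ⌈v i⌉ + 1 := by linarith
      have : q i < ⌈v i⌉ + 1 := by exact_mod_cast this
      omega

/-- The index set for the test functions at each scale. -/
abbrev TestIdx (J : Type*) := Option ((J →₀ ℤ) × Option (J × Bool))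

/-- The positive or negative part of a real number. -/
noncomputable def signPart (b : Bool) (t : ℝ) : ℝ := max 0 (if b then t else -t)

lemma signPart_nonneg (b : Bool) (t : ℝ) : 0 ≤ signPart b t := le_max_left _ _

lemma signPart_le (b : Bool) (t : ℝ) : signPart b t ≤ |t| :=
  max_le (abs_nonneg t) (by cases b; exacts [neg_le_abs t, le_abs_self t])

lemma signPart_zero (b : Bool) : signPart b 0 = 0 := by simp [signPart]

lemma abs_signPart_sub_le (b : Bool) (s t : ℝ) : |signPart b s - signPart b t| ≤ |s - t| := by
  have key : ∀ s t : ℝ, signPart b s - signPart b t ≤ |s - t| := fun s t => by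
    refine (max_sub_max_le_abs _ _).trans ?_
    cases b
    · simp only [Bool.false_eq_true, if_false]; rw [neg_sub_neg, abs_sub_comm]
    · simp
  rw [abs_sub_le_iff]
  exact ⟨key s t, by rw [abs_sub_comm]; exact key t s⟩

lemma signPart_sub (t : ℝ) : signPart true t - signPart false t = t := by
  simp only [signPart, if_true, Bool.false_eq_true, if_false]
  rcases max_cases 0 t with h | h <;> rcases max_cases 0 (-t) with h' | h' <;> linarith

/-- The unscaled test functions. -/
noncomputable def testFun : TestIdx J → C00 J ℝ → ℝ
  | none, _ => 1
  | some (q, none), v => bump01 ‖v - latticePt q‖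
  | some (q, some (i, b)), v => bump01 ‖v - latticePt q‖ * signPart b ((v - latticePt q) i)

lemma testFun_nonneg (p : TestIdx J) (v : C00 J ℝ) : 0 ≤ testFun p v := by
  rcases p with _ | ⟨q, _ | ⟨i, b⟩⟩
  · exact zero_le_one
  · exact bump01_nonneg _
  · exact mul_nonneg (bump01_nonneg _) (signPart_nonneg _ _)

lemma testFun_le_one (p : TestIdx J) (v : C00 J ℝ) : testFun p v ≤ 1 := by
  rcases p with _ | ⟨q, _ | ⟨i, b⟩⟩
  · exact le_rfl
  · exact bump01_le_one _
  · by_cases h : 1 ≤ ‖v - latticePt q‖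
    · simp [testFun, bump01_eq_zero h]
    · refine mul_le_one₀ (bump01_le_one _) (signPart_nonneg _ _) ?_
      exact (signPart_le _ _).trans ((C00.norm_apply_le _ _).trans (not_le.1 h).le)

lemma abs_testFun_sub_le (p : TestIdx J) (v w : C00 J ℝ) :
    |testFun p v - testFun p w| ≤ 3 * ‖v - w‖ := by
  have h0 : ∀ q, |bump01 ‖v - latticePt q‖ - bump01 ‖w - latticePt q‖| ≤ 2 * ‖v - w‖ := fun q => by
    refine (abs_bump01_sub_le _ _).trans (mul_le_mul_of_nonneg_left ?_ zero_le_two)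
    have := abs_norm_sub_norm_le (v - latticePt q) (w - latticePt q)
    rwa [sub_sub_sub_cancel_right] at this
  rcases p with _ | ⟨q, _ | ⟨i, b⟩⟩
  · simp [testFun]
  · simp only [testFun]
    linarith [h0 q, norm_nonneg (v - w)]
  · have key : ∀ v w : C00 J ℝ, ‖v - latticePt q‖ ≤ ‖w - latticePt q‖ →
        |bump01 ‖v - latticePt q‖ - bump01 ‖w - latticePt q‖| ≤ 2 * ‖v - w‖ →
        |testFun (some (q, some (i, b))) v - testFun (some (q, some (i, b))) w| ≤ 3 * ‖v - w‖ := by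
      intro v w hvw h0
      by_cases h : 1 ≤ ‖v - latticePt q‖
      · simp only [testFun, bump01_eq_zero h, bump01_eq_zero (h.trans hvw)]
        simp
      · have e : testFun (some (q, some (i, b))) v - testFun (some (q, some (i, b))) w =
            (bump01 ‖v - latticePt q‖ - bump01 ‖w - latticePt q‖) * signPart b ((v - latticePt q) i) +
            bump01 ‖w - latticePt q‖ * (signPart b ((v - latticePt q) i) -
              signPart b ((w - latticePt q) i)) := by
          simp only [testFun]; ring
        have h1 : |signPart b ((v - latticePt q) i)| ≤ 1 := by
          rw [abs_of_nonneg (signPart_nonneg _ _)]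
          exact (signPart_le _ _).trans ((C00.norm_apply_le _ _).trans (not_le.1 h).le)
        have h2 : |signPart b ((v - latticePt q) i) - signPart b ((w - latticePt q) i)| ≤ ‖v - w‖ := by
          refine (abs_signPart_sub_le _ _ _).trans ?_
          have := C00.norm_apply_le (v - w) i
          simpa using this
        have h3 : |bump01 ‖w - latticePt q‖| ≤ 1 := by
          rw [abs_of_nonneg (bump01_nonneg _)]; exact bump01_le_one _
        rw [e]
        refine (abs_add_le _ _).trans ?_
        rw [abs_mul, abs_mul]
        have h4 := mul_le_mul h0 h1 (abs_nonneg _) (by positivity)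
        have h5 := mul_le_mul h3 h2 (abs_nonneg _) zero_le_one
        linarith
    rcases le_total ‖v - latticePt q‖ ‖w - latticePt q‖ with h | h
    · exact key v w h (h0 q)
    · rw [abs_sub_comm, norm_sub_rev v w]
      exact key w v h (by rw [abs_sub_comm, norm_sub_rev w v]; exact h0 q)

lemma finite_testFun (v : C00 J ℝ) : {p : TestIdx J | testFun p v ≠ 0}.Finite := by
  have hq := finite_latticePt v
  have h1 := (finite_singleton (none : TestIdx J)).union ((hq.image fun q => some (q, none)).union
    (hq.biUnion fun q _ => ((v - latticePt q).finite_support.prod (finite_univ (α := Bool))).image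
      fun r => some (q, some r)))
  refine h1.subset ?_
  rintro (_ | ⟨q, _ | ⟨i, b⟩⟩) hp
  · exact Or.inl rfl
  · refine Or.inr (Or.inl ⟨q, ?_, rfl⟩)
    by_contra h
    exact hp (bump01_eq_zero (by simpa using h))
  · refine Or.inr (Or.inr ?_)
    simp only [mem_iUnion]
    refine ⟨q, ?_, (i, b), ⟨?_, mem_univ _⟩, rfl⟩
    · by_contra h
      refine hp ?_
      simp only [testFun]
      rw [bump01_eq_zero (by simpa using h), zero_mul]
    · intro h
      refine hp ?_
      simp only [testFun]
      rw [h, signPart_zero, mul_zero]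

namespace FinHyp

/-- The weight of the scale `2 ^ (-k)`, detecting pairs of points at a comparable distance. -/
noncomputable def scaleWeight : ℕ → FinHyp (C00 J ℝ) → ℝ
  | 0, _ => 1
  | k + 1, S => sup (fun p => (1 / 2) ^ (k + 1) * band (2 ^ (k + 1) * ‖p.1 - p.2‖)) (sq S)

/-- The test coordinate at a scale. -/
noncomputable def testCoord (k : ℕ) (p : TestIdx J) (S : FinHyp (C00 J ℝ)) : ℝ :=
  sup (fun v => testFun p ((2 : ℝ) ^ k • v)) S

lemma scaleWeight_nonneg (k : ℕ) (S : FinHyp (C00 J ℝ)) : 0 ≤ scaleWeight k S := by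
  cases k with
  | zero => exact zero_le_one
  | succ k =>
    obtain ⟨p, hp⟩ := (sq S).nonempty_toSet
    refine le_trans ?_ (le_sup _ hp)
    exact mul_nonneg (by positivity) (band_nonneg _)

lemma testCoord_nonneg (k : ℕ) (p : TestIdx J) (S : FinHyp (C00 J ℝ)) : 0 ≤ testCoord k p S := by
  obtain ⟨v, hv⟩ := S.nonempty_toSet
  exact (testFun_nonneg _ _).trans (le_sup (fun v => testFun p ((2 : ℝ) ^ k • v)) hv)

lemma testCoord_le_one (k : ℕ) (p : TestIdx J) (S : FinHyp (C00 J ℝ)) : testCoord k p S ≤ 1 :=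
  sup_le fun _ _ => testFun_le_one _ _

lemma abs_testCoord_sub_le (k : ℕ) (p : TestIdx J) (S T : FinHyp (C00 J ℝ)) :
    |testCoord k p S - testCoord k p T| ≤ 3 * 2 ^ k * dist S T := by
  have h : ∀ v w : C00 J ℝ, testFun p ((2 : ℝ) ^ k • v) ≤ testFun p ((2 : ℝ) ^ k • w) +
      3 * 2 ^ k * dist v w := fun v w => by
    have h1 := (le_abs_self _).trans (abs_testFun_sub_le p ((2 : ℝ) ^ k • v) ((2 : ℝ) ^ k • w))
    rw [← smul_sub, norm_smul, norm_pow, Real.norm_ofNat, ← dist_eq_norm] at h1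
    linarith
  have key : ∀ S T : FinHyp (C00 J ℝ), testCoord k p S ≤ testCoord k p T + 3 * 2 ^ k * dist S T := by
    intro S T
    refine sup_le fun a ha => ?_
    obtain ⟨b, hb, hab⟩ := exists_dist_le S T ha
    have h1 := le_sup (fun v => testFun p ((2 : ℝ) ^ k • v)) hb
    have h2 := mul_le_mul_of_nonneg_left hab (show (0 : ℝ) ≤ 3 * 2 ^ k by positivity)
    change _ ≤ sup (fun v => testFun p ((2 : ℝ) ^ k • v)) T + _
    linarith [h a b]
  rw [abs_sub_le_iff]
  constructor
  · linarith [key S T]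
  · have := key T S
    rw [dist_comm] at this
    linarith

lemma scaleWeight_le (k : ℕ) (S T : FinHyp (C00 J ℝ)) :
    scaleWeight k S ≤ scaleWeight k T + 2 * dist S T := by
  cases k with
  | zero => simp only [scaleWeight]; linarith [dist_nonneg (x := S) (y := T)]
  | succ k =>
    refine sup_le fun p hp => ?_
    obtain ⟨a, ha, h1⟩ := exists_dist_le S T hp.1
    obtain ⟨b, hb, h2⟩ := exists_dist_le S T hp.2
    have h3 := le_sup (A := sq T)
      (fun p : C00 J ℝ × C00 J ℝ => (1 / 2 : ℝ) ^ (k + 1) * band (2 ^ (k + 1) * ‖p.1 - p.2‖))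
      (a := (a, b)) ⟨ha, hb⟩
    have h4 := band_le (2 ^ (k + 1) * ‖p.1 - p.2‖) (2 ^ (k + 1) * ‖a - b‖)
    rw [← mul_sub, abs_mul, abs_of_nonneg (show (0 : ℝ) ≤ 2 ^ (k + 1) by positivity)] at h4
    have h5 : abs (‖p.1 - p.2‖ - ‖a - b‖) ≤ 2 * dist S T := by
      refine (abs_norm_sub_norm_le _ _).trans ?_
      have : p.1 - p.2 - (a - b) = (p.1 - a) - (p.2 - b) := by abel
      rw [this]
      refine (norm_sub_le _ _).trans ?_
      rw [← dist_eq_norm, ← dist_eq_norm]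
      linarith
    have h6 := mul_le_mul_of_nonneg_left h4 (show (0 : ℝ) ≤ (1 / 2) ^ (k + 1) by positivity)
    rw [mul_add, ← mul_assoc ((1 / 2 : ℝ) ^ (k + 1)) (2 ^ (k + 1)) (abs _), ← mul_pow] at h6
    norm_num at h6 h3 ⊢
    change _ ≤ sup _ _ + _
    norm_num
    linarith

lemma finite_scaleWeight (S : FinHyp (C00 J ℝ)) : {k | scaleWeight k S ≠ 0}.Finite := by
  have h : ∀ p ∈ (sq S).toSet, {k : ℕ | band (2 ^ k * ‖p.1 - p.2‖) ≠ 0}.Finite := by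
    intro p _
    rcases eq_or_ne p.1 p.2 with h | h
    · refine finite_empty.subset fun k hk => hk ?_
      rw [h, sub_self, norm_zero, mul_zero, band_eq_zero (Or.inl zero_le_one)]
    · have h0 : 0 < ‖p.1 - p.2‖ := norm_pos_iff.2 (sub_ne_zero.2 h)
      obtain ⟨n, hn⟩ := pow_unbounded_of_one_lt (5 / ‖p.1 - p.2‖) (one_lt_two (α := ℝ))
      rw [div_lt_iff₀ h0] at hn
      refine (finite_Iio n).subset fun k hk => ?_
      by_contra hkn
      rw [mem_Iio, not_lt] at hkn
      refine hk (band_eq_zero (Or.inr (hn.le.trans ?_)))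
      exact mul_le_mul_of_nonneg_right (pow_le_pow_right₀ one_le_two hkn) h0.le
  refine ((finite_singleton 0).union ((sq S).finite_toSet.biUnion h)).subset fun k hk => ?_
  cases k with
  | zero => exact Or.inl rfl
  | succ k =>
    right
    obtain ⟨p, hp, h1⟩ := exists_eq_sup
      (fun p : C00 J ℝ × C00 J ℝ => (1 / 2 : ℝ) ^ (k + 1) * band (2 ^ (k + 1) * ‖p.1 - p.2‖)) (sq S)
    simp only [mem_iUnion]
    refine ⟨p, hp, fun h2 => hk ?_⟩
    rw [scaleWeight, ← h1, h2, mul_zero]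

lemma finite_testCoord (k : ℕ) (S : FinHyp (C00 J ℝ)) : {p | testCoord k p S ≠ 0}.Finite := by
  refine (S.finite_toSet.biUnion fun v _ => finite_testFun ((2 : ℝ) ^ k • v)).subset fun p hp => ?_
  obtain ⟨v, hv, h⟩ := exists_eq_sup (fun v => testFun p ((2 : ℝ) ^ k • v)) S
  simp only [mem_iUnion]
  refine ⟨v, hv, fun h2 => hp ?_⟩
  rw [testCoord, ← h, h2]

/-- The embedding of the hyperspace of finite subsets of `C00 J ℝ` into a space `C00`. -/
noncomputable def code (S : FinHyp (C00 J ℝ)) : C00 (ℕ × TestIdx J) ℝ :=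
  C00.mk (fun r => scaleWeight r.1 S * testCoord r.1 r.2 S) <| by
    refine ((finite_scaleWeight S).biUnion fun k _ =>
      (finite_testCoord k S).image fun p => (k, p)).subset ?_
    rintro ⟨k, p⟩ hr
    simp only [mem_iUnion]
    exact ⟨k, left_ne_zero_of_mul hr, p, right_ne_zero_of_mul hr, rfl⟩

lemma code_apply (S : FinHyp (C00 J ℝ)) (k : ℕ) (p : TestIdx J) :
    code S (k, p) = scaleWeight k S * testCoord k p S := rfl

lemma continuous_scaleWeight (k : ℕ) : Continuous (scaleWeight k : FinHyp (C00 J ℝ) → ℝ) := by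
  refine (LipschitzWith.of_dist_le_mul (K := 2) fun S T => ?_).continuous
  rw [Real.dist_eq, abs_sub_le_iff]
  simp only [NNReal.coe_ofNat]
  exact ⟨by linarith [scaleWeight_le k S T], by linarith [scaleWeight_le k T S, dist_comm S T]⟩

lemma continuous_testCoord (k : ℕ) (p : TestIdx J) :
    Continuous (testCoord k p : FinHyp (C00 J ℝ) → ℝ) := by
  refine (LipschitzWith.of_dist_le_mul (K := 3 * 2 ^ k) fun S T => ?_).continuous
  rw [Real.dist_eq]
  exact_mod_cast abs_testCoord_sub_le k p S T

lemma continuous_code : Continuous (code : FinHyp (C00 J ℝ) → C00 (ℕ × TestIdx J) ℝ) := by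
  rw [continuous_iff_continuousAt]
  intro S
  refine C00.tendsto_of (fun r => ?_) fun ε hε => ?_
  · exact ((continuous_scaleWeight r.1).mul (continuous_testCoord r.1 r.2)).tendsto S
  · have hK := finite_scaleWeight S
    have hM : ∀ᶠ T in nhds S, ∀ k ∈ {k | scaleWeight k S ≠ 0},
        scaleWeight k T * (3 * 2 ^ k * dist T S) < ε := by
      refine (eventually_all_finite hK).2 fun k _ => ?_
      have : Tendsto (fun T => scaleWeight k T * (3 * 2 ^ k * dist T S)) (nhds S)
          (nhds (scaleWeight k S * (3 * 2 ^ k * dist S S))) :=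
        ((continuous_scaleWeight k).mul (continuous_const.mul
          (continuous_id.dist continuous_const))).tendsto S
      rw [dist_self, mul_zero, mul_zero] at this
      exact this.eventually_lt_const hε
    refine ⟨_, hK.biUnion fun k _ => (finite_testCoord k S).image fun p => (k, p), ?_⟩
    filter_upwards [hM, ball_mem_nhds S (half_pos hε)] with T hT hTd
    rintro ⟨k, p⟩ hr
    rw [code_apply, Real.norm_of_nonneg (mul_nonneg (scaleWeight_nonneg _ _) (testCoord_nonneg _ _ _))]
    by_cases hk : scaleWeight k S = 0
    · have h1 := scaleWeight_le k T S
      rw [mem_ball] at hTd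
      have h2 := mul_le_of_le_one_right (scaleWeight_nonneg k T) (testCoord_le_one k p T)
      linarith
    · have hp : testCoord k p S = 0 := by
        by_contra h
        exact hr (by simp only [mem_iUnion]; exact ⟨k, hk, p, h, rfl⟩)
      have h1 := (le_abs_self _).trans (abs_testCoord_sub_le k p T S)
      rw [hp, sub_zero] at h1
      exact (mul_le_mul_of_nonneg_left h1 (scaleWeight_nonneg k T)).trans (hT k hk).le

end FinHyp

end HyperspaceEmbedding

namespace FinHyp

section CodeEmbedding

variable {J : Type*}

lemma testCoord_none (k : ℕ) (S : FinHyp (C00 J ℝ)) : testCoord k none S = 1 := by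
  obtain ⟨v, _, h⟩ := exists_eq_sup (fun v => testFun (none : TestIdx J) ((2 : ℝ) ^ k • v)) S
  exact h.symm

lemma separation_step {k : ℕ} {S : FinHyp (C00 J ℝ)}
    (h : scaleWeight (k + 1) S < (1 / 2) ^ (k + 1)) {x y : C00 J ℝ} (hx : x ∈ S.toSet)
    (hy : y ∈ S.toSet) (hxy : 2 ^ k * ‖x - y‖ < 2) : 2 ^ (k + 1) * ‖x - y‖ < 2 := by
  by_contra! h2
  have h1 := one_le_band h2 (by rw [pow_succ]; linarith)
  have h3 := le_sup (A := sq S)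
    (fun p : C00 J ℝ × C00 J ℝ => (1 / 2 : ℝ) ^ (k + 1) * band (2 ^ (k + 1) * ‖p.1 - p.2‖))
    (a := (x, y)) ⟨hx, hy⟩
  have h4 : (0 : ℝ) < (1 / 2) ^ (k + 1) := by positivity
  have h5 := mul_le_mul_of_nonneg_left h1 h4.le
  have h6 : scaleWeight (k + 1) S = sup (fun p : C00 J ℝ × C00 J ℝ =>
    (1 / 2 : ℝ) ^ (k + 1) * band (2 ^ (k + 1) * ‖p.1 - p.2‖)) (sq S) := rfl
  simp only at h3
  linarith

lemma eventually_separated {u : ℕ → FinHyp (C00 J ℝ)} {k₀ : ℕ}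
    (h : ∀ k, k₀ < k → Tendsto (fun m => scaleWeight k (u m)) atTop (nhds 0)) {η : ℝ} (hη : 0 < η) :
    ∀ᶠ m in atTop, ∀ x ∈ (u m).toSet, ∀ y ∈ (u m).toSet, 2 ^ k₀ * ‖x - y‖ < 2 → ‖x - y‖ < η := by
  have key : ∀ L, ∀ᶠ m in atTop, ∀ x ∈ (u m).toSet, ∀ y ∈ (u m).toSet, 2 ^ k₀ * ‖x - y‖ < 2 →
      2 ^ (k₀ + L) * ‖x - y‖ < 2 := by
    intro L
    induction L with
    | zero => exact Eventually.of_forall fun _ _ _ _ _ h => h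
    | succ L ih =>
      filter_upwards [ih, (h (k₀ + L + 1) (by omega)).eventually_lt_const
        (show (0 : ℝ) < (1 / 2) ^ (k₀ + L + 1) by positivity)] with m h1 h2 x hx y hy hxy
      exact separation_step h2 hx hy (h1 x hx y hy hxy)
  obtain ⟨L, hL⟩ := pow_unbounded_of_one_lt (2 / η) (one_lt_two (α := ℝ))
  filter_upwards [key L] with m hm x hx y hy hxy
  have h1 := hm x hx y hy hxy
  rw [div_lt_iff₀ hη] at hL
  by_contra! h2
  have h3 : (2 : ℝ) ^ L ≤ 2 ^ (k₀ + L) := pow_le_pow_right₀ one_le_two (by omega)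
  have h4 := mul_le_mul h3 h2 hη.le (by positivity)
  linarith

lemma exists_level {u : ℕ → FinHyp (C00 J ℝ)} {z : C00 (ℕ × TestIdx J) ℝ}
    (hu : Tendsto (fun m => code (u m)) atTop (nhds z)) :
    ∃ k₀, (∀ k, k₀ < k → Tendsto (fun m => scaleWeight k (u m)) atTop (nhds 0)) ∧
      ∃ G : TestIdx J → ℝ, {p | G p ≠ 0}.Finite ∧
        ∀ ε > 0, ∀ᶠ m in atTop, ∀ p, |testCoord k₀ p (u m) - G p| ≤ ε := by
  have hW : ∀ k, Tendsto (fun m => scaleWeight k (u m)) atTop (nhds (z (k, none))) := fun k => by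
    have := ((C00.continuous_apply (k, none)).tendsto z).comp hu
    simpa [Function.comp_def, code_apply, testCoord_none] using this
  have hfin : {k : ℕ | z (k, none) ≠ 0}.Finite :=
    (z.finite_support.preimage (f := fun k : ℕ => (k, (none : TestIdx J)))
      fun a _ b _ h => (Prod.mk.inj h).1)
  have h0 : z (0, none) = 1 := tendsto_nhds_unique (hW 0) tendsto_const_nhds
  obtain ⟨k₀, hk₀, hmax⟩ := exists_max_image _ id hfin ⟨0, by simp [h0]⟩
  rw [mem_ofPred_eq] at hk₀
  have hpos : 0 < z (k₀, none) := lt_of_le_of_ne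
    (ge_of_tendsto' (hW k₀) fun m => scaleWeight_nonneg _ _) (Ne.symm hk₀)
  set W := z (k₀, none)
  refine ⟨k₀, fun k hk => ?_, fun p => z (k₀, p) / W, ?_, fun ε hε => ?_⟩
  · have : z (k, none) = 0 := by
      by_contra h
      exact absurd (hmax k h) (not_le.2 hk)
    exact this ▸ hW k
  · refine (z.finite_support.preimage (f := fun p : TestIdx J => (k₀, p))
      fun a _ b _ h => (Prod.mk.inj h).2).subset fun p hp h => hp ?_
    have h' : z (k₀, p) = 0 := h
    change z (k₀, p) / W = 0
    rw [h', zero_div]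
  · filter_upwards [Metric.tendsto_nhds.1 hu (ε * W / 2) (by positivity),
      Metric.tendsto_nhds.1 (hW k₀) (ε * W / 2) (by positivity)] with m h1 h2 p
    rw [dist_eq_norm] at h1
    have h3 := (C00.norm_apply_le (code (u m) - z) (k₀, p)).trans_lt h1
    rw [C00.sub_apply, code_apply, Real.norm_eq_abs] at h3
    rw [Real.dist_eq] at h2
    have h4 := testCoord_le_one k₀ p (u m)
    have h5 := testCoord_nonneg k₀ p (u m)
    have h6 : |(W - scaleWeight k₀ (u m)) * testCoord k₀ p (u m)| ≤ ε * W / 2 := by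
      rw [abs_mul, abs_sub_comm, abs_of_nonneg h5]
      exact (mul_le_of_le_one_right (abs_nonneg _) h4).trans h2.le
    have h7 : W * (testCoord k₀ p (u m) - z (k₀, p) / W) =
        (W - scaleWeight k₀ (u m)) * testCoord k₀ p (u m) +
        (scaleWeight k₀ (u m) * testCoord k₀ p (u m) - z (k₀, p)) := by
      field_simp; ring
    have h8 := abs_add_le ((W - scaleWeight k₀ (u m)) * testCoord k₀ p (u m))
      (scaleWeight k₀ (u m) * testCoord k₀ p (u m) - z (k₀, p))
    rw [← h7, abs_mul, abs_of_pos hpos] at h8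
    refine le_of_mul_le_mul_left ?_ hpos
    linarith

lemma isClosedEmbedding_code :
    Topology.IsClosedEmbedding (code : FinHyp (C00 J ℝ) → C00 (ℕ × TestIdx J) ℝ) := by
  refine isClosedEmbedding_of_seq continuous_code fun u z hu => ?_
  obtain ⟨k₀, hsep, G, hGfin, hG⟩ := exists_level hu
  have hsep' := fun {η : ℝ} (hη : 0 < η) => eventually_separated hsep hη
  have hGt : ∀ p, Tendsto (fun m => testCoord k₀ p (u m)) atTop (nhds (G p)) := fun p => by
    rw [Metric.tendsto_nhds]
    intro ε hε
    filter_upwards [hG (ε / 2) (half_pos hε)] with m hm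
    rw [Real.dist_eq]
    exact (hm p).trans_lt (half_lt_self hε)
  have hG0 : ∀ p, 0 ≤ G p := fun p => ge_of_tendsto' (hGt p) fun m => testCoord_nonneg _ _ _
  set Q : Set (J →₀ ℤ) := {q | G (some (q, none)) ≠ 0} with hQ
  have hQfin : Q.Finite := hGfin.preimage (f := fun q : J →₀ ℤ => some (q, none))
    fun a _ b _ h => (Prod.mk.inj (Option.some.inj h)).1
  have hround : ∀ᶠ m in atTop, ∀ x ∈ (u m).toSet, ∃ q ∈ Q, ‖(2 : ℝ) ^ k₀ • x - latticePt q‖ < 1 := by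
    filter_upwards [hG (1 / 2) (by norm_num)] with m hm x hx
    obtain ⟨q, hq⟩ := exists_latticePt ((2 : ℝ) ^ k₀ • x)
    refine ⟨q, fun h0 => ?_, by linarith⟩
    have h1 := le_sup (fun v => testFun (some (q, none)) ((2 : ℝ) ^ k₀ • v)) hx
    simp only [testFun, bump01_eq_one hq] at h1
    have h2 := hm (some (q, none))
    rw [h0, sub_zero, abs_of_nonneg (testCoord_nonneg _ _ _)] at h2
    have h3 : (1 : ℝ) ≤ testCoord k₀ (some (q, none)) (u m) := h1
    linarith
  have hx : ∀ m q, ∃ x ∈ (u m).toSet,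
      testFun (some (q, none)) ((2 : ℝ) ^ k₀ • x) = testCoord k₀ (some (q, none)) (u m) := fun m q =>
    exists_eq_sup (fun v => testFun (some (q, none)) ((2 : ℝ) ^ k₀ • v)) (u m)
  choose x hxu hxt using hx
  have hQpos : ∀ q ∈ Q, 0 < G (some (q, none)) := fun q hq => (hG0 _).lt_of_ne (Ne.symm hq)
  have hxq : ∀ q ∈ Q, ∀ᶠ m in atTop, ‖(2 : ℝ) ^ k₀ • x m q - latticePt q‖ < 1 := by
    intro q hq
    filter_upwards [(hGt (some (q, none))).eventually_const_lt (hQpos q hq)] with m hm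
    by_contra h
    rw [← hxt, testFun, bump01_eq_zero (not_lt.1 h)] at hm
    exact lt_irrefl _ hm
  have hclose : ∀ (q : J →₀ ℤ) (a b : C00 J ℝ), ‖(2 : ℝ) ^ k₀ • a - latticePt q‖ < 1 →
      ‖(2 : ℝ) ^ k₀ • b - latticePt q‖ < 1 → 2 ^ k₀ * ‖a - b‖ < 2 := by
    intro q a b ha hb
    have h1 := norm_sub_le ((2 : ℝ) ^ k₀ • a - latticePt q) ((2 : ℝ) ^ k₀ • b - latticePt q)
    rw [sub_sub_sub_cancel_right, ← smul_sub, norm_smul, norm_pow, Real.norm_ofNat] at h1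
    linarith
  have hHfin : ∀ q : J →₀ ℤ, {i | G (some (q, some (i, true))) - G (some (q, some (i, false))) ≠ 0}.Finite := by
    intro q
    have hb : ∀ b : Bool, {i | G (some (q, some (i, b))) ≠ 0}.Finite := fun b =>
      hGfin.preimage (f := fun i : J => some (q, some (i, b)))
        fun a _ c _ h => (Prod.mk.inj (Option.some.inj (Prod.mk.inj (Option.some.inj h)).2)).1
    refine ((hb true).union (hb false)).subset fun i hi => ?_
    by_contra h
    simp only [mem_union, mem_ofPred_eq, not_or, not_not] at h
    exact hi (by rw [h.1, h.2, sub_zero])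
  set H : (J →₀ ℤ) → C00 J ℝ := fun q => C00.mk _ (hHfin q)
  have hlim : ∀ q ∈ Q, Tendsto (fun m => (testCoord k₀ (some (q, none)) (u m)) •
      ((2 : ℝ) ^ k₀ • x m q - latticePt q)) atTop (nhds (H q)) := by
    intro q hq
    rw [Metric.tendsto_nhds]
    intro ε hε
    have h2k : (0 : ℝ) < 3 * 2 ^ k₀ := by positivity
    filter_upwards [hG (ε / 8) (by positivity), hxq q hq,
      hsep' (show 0 < ε / 8 / (3 * 2 ^ k₀) by positivity)] with m hGm hxm hsm
    have hb : ∀ i b, |testFun (some (q, some (i, b))) ((2 : ℝ) ^ k₀ • x m q) -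
        G (some (q, some (i, b)))| ≤ ε / 4 := by
      intro i b
      have h1 := hGm (some (q, some (i, b)))
      have h2 := le_sup (fun v => testFun (some (q, some (i, b))) ((2 : ℝ) ^ k₀ • v)) (hxu m q)
      obtain ⟨y, hy, h3⟩ := exists_eq_sup
        (fun v => testFun (some (q, some (i, b))) ((2 : ℝ) ^ k₀ • v)) (u m)
      change _ ≤ testCoord k₀ _ _ at h2
      change _ = testCoord k₀ _ _ at h3
      have h4 : testCoord k₀ (some (q, some (i, b))) (u m) ≤
          testFun (some (q, some (i, b))) ((2 : ℝ) ^ k₀ • x m q) + ε / 8 := by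
        by_cases h5 : ‖(2 : ℝ) ^ k₀ • y - latticePt q‖ < 1
        · have h6 := hsm y hy _ (hxu m q) (hclose q _ _ h5 hxm)
          have h7 := (le_abs_self _).trans (abs_testFun_sub_le (some (q, some (i, b)))
            ((2 : ℝ) ^ k₀ • y) ((2 : ℝ) ^ k₀ • x m q))
          rw [← smul_sub, norm_smul, norm_pow, Real.norm_ofNat, ← mul_assoc] at h7
          rw [lt_div_iff₀ h2k] at h6
          linarith
        · rw [← h3]
          have h6 : testFun (some (q, some (i, b))) ((2 : ℝ) ^ k₀ • y) = 0 := by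
            rw [testFun, bump01_eq_zero (not_lt.1 h5), zero_mul]
          rw [h6]
          linarith [testFun_nonneg (some (q, some (i, b))) ((2 : ℝ) ^ k₀ • x m q)]
      rw [abs_le] at h1 ⊢
      constructor <;> linarith [h1.1, h1.2]
    rw [dist_eq_norm]
    refine ((C00.norm_le_iff (half_pos hε).le).2 fun i => ?_).trans_lt (half_lt_self hε)
    have e : (testCoord k₀ (some (q, none)) (u m) • ((2 : ℝ) ^ k₀ • x m q - latticePt q) - H q) i =
        (testFun (some (q, some (i, true))) ((2 : ℝ) ^ k₀ • x m q) -
          G (some (q, some (i, true)))) -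
        (testFun (some (q, some (i, false))) ((2 : ℝ) ^ k₀ • x m q) -
          G (some (q, some (i, false)))) := by
      have h1 := signPart_sub (((2 : ℝ) ^ k₀ • x m q - latticePt q) i)
      have h2 : H q i = G (some (q, some (i, true))) - G (some (q, some (i, false))) := rfl
      rw [C00.sub_apply, C00.smul_apply, h2, ← hxt]
      simp only [testFun, smul_eq_mul]
      linear_combination -(bump01 ‖(2 : ℝ) ^ k₀ • x m q - latticePt q‖) * h1
    rw [e, Real.norm_eq_abs]
    have h1 := abs_sub (testFun (some (q, some (i, true))) ((2 : ℝ) ^ k₀ • x m q) -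
          G (some (q, some (i, true)))) (testFun (some (q, some (i, false))) ((2 : ℝ) ^ k₀ • x m q) -
          G (some (q, some (i, false))))
    linarith [hb i true, hb i false]
  set v : (J →₀ ℤ) → C00 J ℝ := fun q =>
    ((2 : ℝ) ^ k₀)⁻¹ • ((G (some (q, none)))⁻¹ • H q + latticePt q)
  have hv : ∀ q ∈ Q, Tendsto (fun m => x m q) atTop (nhds (v q)) := by
    intro q hq
    have h1 := ((((hGt (some (q, none))).inv₀ hq).smul (hlim q hq)).add_const
      (latticePt q)).const_smul (((2 : ℝ) ^ k₀)⁻¹)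
    refine h1.congr' ?_
    filter_upwards [(hGt (some (q, none))).eventually_const_lt (hQpos q hq)] with m hm
    rw [inv_smul_smul₀ hm.ne', sub_add_cancel, inv_smul_smul₀ (by positivity)]
  have hQne : Q.Nonempty := by
    obtain ⟨m, hm⟩ := hround.exists
    obtain ⟨a, ha⟩ := (u m).nonempty_toSet
    obtain ⟨q, hq, _⟩ := hm a ha
    exact ⟨q, hq⟩
  refine ⟨mk (v '' Q) (hQne.image v) (hQfin.image v), tendsto_of (fun ε hε => ?_) ?_⟩
  · filter_upwards [hround, hsep' (half_pos hε), (eventually_all_finite hQfin).2 hxq,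
      (eventually_all_finite hQfin).2 fun q hq =>
        Metric.tendsto_nhds.1 (hv q hq) (ε / 2) (half_pos hε)] with m h1 h2 h3 h4 a ha
    obtain ⟨q, hq, haq⟩ := h1 a ha
    refine ⟨v q, mem_image_of_mem v hq, ?_⟩
    have h5 := h2 a ha _ (hxu m q) (hclose q _ _ haq (h3 q hq))
    rw [← dist_eq_norm] at h5
    linarith [dist_triangle a (x m q) (v q), h4 q hq]
  · rintro _ ⟨q, hq, rfl⟩ ε hε
    filter_upwards [Metric.tendsto_nhds.1 (hv q hq) ε hε] with m hm
    exact ⟨x m q, hxu m q, by rwa [dist_comm]⟩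

/-- A closed embedding induces a closed embedding of hyperspaces. -/
lemma isClosedEmbedding_map {X Y : Type*} [MetricSpace X] [MetricSpace Y] {f : X → Y}
    (hf : Topology.IsClosedEmbedding f) : Topology.IsClosedEmbedding (map f) := by
  refine isClosedEmbedding_of_seq (continuous_map hf.continuous) fun u T hu => ?_
  have hTr : T.toSet ⊆ range f := by
    intro t ht
    rw [← hf.isClosed_range.closure_eq, Metric.mem_closure_iff]
    intro ε hε
    obtain ⟨m, hm⟩ := (hu.eventually (eventually_close T hε)).exists
    obtain ⟨_, ⟨b, _, rfl⟩, h⟩ := hm.2 t ht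
    exact ⟨_, mem_range_self b, h⟩
  have him : f '' (f ⁻¹' T.toSet) = T.toSet := image_preimage_eq_of_subset hTr
  have hne : (f ⁻¹' T.toSet).Nonempty := by
    have := T.nonempty_toSet
    rw [← him] at this
    exact this.of_image
  refine ⟨mk (f ⁻¹' T.toSet) hne (T.finite_toSet.preimage hf.injective.injOn), ?_⟩
  have hnear : ∀ ε > 0, ∀ t ∈ T.toSet, ∀ᶠ y in nhds t, ∀ a x, f a = t → f x = y → dist x a < ε := by
    intro ε hε t ht
    obtain ⟨a, rfl⟩ := hTr ht
    have h1 := hf.isInducing.nhds_eq_comap a ▸ ball_mem_nhds a hε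
    obtain ⟨V, hV, hVs⟩ := mem_comap.1 h1
    filter_upwards [hV] with y hy b x hb hx
    rw [hf.injective hb]
    exact hVs (show f x ∈ V by rwa [hx])
  refine tendsto_of (fun ε hε => ?_) fun a ha ε hε => ?_
  · filter_upwards [hu.eventually (eventually_forall_mem (hnear ε hε))] with m hm x hx
    obtain ⟨t, ht, h⟩ := hm.1 (f x) (mem_image_of_mem f hx)
    obtain ⟨a, rfl⟩ := hTr ht
    exact ⟨a, ht, h a x rfl rfl⟩
  · filter_upwards [hu.eventually (eventually_forall_mem (hnear ε hε))] with m hm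
    obtain ⟨_, ⟨x, hx, rfl⟩, h⟩ := hm.2 (f a) ha
    exact ⟨x, hx, by rw [dist_comm]; exact h a x rfl rfl⟩

end CodeEmbedding

end FinHyp

section ManifoldEmbedding

theorem exists_surjective_of_connected_cover {X D ι : Type*} [TopologicalSpace X]
    [ConnectedSpace X] {O : ι → Set X} (hO : ∀ i, IsOpen (O i)) (hne : ∀ i, (O i).Nonempty)
    (hcov : ∀ x, ∃ i, x ∈ O i) (hfin : ∀ x, {i | x ∈ O i}.Finite) {d : ι → D → X}
    (hd : ∀ i U, IsOpen U → U ⊆ O i → U.Nonempty → ∃ t, d i t ∈ U) :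
    ∃ g : List (D × ℕ) → ι, Function.Surjective g := by
  have henum : ∀ x, ∃ e : ℕ → ι, {i | x ∈ O i} = range e := fun x =>
    (hfin x).countable.exists_eq_range (hcov x)
  choose e he using henum
  obtain ⟨i₀, -⟩ := hcov (Classical.arbitrary X)
  let g : List (D × ℕ) → ι := fun l => l.foldr (fun p i => e (d i p.1) p.2) i₀
  have hadj : ∀ i ∈ range g, ∀ j, (O i ∩ O j).Nonempty → j ∈ range g := by
    rintro i ⟨l, rfl⟩ j hij
    obtain ⟨t, ht⟩ := hd (g l) _ ((hO _).inter (hO j)) inter_subset_left hij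
    obtain ⟨n, hn⟩ : j ∈ range (e (d (g l) t)) := he (d (g l) t) ▸ ht.2
    exact ⟨(t, n) :: l, hn⟩
  refine ⟨g, fun j => by_contra fun hj => ?_⟩
  have hpre := isPreconnected_univ (α := X) (⋃ i ∈ range g, O i) (⋃ i ∈ (range g)ᶜ, O i)
    (isOpen_biUnion fun i _ => hO i) (isOpen_biUnion fun i _ => hO i)
    (fun x _ => ?_) ?_ ?_
  · obtain ⟨x, -, hx, hx'⟩ := hpre
    simp only [mem_iUnion₂] at hx hx'
    obtain ⟨i, hi, hxi⟩ := hx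
    obtain ⟨k, hk, hxk⟩ := hx'
    exact hk (hadj i hi k ⟨x, hxi, hxk⟩)
  · obtain ⟨i, hi⟩ := hcov x
    by_cases h : i ∈ range g
    · exact Or.inl (mem_biUnion h hi)
    · exact Or.inr (mem_biUnion (mem_compl h) hi)
  · obtain ⟨x, hx⟩ := hne i₀
    exact ⟨x, mem_univ x, mem_biUnion (show i₀ ∈ range g from ⟨[], rfl⟩) hx⟩
  · obtain ⟨x, hx⟩ := hne j
    exact ⟨x, mem_univ x, mem_biUnion (mem_compl hj) hx⟩

theorem C00.denseRange_rat (κ : Type*) :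
    DenseRange fun t : κ →₀ ℚ => (C00.mk (fun k => (t k : ℝ))
      (t.hasFiniteSupport.subset fun k hk h => hk (by simp [h])) : C00 κ ℝ) := by
  refine Metric.denseRange_iff.2 fun z r hr => ?_
  have h : ∀ k, ∃ q : ℚ, |z k - q| ≤ r / 2 ∧ (z k = 0 → q = 0) := fun k => by
    by_cases hk : z k = 0
    · exact ⟨0, by simp [hk, (half_pos hr).le], fun _ => rfl⟩
    · obtain ⟨q, hq⟩ := exists_rat_near (z k) (half_pos hr)
      exact ⟨q, hq.le, fun h => absurd h hk⟩
  choose q hq hq0 using h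
  refine ⟨Finsupp.ofSupportFinite q (z.finite_support.subset fun k hk h => hk (hq0 k h)), ?_⟩
  rw [dist_eq_norm]
  refine ((C00.norm_le_iff (half_pos hr).le).2 fun k => ?_).trans_lt (half_lt_self hr)
  rw [C00.sub_apply, C00.mk_apply]
  exact hq k

theorem nonempty_equiv_list_finsupp (κ : Type*) [Infinite κ] :
    Nonempty (List ((κ →₀ ℚ) × ℕ) ≃ κ) := by
  rw [← Cardinal.eq, Cardinal.mk_list_eq_mk, Cardinal.mk_prod, Cardinal.lift_uzero,
    Cardinal.mk_finsupp_lift_of_infinite]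
  simp

variable {X κ : Type*} [MetricSpace X] [ConnectedSpace X] [Infinite κ]

theorem exists_isClosedEmbedding_of_charts
    (hX : ∀ x : X, ∃ h : OpenPartialHomeomorph X (C00 κ ℝ), x ∈ h.source) :
    ∃ f : X → C00 κ ℝ, Topology.IsClosedEmbedding f := by
  classical
  choose h hx using hX
  have hball : ∀ x, ∃ r > 0, closedBall (h x x) r ⊆ (h x).target := fun x =>
    Metric.nhds_basis_closedBall.mem_iff.1 ((h x).open_target.mem_nhds ((h x).map_source (hx x)))
  choose r hr hrt using hball
  let W : X → Set X := fun x => (h x).source ∩ h x ⁻¹' ball (h x x) (r x)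
  have hWo : ∀ x, IsOpen (W x) := fun x => (h x).isOpen_inter_preimage isOpen_ball
  obtain ⟨f, hfW⟩ := BumpCovering.exists_isSubordinate isClosed_univ W hWo
    fun x _ => mem_iUnion.2 ⟨x, hx x, mem_ball_self (hr x)⟩
  have hWs : ∀ i, tsupport (f i) ⊆ (h i).source := fun i => (hfW i).trans inter_subset_left
  let O : X → Set X := fun i => {x | f i x ≠ 0}
  have hOo : ∀ i, IsOpen (O i) := fun i => isOpen_ne_fun (f i).continuous continuous_const
  have hOW : ∀ i, O i ⊆ W i := fun i => (subset_tsupport (f i)).trans (hfW i)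
  let ι := {i // (O i).Nonempty}
  have hone : ∀ x, ∃ i : ι, f i x = 1 := fun x =>
    ⟨⟨f.ind x (mem_univ x), x, by simp [O, f.ind_apply]⟩, f.ind_apply x (mem_univ x)⟩
  obtain ⟨g, hg⟩ := exists_surjective_of_connected_cover (D := κ →₀ ℚ) (O := fun i : ι => O i)
    (fun i => hOo i) (fun i => i.2)
    (fun x => (hone x).imp fun i hi => by simp [O, hi])
    (fun x => (f.point_finite x).preimage Subtype.val_injective.injOn)
    (d := fun i t => (h i).symm (C00.mk (fun k => (t k : ℝ))
      (t.hasFiniteSupport.subset fun k hk h => hk (by simp [h])))) (by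
      intro i U hU hUi hne
      have hUs : U ⊆ (h i).source := hUi.trans ((hOW i).trans inter_subset_left)
      obtain ⟨t, y, hy, hyt⟩ := (C00.denseRange_rat κ).exists_mem_open
        ((h i).isOpen_image_of_subset_source hU hUs) (hne.image _)
      refine ⟨t, ?_⟩
      rw [← hyt, (h i).left_inv (hUs hy)]
      exact hy)
  have hι : Nonempty (ι ↪ κ) := by
    obtain ⟨e⟩ := nonempty_equiv_list_finsupp κ
    exact ⟨⟨fun i => e (Function.surjInv hg i),
      e.injective.comp (Function.injective_surjInv hg)⟩⟩
  have hidx : Nonempty ((ι × Bool) × κ ↪ κ) := by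
    obtain ⟨a⟩ := hι
    obtain ⟨b⟩ : Nonempty ((κ × Bool) × κ ≃ κ) := by
      have h2 : Cardinal.mk κ * 2 = Cardinal.mk κ :=
        Cardinal.mul_eq_left (Cardinal.aleph0_le_mk κ)
          ((Cardinal.natCast_lt_aleph0 (n := 2)).le.trans (Cardinal.aleph0_le_mk κ)) two_ne_zero
      rw [← Cardinal.eq]
      simp [h2]
    exact ⟨((a.prodMap (Function.Embedding.refl Bool)).prodMap (Function.Embedding.refl κ)).trans
      b.toEmbedding⟩
  obtain ⟨eκ⟩ := hidx
  let c : C00 κ ℝ := C00.mk (Pi.single (Classical.arbitrary κ) 1)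
    ((finite_singleton (Classical.arbitrary κ)).subset fun k hk => by
      by_contra hk'; exact hk (Pi.single_eq_of_ne hk' _))
  have hc : c (Classical.arbitrary κ) = 1 := by
    rw [C00.mk_apply, Pi.single_eq_same]
  let G : ι × Bool → X → C00 κ ℝ := fun p x =>
    f p.1 x • (if p.2 then h p.1 x else c)
  have hG0 : ∀ p x, f p.1 x = 0 → G p x = 0 := fun p x hp => by simp [G, hp]
  have hGc : ∀ p, Continuous (G p) := by
    rintro ⟨i, _ | _⟩
    · exact (f i).continuous.smul continuous_const
    · refine continuous_iff_continuousAt.2 fun x => ?_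
      by_cases hxs : x ∈ tsupport (f i)
      · exact (f i).continuous.continuousAt.smul ((h i).continuousAt (hWs i hxs))
      · have : G (i, true) =ᶠ[nhds x] fun _ => 0 := by
          filter_upwards [notMem_tsupport_iff_eventuallyEq.1 hxs] with y hy
          exact hG0 _ _ hy
        exact continuousAt_const.congr this.symm
  have hfinG : ∀ x, {p | G p x ≠ 0}.Finite := fun x => by
    refine (((f.point_finite x).preimage (f := fun i : ι => (i : X))
      Subtype.val_injective.injOn).prod (finite_univ (α := Bool))).subset fun p hp => ?_
    exact ⟨fun h' => hp (hG0 p x h'), mem_univ _⟩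
  let F : X → C00 (ι × Bool) (C00 κ ℝ) := fun x => C00.mk (fun p => G p x) (hfinG x)
  have hF : Continuous F := by
    refine continuous_iff_continuousAt.2 fun x => C00.tendsto_of
      (fun p => (hGc p).continuousAt) fun ε hε => ?_
    obtain ⟨t, ht, hfin⟩ := f.locallyFinite x
    refine ⟨_, ((hfin.preimage (f := fun i : ι => (i : X))
      Subtype.val_injective.injOn).prod (finite_univ (α := Bool))), ?_⟩
    filter_upwards [ht] with y hy p hp
    have h0 : f p.1 y = 0 := by
      by_contra h0
      exact hp ⟨⟨y, h0, hy⟩, mem_univ _⟩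
    rw [C00.mk_apply, hG0 p y h0, norm_zero]
    exact hε.le
  have hFe : Topology.IsClosedEmbedding F := by
    refine isClosedEmbedding_of_seq hF fun u z hz => ?_
    obtain ⟨i, hi⟩ : ∃ i : ι, z (i, false) ≠ 0 := by
      obtain ⟨m, hm⟩ := (hz.eventually (C00.eventually_tail z one_pos)).exists
      obtain ⟨i, hi⟩ := hone (u m)
      refine ⟨i, fun h0 => (hm _ h0).not_ge ?_⟩
      have h1 := C00.norm_apply_le c (Classical.arbitrary κ)
      rw [hc, norm_one] at h1
      simpa [F, G, hi] using h1
    have hcoord : ∀ p, Tendsto (fun m => G p (u m)) atTop (nhds (z p)) := fun p =>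
      ((C00.continuous_apply p).tendsto z).comp hz
    set t := z (i, false) (Classical.arbitrary κ)
    have hft : Tendsto (fun m => f i (u m)) atTop (nhds t) := by
      refine (((C00.continuous_apply (Classical.arbitrary κ)).tendsto _).comp
        (hcoord (i, false))).congr fun m => ?_
      simp [G, hc]
    have ht : t ≠ 0 := fun h0 => hi (by
      refine tendsto_nhds_unique (hcoord (i, false)) ?_
      have := hft.smul_const c
      rw [h0, zero_smul] at this
      exact this)
    have hne := hft.eventually_ne ht
    have hv : Tendsto (fun m => h i (u m)) atTop (nhds (t⁻¹ • z (i, true))) := by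
      refine ((hft.inv₀ ht).smul (hcoord (i, true))).congr' ?_
      filter_upwards [hne] with m hm
      simp [G, smul_smul, inv_mul_cancel₀ hm]
    have hvt : t⁻¹ • z (i, true) ∈ (h i).target := hrt i (isClosed_closedBall.mem_of_tendsto hv
      (hne.mono fun m hm => ball_subset_closedBall (hOW i hm).2))
    refine ⟨(h i).symm (t⁻¹ • z (i, true)),
      (((h i).continuousAt_symm hvt).tendsto.comp hv).congr' ?_⟩
    filter_upwards [hne] with m hm
    exact (h i).left_inv (hOW i hm).1
  exact ⟨_, (C00.isClosedEmbedding_emb eκ).comp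
    (C00.curryHomeo.isClosedEmbedding.comp hFe)⟩

theorem FinHyp.exists_isClosedEmbedding_of_charts
    (hX : ∀ x : X, ∃ h : OpenPartialHomeomorph X (C00 κ ℝ), x ∈ h.source) :
    ∃ j : FinHyp X → C00 κ ℝ, Topology.IsClosedEmbedding j := by
  obtain ⟨f, hf⟩ := _root_.exists_isClosedEmbedding_of_charts hX
  obtain ⟨e⟩ : Nonempty (ℕ × TestIdx κ ≃ κ) := by
    have hκ := Cardinal.aleph0_le_mk κ
    have h2 : Cardinal.mk κ * 2 = Cardinal.mk κ :=
      Cardinal.mul_eq_left hκ ((Cardinal.natCast_lt_aleph0 (n := 2)).le.trans hκ) two_ne_zero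
    rw [← Cardinal.eq]
    simp [TestIdx, h2, Cardinal.add_one_eq hκ]
  exact ⟨_, (C00.isClosedEmbedding_emb e.toEmbedding).comp
    (isClosedEmbedding_code.comp (isClosedEmbedding_map hf))⟩

end ManifoldEmbedding

/-- A pair of maps restricting to mutually inverse homeomorphisms between two subsets. -/
structure HomeoOn {X Y : Type*} [TopologicalSpace X] [TopologicalSpace Y] (A : Set X) (B : Set Y)
    (F : X → Y) (G : Y → X) : Prop where
  contF : ContinuousOn F A
  contG : ContinuousOn G B
  mapsF : MapsTo F A B
  mapsG : MapsTo G B A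
  left : ∀ p ∈ A, G (F p) = p
  right : ∀ q ∈ B, F (G q) = q

namespace HomeoOn

variable {X Y Z : Type*} [TopologicalSpace X] [TopologicalSpace Y] [TopologicalSpace Z]
  {A : Set X} {B : Set Y} {C : Set Z} {F : X → Y} {G : Y → X} {F' : Y → Z} {G' : Z → Y}

lemma symm (h : HomeoOn A B F G) : HomeoOn B A G F :=
  ⟨h.contG, h.contF, h.mapsG, h.mapsF, h.right, h.left⟩

lemma trans (h : HomeoOn A B F G) (h' : HomeoOn B C F' G') : HomeoOn A C (F' ∘ F) (G ∘ G') where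
  contF := h'.contF.comp h.contF h.mapsF
  contG := h.contG.comp h'.contG h'.mapsG
  mapsF := h'.mapsF.comp h.mapsF
  mapsG := h.mapsG.comp h'.mapsG
  left p hp := by simp [h'.left _ (h.mapsF hp), h.left p hp]
  right p hp := by simp [h.right _ (h'.mapsG hp), h'.right p hp]

lemma restrict (h : HomeoOn A B F G) {A' : Set X} {B' : Set Y} (hA : A' ⊆ A) (hB : B' ⊆ B)
    (h1 : MapsTo F A' B') (h2 : MapsTo G B' A') : HomeoOn A' B' F G :=
  ⟨h.contF.mono hA, h.contG.mono hB, h1, h2, fun p hp => h.left p (hA hp),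
    fun p hp => h.right p (hB hp)⟩

/-- A pair of mutually inverse partial homeomorphisms gives a homeomorphism of subtypes. -/
def toHomeomorph (h : HomeoOn A B F G) : A ≃ₜ B where
  toFun p := ⟨F p, h.mapsF p.2⟩
  invFun q := ⟨G q, h.mapsG q.2⟩
  left_inv p := Subtype.ext (h.left p p.2)
  right_inv q := Subtype.ext (h.right q q.2)
  continuous_toFun := (continuousOn_iff_continuous_domRestrict.1 h.contF).subtype_mk _
  continuous_invFun := (continuousOn_iff_continuous_domRestrict.1 h.contG).subtype_mk _

end HomeoOn

section InfiniteComposition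

variable {Z : Type*}

/-- The composition `Ψ (n - 1) ∘ ⋯ ∘ Ψ 0`. -/
def compUp (Ψ : ℕ → Z → Z) : ℕ → Z → Z
  | 0 => id
  | n + 1 => Ψ n ∘ compUp Ψ n

/-- The composition `Ψ 0 ∘ ⋯ ∘ Ψ (n - 1)`. -/
def compDown (Ψ : ℕ → Z → Z) : ℕ → Z → Z
  | 0 => id
  | n + 1 => compDown Ψ n ∘ Ψ n

variable {Ψ : ℕ → Z → Z}

lemma compDown_compUp (hinv : ∀ n z, Ψ n (Ψ n z) = z) (n : ℕ) (z : Z) :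
    compDown Ψ n (compUp Ψ n z) = z := by
  induction n with
  | zero => rfl
  | succ n ih => simp [compDown, compUp, hinv, ih]

lemma compUp_compDown (hinv : ∀ n z, Ψ n (Ψ n z) = z) (n : ℕ) (z : Z) :
    compUp Ψ n (compDown Ψ n z) = z := by
  induction n generalizing z with
  | zero => rfl
  | succ n ih => simp [compDown, compUp, hinv, ih]

lemma compDown_eq_of_fixed {y : Z} {N : ℕ} (hy : ∀ n ≥ N, Ψ n y = y) :
    ∀ n ≥ N, compDown Ψ n y = compDown Ψ N y := by
  intro n hn
  induction n, hn using Nat.le_induction with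
  | base => rfl
  | succ n hn ih => rw [compDown, Function.comp_apply, hy n hn, ih]

lemma compUp_mem_of_mapsTo {V : Set Z} {N : ℕ} (hV : ∀ n ≥ N, MapsTo (Ψ n) V V) {z : Z}
    (hz : compUp Ψ N z ∈ V) : ∀ n ≥ N, compUp Ψ n z ∈ V := by
  intro n hn
  induction n, hn using Nat.le_induction with
  | base => exact hz
  | succ n hn ih => exact hV n hn ih

lemma compDown_mem_of_mapsTo {V : Set Z} {N : ℕ} (hV : ∀ n ≥ N, MapsTo (Ψ n) V V) :
    ∀ n ≥ N, ∀ z ∈ V, compDown Ψ n z ∈ compDown Ψ N '' V := by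
  intro n hn
  induction n, hn using Nat.le_induction with
  | base => exact fun z hz => mem_image_of_mem _ hz
  | succ n hn ih => exact fun z hz => ih _ (hV n hn hz)

variable [TopologicalSpace Z]

lemma continuous_compUp (hc : ∀ n, Continuous (Ψ n)) (n : ℕ) : Continuous (compUp Ψ n) := by
  induction n with
  | zero => exact continuous_id
  | succ n ih => exact (hc n).comp ih

lemma continuous_compDown (hc : ∀ n, Continuous (Ψ n)) (n : ℕ) : Continuous (compDown Ψ n) := by
  induction n with
  | zero => exact continuous_id
  | succ n ih => exact ih.comp (hc n)

/-- An infinite composition of involutions that is pointwise eventually constant is a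
homeomorphism onto a set of eventually fixed points having small invariant neighborhoods. -/
theorem exists_homeoOn_of_involutions (hc : ∀ n, Continuous (Ψ n))
    (hinv : ∀ n z, Ψ n (Ψ n z) = z) {T : Set Z}
    (hT : ∀ y ∈ T, ∃ N, (∀ n ≥ N, Ψ n y = y) ∧
      ∀ U ∈ nhds y, ∃ V ∈ nhds y, V ⊆ U ∧ ∀ n ≥ N, MapsTo (Ψ n) V V)
    (hst : ∀ w, ∃ N, ∃ y ∈ T, ∀ n ≥ N, compUp Ψ n w = y) :
    ∃ Φ Θ : Z → Z, HomeoOn univ T Φ Θ ∧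
      ∀ y ∈ T, ∀ᶠ n in atTop, compDown Ψ n y = Θ y := by
  classical
  choose NΦ Φ hΦT hΦ using hst
  choose! NΘ hfix hnbhd using hT
  refine ⟨Φ, fun y => compDown Ψ (NΘ y) y, ⟨?_, ?_, fun w _ => hΦT w, mapsTo_univ _ _, ?_, ?_⟩, ?_⟩
  · rw [continuousOn_univ, continuous_iff_continuousAt]
    intro w U hU
    obtain ⟨V, hV, hVU, hVm⟩ := hnbhd _ (hΦT w) U hU
    set K := max (NΦ w) (NΘ (Φ w))
    have hK : compUp Ψ K w = Φ w := hΦ w K (le_max_left _ _)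
    have : compUp Ψ K ⁻¹' V ∈ nhds w :=
      (continuous_compUp hc K).continuousAt (hK.symm ▸ hV)
    rw [mem_map]
    filter_upwards [this] with w' hw'
    have h1 := compUp_mem_of_mapsTo (fun n hn => hVm n ((le_max_right _ _).trans hn)) hw'
      (max K (NΦ w')) (le_max_left _ _)
    rw [hΦ w' _ (le_max_right _ _)] at h1
    exact hVU h1
  · intro y hy U hU
    obtain ⟨V, hV, hVU, hVm⟩ := hnbhd y hy _ ((continuous_compDown hc (NΘ y)).continuousAt hU)
    rw [mem_map]
    filter_upwards [mem_nhdsWithin_of_mem_nhds hV, self_mem_nhdsWithin] with y' hy' hT'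
    obtain ⟨v, hv, hvy⟩ := compDown_mem_of_mapsTo hVm (max (NΘ y) (NΘ y')) (le_max_left _ _) y' hy'
    rw [compDown_eq_of_fixed (hfix y' hT') _ (le_max_right _ _)] at hvy
    change compDown Ψ (NΘ y') y' ∈ U
    rw [← hvy]
    exact hVU hv
  · intro w _
    have h1 := compDown_eq_of_fixed (hfix _ (hΦT w)) (max (NΘ (Φ w)) (NΦ w)) (le_max_left _ _)
    have h2 := hΦ w (max (NΘ (Φ w)) (NΦ w)) (le_max_right _ _)
    have h3 := compDown_compUp hinv (max (NΘ (Φ w)) (NΦ w)) w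
    rwa [h2, h1] at h3
  · intro y hy
    set w := compDown Ψ (NΘ y) y with hw
    have h1 := compDown_eq_of_fixed (hfix _ hy) (max (NΘ y) (NΦ w)) (le_max_left _ _)
    have h2 := hΦ w (max (NΘ y) (NΦ w)) (le_max_right _ _)
    rw [← hw] at h1
    have h3 := compUp_compDown hinv (max (NΘ y) (NΦ w)) y
    rwa [h1, h2] at h3
  · exact fun y hy => eventually_atTop.2 ⟨NΘ y, compDown_eq_of_fixed (hfix y hy)⟩

end InfiniteComposition

section Rotation

variable {E : Type*} [NormedAddCommGroup E] [NormedSpace ℝ E]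

/-- A linear path from the swap to the reflection `(y, f) ↦ (-y, f)`. -/
def mix (t : ℝ) (p : E × E) : E × E := ((-t) • p.1 + (1 - t) • p.2, (1 - t) • p.1 + t • p.2)

lemma mix_mix (t : ℝ) (p : E × E) : mix t (mix t p) = (t ^ 2 + (1 - t) ^ 2) • p := by
  refine Prod.ext ?_ ?_ <;> simp only [mix, Prod.smul_fst, Prod.smul_snd] <;> module

lemma mix_smul (t c : ℝ) (p : E × E) : mix t (c • p) = c • mix t p := by
  refine Prod.ext ?_ ?_ <;> simp only [mix, Prod.smul_fst, Prod.smul_snd] <;> module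

lemma continuous_mix : Continuous fun q : ℝ × (E × E) => mix q.1 q.2 := by
  unfold mix
  fun_prop

/-- The sum norm on a product. -/
def sumNorm (p : E × E) : ℝ := ‖p.1‖ + ‖p.2‖

omit [NormedSpace ℝ E] in
lemma sumNorm_nonneg (p : E × E) : 0 ≤ sumNorm p := by unfold sumNorm; positivity

omit [NormedSpace ℝ E] in
lemma sumNorm_eq_zero {p : E × E} : sumNorm p = 0 ↔ p = 0 := by
  rw [sumNorm, add_eq_zero_iff_of_nonneg (norm_nonneg _) (norm_nonneg _), norm_eq_zero,
    norm_eq_zero, Prod.ext_iff]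
  rfl

lemma sumNorm_smul (c : ℝ) (p : E × E) : sumNorm (c • p) = |c| * sumNorm p := by
  simp [sumNorm, norm_smul, mul_add]

omit [NormedSpace ℝ E] in
lemma continuous_sumNorm : Continuous (sumNorm : E × E → ℝ) := by
  unfold sumNorm
  fun_prop

lemma scale_pos (t : ℝ) : 0 < t ^ 2 + (1 - t) ^ 2 := by nlinarith [sq_nonneg (2 * t - 1)]

lemma mix_ne_zero (t : ℝ) {p : E × E} (hp : p ≠ 0) : mix t p ≠ 0 := fun h => by
  have := mix_mix t p
  rw [h, eq_comm] at this
  have h0 : mix t (0 : E × E) = 0 := by simp [mix]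
  rw [h0, smul_eq_zero] at this
  rcases this with h1 | h1
  exacts [(scale_pos t).ne' h1, hp h1]

/-- A norm preserving path of involutions from the swap to the reflection. -/
noncomputable def rot (t : ℝ) (p : E × E) : E × E := (sumNorm p / sumNorm (mix t p)) • mix t p

lemma sumNorm_rot (t : ℝ) (p : E × E) : sumNorm (rot t p) = sumNorm p := by
  rcases eq_or_ne p 0 with rfl | hp
  · simp [rot, sumNorm]
  · have h := mt sumNorm_eq_zero.1 (mix_ne_zero t hp)
    rw [rot, sumNorm_smul, abs_of_nonneg (div_nonneg (sumNorm_nonneg _) (sumNorm_nonneg _)),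
      div_mul_cancel₀ _ h]

lemma rot_rot (t : ℝ) (p : E × E) : rot t (rot t p) = p := by
  rcases eq_or_ne p 0 with rfl | hp
  · simp [rot, sumNorm]
  · have h := mt sumNorm_eq_zero.1 (mix_ne_zero t hp)
    have h' := mt sumNorm_eq_zero.1 hp
    have hs := scale_pos t
    have hc : 0 < sumNorm p / sumNorm (mix t p) :=
      div_pos ((sumNorm_nonneg _).lt_of_ne' h') ((sumNorm_nonneg _).lt_of_ne' h)
    have hm : mix t (rot t p) =
        (sumNorm p / sumNorm (mix t p) * (t ^ 2 + (1 - t) ^ 2)) • p := by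
      rw [rot, mix_smul, mix_mix, smul_smul]
    rw [rot, sumNorm_rot, hm, smul_smul, sumNorm_smul, abs_of_pos (mul_pos hc hs),
      div_mul_cancel_right₀ h', inv_mul_cancel₀ (mul_pos hc hs).ne', one_smul]

lemma rot_zero_time (p : E × E) : rot 0 p = (p.2, p.1) := by
  rcases eq_or_ne p 0 with rfl | hp
  · simp [rot, sumNorm, Prod.ext_iff]
  · have hm : mix 0 p = (p.2, p.1) := by simp [mix]
    have : sumNorm (p.2, p.1) = sumNorm p := add_comm _ _
    rw [rot, hm, this, div_self (mt sumNorm_eq_zero.1 hp), one_smul]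

lemma rot_one_time (p : E × E) : rot 1 p = (-p.1, p.2) := by
  rcases eq_or_ne p 0 with rfl | hp
  · simp [rot, sumNorm, Prod.ext_iff]
  · have hm : mix 1 p = (-p.1, p.2) := by simp [mix]
    have : sumNorm (-p.1, p.2) = sumNorm p := by simp [sumNorm]
    rw [rot, hm, this, div_self (mt sumNorm_eq_zero.1 hp), one_smul]

lemma rot_zero (t : ℝ) : rot t (0 : E × E) = 0 := by simp [rot, sumNorm]

lemma continuous_rot : Continuous fun q : ℝ × (E × E) => rot q.1 q.2 := by
  refine continuous_iff_continuousAt.2 fun ⟨t, p⟩ => ?_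
  rcases eq_or_ne p 0 with rfl | hp
  · have h0 : Tendsto (fun q : ℝ × (E × E) => sumNorm q.2) (nhds (t, 0)) (nhds 0) := by
      have := (continuous_sumNorm.comp (continuous_snd (X := ℝ) (Y := E × E))).tendsto (t, 0)
      rwa [Function.comp_apply, sumNorm_eq_zero.2 rfl] at this
    rw [ContinuousAt, rot_zero]
    refine squeeze_zero_norm (fun q => ?_) h0
    rw [← sumNorm_rot q.1 q.2, Prod.norm_def]
    exact max_le (le_add_of_nonneg_right (norm_nonneg _)) (le_add_of_nonneg_left (norm_nonneg _))
  · refine ContinuousAt.smul (f := fun q : ℝ × (E × E) => sumNorm q.2 / sumNorm (mix q.1 q.2))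
      (ContinuousAt.div ?_ ?_ ?_) continuous_mix.continuousAt
    · exact (continuous_sumNorm.comp continuous_snd).continuousAt
    · exact (continuous_sumNorm.comp continuous_mix).continuousAt
    · exact mt sumNorm_eq_zero.1 (mix_ne_zero t hp)

end Rotation

namespace L1

section Update

variable {ι E : Type*} [NormedAddCommGroup E]

/-- Replace one coordinate. -/
noncomputable def upd (z : L1 ι E) (n : ι) (v : E) : L1 ι E := by
  classical
  exact mk (Function.update z n v) ((z.finite_support.insert n).subset fun i hi => by
    rw [mem_ofPred_eq] at hi
    by_cases h : i = n
    · exact Or.inl h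
    · exact Or.inr (by rwa [Function.update_of_ne h] at hi))

@[simp] lemma upd_same (z : L1 ι E) (n : ι) (v : E) : upd z n v n = v := by simp [upd]

lemma upd_of_ne (z : L1 ι E) {n i : ι} (h : i ≠ n) (v : E) : upd z n v i = z i := by
  simp [upd, h]

lemma norm_restr_singleton (z : L1 ι E) (n : ι) : ‖restr {n} z‖ = ‖z n‖ := by
  have := norm_restr_finset {n} z
  simpa using this

lemma norm_upd (z : L1 ι E) (n : ι) (v : E) : ‖upd z n v‖ = ‖z‖ - ‖z n‖ + ‖v‖ := by
  rw [← norm_restr_add {n} (upd z n v), ← norm_restr_add {n} z, norm_restr_singleton,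
    norm_restr_singleton, upd_same]
  have : restr {n}ᶜ (upd z n v) = restr {n}ᶜ z := by
    ext i
    by_cases hi : i = n
    · have : i ∉ ({n} : Set ι)ᶜ := by simp [hi]
      rw [restr_apply_notMem _ this, restr_apply_notMem _ this]
    · have : i ∈ ({n} : Set ι)ᶜ := by simp [hi]
      rw [restr_apply_mem _ this, restr_apply_mem _ this, upd_of_ne _ hi]
  rw [this]
  ring

lemma upd_sub_upd (z z' : L1 ι E) (n : ι) (v v' : E) :
    upd z n v - upd z' n v' = upd (z - z') n (v - v') := by
  ext i
  by_cases hi : i = n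
  · simp [hi]
  · simp [upd_of_ne _ hi]

lemma continuous_upd (n : ι) : Continuous fun p : L1 ι E × E => upd p.1 n p.2 := by
  refine continuous_iff_continuousAt.2 fun ⟨z, v⟩ => ?_
  rw [ContinuousAt, tendsto_iff_norm_sub_tendsto_zero]
  simp only [upd_sub_upd, norm_upd]
  have : Continuous fun p : L1 ι E × E => ‖p.1 - z‖ - ‖(p.1 - z) n‖ + ‖p.2 - v‖ := by
    have := (continuous_apply (E := E) n).comp ((continuous_fst (X := L1 ι E) (Y := E)).sub
      (continuous_const (y := z)))
    exact ((continuous_fst.sub continuous_const).norm.sub this.norm).add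
      (continuous_snd.sub continuous_const).norm
  have := this.tendsto (z, v)
  simpa using this

lemma continuous_restr (J : Set ι) : Continuous (restr J : L1 ι E → L1 ι E) := by
  refine (LipschitzWith.of_dist_le_mul (K := 1) fun f g => ?_).continuous
  have h : restr J f - restr J g = restr J (f - g) := by
    ext i
    by_cases hi : i ∈ J
    · simp [restr_apply_mem _ hi]
    · simp [restr_apply_notMem _ hi]
  rw [dist_eq_norm, dist_eq_norm, h, NNReal.coe_one, one_mul, ← norm_restr_add J (f - g)]
  exact le_add_of_nonneg_right (norm_nonneg _)

end Update

section Head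

variable {E : Type*} [NormedAddCommGroup E]

/-- The first `n` coordinates. -/
noncomputable def head (n : ℕ) (z : L1 ℕ E) : L1 ℕ E := restr (Iio n) z

lemma head_apply_lt (z : L1 ℕ E) {n i : ℕ} (h : i < n) : head n z i = z i :=
  restr_apply_mem z h

lemma head_apply_ge (z : L1 ℕ E) {n i : ℕ} (h : n ≤ i) : head n z i = 0 :=
  restr_apply_notMem z (not_lt.2 h)

lemma continuous_head (n : ℕ) : Continuous (head n : L1 ℕ E → L1 ℕ E) := continuous_restr _

lemma head_upd (z : L1 ℕ E) {n m : ℕ} (h : n ≤ m) (v : E) : head n (upd z m v) = head n z := by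
  ext i
  by_cases hi : i < n
  · rw [head_apply_lt _ hi, head_apply_lt _ hi, upd_of_ne _ (hi.trans_le h).ne]
  · rw [head_apply_ge _ (not_lt.1 hi), head_apply_ge _ (not_lt.1 hi)]

lemma head_eq_self {z : L1 ℕ E} {n : ℕ} (h : ∀ i ≥ n, z i = 0) : head n z = z := by
  ext i
  by_cases hi : i < n
  · rw [head_apply_lt _ hi]
  · rw [head_apply_ge _ (not_lt.1 hi), h i (not_lt.1 hi)]

lemma norm_head_succ (n : ℕ) (z : L1 ℕ E) : ‖head (n + 1) z‖ = ‖head n z‖ + ‖z n‖ := by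
  have h : ∀ n, ‖head n z‖ = ∑ i ∈ Finset.range n, ‖z i‖ := fun n => by
    rw [head, ← Finset.coe_range, norm_restr_finset]
  rw [h, h, Finset.sum_range_succ]

lemma head_succ (n : ℕ) (z : L1 ℕ E) : head (n + 1) z = upd (head n z) n (z n) := by
  ext i
  rcases lt_trichotomy i n with h | rfl | h
  · rw [head_apply_lt _ (h.trans n.lt_succ_self), upd_of_ne _ h.ne, head_apply_lt _ h]
  · rw [head_apply_lt _ i.lt_succ_self, upd_same]
  · rw [head_apply_ge _ h, upd_of_ne _ h.ne', head_apply_ge _ h.le]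

lemma dist_head_succ (n : ℕ) (z : L1 ℕ E) : dist (head (n + 1) z) (head n z) = ‖z n‖ := by
  have : upd (head n z) n 0 = head n z := by
    ext i
    by_cases hi : i = n
    · rw [hi, upd_same, head_apply_ge _ le_rfl]
    · rw [upd_of_ne _ hi]
  rw [head_succ, dist_eq_norm]
  nth_rewrite 2 [← this]
  rw [upd_sub_upd, norm_upd]
  simp

lemma norm_sub_head (n : ℕ) (z : L1 ℕ E) : ‖z - head n z‖ = ‖z‖ - ‖head n z‖ := by
  have h := norm_restr_add (Iio n) z
  have h' := restr_add_restr_compl (Iio n) z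
  rw [head, ← h, ← sub_eq_of_eq_add' h'.symm]
  ring

lemma exists_forall_ge_eq_zero (z : L1 ℕ E) : ∃ N, ∀ n ≥ N, z n = 0 := by
  obtain ⟨N, hN⟩ := z.finite_support.bddAbove
  refine ⟨N + 1, fun n hn => by_contra fun h => ?_⟩
  have := hN h
  lia

end Head

end L1

/-- The part of the product of `Y` with a normed space lying in the open band of width `a`
around the zero section, together with the zero section. -/
def openBand {Y : Type*} (E : Type*) [NormedAddCommGroup E] (a : Y → ℝ) : Set (Y × E) :=
  {p | p.2 = 0 ∨ ‖p.2‖ < a p.1}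

namespace Absorb

open L1

variable {E : Type*} [NormedAddCommGroup E]

/-- The norm of all coordinates except the first `n` coordinates of the first component. -/
noncomputable def mass (n : ℕ) (w : L1 ℕ E × E) : ℝ := ‖w.1‖ + ‖w.2‖ - ‖head n w.1‖

/-- The function governing the time at which the `n`-th rotation is stopped. -/
noncomputable def lvl (k : L1 ℕ E → ℝ) (n : ℕ) (w : L1 ℕ E × E) : ℝ := k (head n w.1) - mass n w

/-- The time at which the `n`-th rotation is stopped. -/
noncomputable def time (k : L1 ℕ E → ℝ) (n : ℕ) (w : L1 ℕ E × E) : ℝ :=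
  max 0 (min 1 ((n + 1) * lvl k n w))

lemma norm_head_le (n : ℕ) (z : L1 ℕ E) : ‖head n z‖ ≤ ‖z‖ := by
  linarith [norm_sub_head n z, norm_nonneg (z - head n z)]

lemma norm_snd_le_mass (n : ℕ) (w : L1 ℕ E × E) : ‖w.2‖ ≤ mass n w := by
  unfold mass
  linarith [norm_head_le n w.1]

lemma norm_sub_head_le_mass (n : ℕ) (w : L1 ℕ E × E) : ‖w.1 - head n w.1‖ ≤ mass n w := by
  unfold mass
  linarith [norm_sub_head n w.1, norm_nonneg w.2]

lemma time_of_lvl_nonpos {k : L1 ℕ E → ℝ} {n : ℕ} {w : L1 ℕ E × E} (h : lvl k n w ≤ 0) :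
    time k n w = 0 :=
  max_eq_left ((min_le_right _ _).trans (mul_nonpos_of_nonneg_of_nonpos (by positivity) h))

lemma time_of_one_le {k : L1 ℕ E → ℝ} {n : ℕ} {w : L1 ℕ E × E} (h : 1 ≤ (n + 1) * lvl k n w) :
    time k n w = 1 := by
  rw [time, min_eq_left h, max_eq_right zero_le_one]

lemma continuous_mass (n : ℕ) : Continuous (mass n : L1 ℕ E × E → ℝ) :=
  (continuous_fst.norm.add continuous_snd.norm).sub ((continuous_head n).comp continuous_fst).norm

lemma continuous_lvl {k : L1 ℕ E → ℝ} (hk : Continuous k) (n : ℕ) : Continuous (lvl k n) :=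
  (hk.comp ((continuous_head n).comp continuous_fst)).sub (continuous_mass n)

lemma continuous_time {k : L1 ℕ E → ℝ} (hk : Continuous k) (n : ℕ) : Continuous (time k n) :=
  continuous_const.max (continuous_const.min (continuous_const.mul (continuous_lvl hk n)))

lemma lvl_mono {k : L1 ℕ E → ℝ} (hk : ∀ a b, k a ≤ k b + dist a b) (w : L1 ℕ E × E) :
    Monotone fun n => lvl k n w := by
  refine monotone_nat_of_le_succ fun n => ?_
  have h := hk (head n w.1) (head (n + 1) w.1)
  rw [dist_comm, dist_head_succ] at h
  simp only [lvl, mass, norm_head_succ]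
  linarith

variable [NormedSpace ℝ E]

/-- The `n`-th partial rotation. -/
noncomputable def step (k : L1 ℕ E → ℝ) (n : ℕ) (w : L1 ℕ E × E) : L1 ℕ E × E :=
  (upd w.1 n (rot (time k n w) (w.1 n, w.2)).1, (rot (time k n w) (w.1 n, w.2)).2)

variable {k : L1 ℕ E → ℝ}

lemma head_step {n m : ℕ} (h : n ≤ m) (w : L1 ℕ E × E) :
    head n (step k m w).1 = head n w.1 := head_upd _ h _

lemma mass_step {n m : ℕ} (h : n ≤ m) (w : L1 ℕ E × E) : mass n (step k m w) = mass n w := by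
  have h1 := sumNorm_rot (time k m w) (w.1 m, w.2)
  have h2 := norm_upd w.1 m (rot (time k m w) (w.1 m, w.2)).1
  simp only [sumNorm] at h1
  rw [mass, mass, head_step h]
  simp only [step]
  linarith

lemma lvl_step {n m : ℕ} (h : n ≤ m) (k' : L1 ℕ E → ℝ) (w : L1 ℕ E × E) :
    lvl k' n (step k m w) = lvl k' n w := by
  rw [lvl, lvl, mass_step h, head_step h]

lemma time_step {n m : ℕ} (h : n ≤ m) (k' : L1 ℕ E → ℝ) (w : L1 ℕ E × E) :
    time k' n (step k m w) = time k' n w := by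
  rw [time, time, lvl_step h]

lemma step_step (n : ℕ) (w : L1 ℕ E × E) : step k n (step k n w) = w := by
  have h : ((step k n w).1 n, (step k n w).2) = rot (time k n w) (w.1 n, w.2) := by
    simp [step]
  rw [step, time_step le_rfl, h, rot_rot]
  refine Prod.ext (L1.ext fun i => ?_) rfl
  by_cases hi : i = n
  · simp [hi]
  · simp [step, upd_of_ne _ hi]

lemma continuous_step (hk : Continuous k) (n : ℕ) : Continuous (step k n) := by
  have h : Continuous fun w : L1 ℕ E × E => rot (time k n w) (w.1 n, w.2) :=
    continuous_rot.comp ((continuous_time hk n).prodMk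
      (((L1.continuous_apply n).comp continuous_fst).prodMk continuous_snd))
  exact ((continuous_upd n).comp (continuous_fst.prodMk h.fst)).prodMk h.snd

lemma step_of_time_one {n : ℕ} {w : L1 ℕ E × E} (h : time k n w = 1) :
    step k n w = (upd w.1 n (-w.1 n), w.2) := by
  rw [step, h, rot_one_time]

omit [NormedSpace ℝ E] in
lemma upd_self (z : L1 ℕ E) (n : ℕ) : upd z n (z n) = z := by
  ext i
  by_cases hi : i = n
  · simp [hi]
  · simp [upd_of_ne _ hi]

lemma step_eq_self_of_time_one {n : ℕ} {w : L1 ℕ E × E} (h : time k n w = 1) (h0 : w.1 n = 0) :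
    step k n w = w := by
  rw [step_of_time_one h, h0, neg_zero, ← h0, upd_self]

lemma step_eq_self_of_snd_eq_zero {n : ℕ} {w : L1 ℕ E × E} (h : w.2 = 0) (h0 : w.1 n = 0) :
    step k n w = w := by
  have : ((w.1 n, w.2) : E × E) = 0 := Prod.ext h0 h
  rw [step, this, rot_zero]
  refine Prod.ext ?_ h.symm
  change upd w.1 n 0 = w.1
  rw [← h0, upd_self]

lemma step_apply_of_ne {n i : ℕ} (h : i ≠ n) (w : L1 ℕ E × E) : (step k n w).1 i = w.1 i :=
  upd_of_ne _ h _

lemma compUp_apply (w : L1 ℕ E × E) : ∀ n, ∀ i ≥ n, (compUp (step k) n w).1 i = w.1 i := by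
  intro n
  induction n with
  | zero => exact fun _ _ => rfl
  | succ n ih =>
    intro i hi
    rw [compUp, Function.comp_apply, step_apply_of_ne (by lia), ih i (by lia)]

lemma lvl_compUp_mono (hk : ∀ a b, k a ≤ k b + dist a b) (w : L1 ℕ E × E) :
    Monotone fun n => lvl k n (compUp (step k) n w) := by
  refine monotone_nat_of_le_succ fun n => ?_
  refine le_trans (le_of_eq ?_) (lvl_mono hk _ n.le_succ)
  exact (lvl_step le_rfl k _).symm

lemma compUp_eq_of_fixed {Z : Type*} {Ψ : ℕ → Z → Z} {w : Z} {N : ℕ}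
    (h : ∀ n ≥ N, compUp Ψ n w = compUp Ψ N w → Ψ n (compUp Ψ N w) = compUp Ψ N w) :
    ∀ n ≥ N, compUp Ψ n w = compUp Ψ N w := by
  intro n hn
  induction n, hn using Nat.le_induction with
  | base => rfl
  | succ n hn ih => rw [compUp, Function.comp_apply, ih, h n hn ih]

lemma exists_nat_mul_ge {u : ℝ} (hu : 0 < u) (N : ℕ) : ∃ K ≥ N, ∀ n ≥ K, 1 ≤ ((n : ℝ) + 1) * u := by
  obtain ⟨K, hK⟩ := exists_nat_ge (1 / u)
  refine ⟨max N K, le_max_left _ _, fun n hn => ?_⟩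
  have : (K : ℝ) ≤ n := by exact_mod_cast (le_max_right N K).trans hn
  rw [div_le_iff₀ hu] at hK
  nlinarith

theorem exists_homeoOn (hk : ∀ a b, k a ≤ k b + dist a b)
    (hkc : Continuous k) :
    ∃ Φ Θ : L1 ℕ E × E → L1 ℕ E × E, HomeoOn univ (openBand E k) Φ Θ ∧
      ∀ y ∈ openBand E k, ∀ᶠ n in atTop, compDown (step k) n y = Θ y := by
  refine exists_homeoOn_of_involutions (fun n => continuous_step hkc n) (fun n w => step_step n w)
    ?_ ?_
  · rintro ⟨x, e⟩ hy
    obtain ⟨N₀, hN₀⟩ := exists_forall_ge_eq_zero x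
    by_cases he : e = 0
    · refine ⟨N₀, fun n hn => step_eq_self_of_snd_eq_zero he (hN₀ n hn), fun U hU => ?_⟩
      obtain ⟨δ, hδ, hU⟩ := Metric.mem_nhds_iff.1 hU
      refine ⟨{w | ‖head N₀ w.1 - x‖ + mass N₀ w < δ}, ?_, fun w hw => hU ?_, fun n hn w hw => ?_⟩
      · refine (isOpen_lt ((((continuous_head N₀).comp continuous_fst).sub
          continuous_const).norm.add (continuous_mass N₀)) continuous_const).mem_nhds ?_
        simp [mass, head_eq_self hN₀, he, hδ]
      · rw [mem_ofPred_eq] at hw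
        rw [mem_ball, Prod.dist_eq, max_lt_iff, dist_eq_norm, dist_eq_norm]
        have h1 := norm_sub_head_le_mass N₀ w
        have h2 := norm_snd_le_mass N₀ w
        have h3 := norm_sub_le_norm_sub_add_norm_sub w.1 (head N₀ w.1) x
        have h4 := norm_nonneg (head N₀ w.1 - x)
        refine ⟨by linarith, ?_⟩
        change ‖w.2 - e‖ < δ
        rw [he, sub_zero]
        linarith
      · rw [mem_ofPred_eq] at hw ⊢
        rwa [head_step hn, mass_step hn]
    · have hu : 0 < k x - ‖e‖ := sub_pos.2 (hy.resolve_left he)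
      obtain ⟨N, hN, hNu⟩ := exists_nat_mul_ge (half_pos hu) N₀
      have hx : ∀ n ≥ N, head n x = x := fun n hn =>
        head_eq_self fun i hi => hN₀ i (hN.trans (hn.le.trans hi))
      have hlvl : ∀ n ≥ N, lvl k n (x, e) = k x - ‖e‖ := fun n hn => by
        simp [lvl, mass, hx n hn]
      refine ⟨N, fun n hn => step_eq_self_of_time_one (time_of_one_le ?_) (hN₀ n (hN.trans hn)),
        fun U hU => ?_⟩
      · rw [hlvl n hn]
        refine (hNu n hn).trans (mul_le_mul_of_nonneg_left (half_le_self hu.le) (by positivity))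
      · obtain ⟨δ, hδ, hU⟩ := Metric.mem_nhds_iff.1 hU
        refine ⟨{w | ‖head N w.1 - x‖ + (‖w.1‖ - ‖head N w.1‖) + ‖w.2 - e‖ < δ} ∩
          {w | (k x - ‖e‖) / 2 < lvl k N w}, ?_, fun w hw => hU ?_, fun n hn w hw => ?_⟩
        · have hc := (continuous_head (E := E) N).comp (continuous_fst (X := L1 ℕ E) (Y := E))
          refine inter_mem ((isOpen_lt (((hc.sub continuous_const).norm.add
            (continuous_fst.norm.sub hc.norm)).add (continuous_snd.sub continuous_const).norm)
            continuous_const).mem_nhds ?_)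
            ((isOpen_lt continuous_const (continuous_lvl hkc N)).mem_nhds ?_)
          · simp [hx N le_rfl, hδ]
          · rw [mem_ofPred_eq, hlvl N le_rfl]
            exact half_lt_self hu
        · have hw := hw.1
          rw [mem_ofPred_eq] at hw
          rw [mem_ball, Prod.dist_eq, max_lt_iff, dist_eq_norm, dist_eq_norm]
          have h1 := norm_sub_head N w.1
          have h3 := norm_sub_le_norm_sub_add_norm_sub w.1 (head N w.1) x
          have h4 := norm_nonneg (head N w.1 - x)
          have h5 := norm_nonneg (w.1 - head N w.1)
          have h6 := norm_nonneg (w.2 - e)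
          constructor
          · change ‖w.1 - x‖ < δ
            linarith
          · change ‖w.2 - e‖ < δ
            linarith
        · obtain ⟨hw1, hw2⟩ := hw
          rw [mem_ofPred_eq] at hw1 hw2
          refine ⟨?_, by rwa [mem_ofPred_eq, lvl_step hn]⟩
          have ht : time k n w = 1 := time_of_one_le ((hNu n hn).trans
            (mul_le_mul_of_nonneg_left (hw2.le.trans (lvl_mono hk w hn)) (by positivity)))
          rw [mem_ofPred_eq, head_step hn, step_of_time_one ht]
          simpa [norm_upd] using hw1
  · intro w
    obtain ⟨N, hN⟩ := exists_forall_ge_eq_zero w.1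
    rcases le_or_gt (lvl k N (compUp (step k) N w)) 0 with hu | hu
    · have h1 : (compUp (step k) (N + 1) w).2 = 0 := by
        rw [compUp, Function.comp_apply, step, time_of_lvl_nonpos hu, rot_zero_time]
        change (compUp (step k) N w).1 N = 0
        rw [compUp_apply w N N le_rfl, hN N le_rfl]
      refine ⟨N + 1, compUp (step k) (N + 1) w, Or.inl h1, compUp_eq_of_fixed fun n hn _ =>
        step_eq_self_of_snd_eq_zero h1 ?_⟩
      rw [compUp_apply w _ n hn, hN n (by lia)]
    · obtain ⟨K, hK, hKu⟩ := exists_nat_mul_ge hu N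
      refine ⟨K, compUp (step k) K w, Or.inr ?_, compUp_eq_of_fixed fun n hn he =>
        step_eq_self_of_time_one (time_of_one_le ?_) ?_⟩
      · have h1 := hu.trans_le (lvl_compUp_mono hk w hK)
        have h2 : head K (compUp (step k) K w).1 = (compUp (step k) K w).1 :=
          head_eq_self fun i hi => by rw [compUp_apply w _ i hi, hN i (hK.le.trans hi)]
        simp only [lvl, mass, h2] at h1
        linarith
      · rw [← he]
        exact (hKu n hn).trans (mul_le_mul_of_nonneg_left
          (lvl_compUp_mono hk w (hK.le.trans hn)) (by positivity))
      · rw [compUp_apply w _ n hn, hN n (hK.le.trans hn)]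

lemma compDown_congr {k' : L1 ℕ E → ℝ} : ∀ n, ∀ y : L1 ℕ E × E,
    (∀ i < n, time k i y = time k' i y) → compDown (step k) n y = compDown (step k') n y := by
  intro n
  induction n with
  | zero => exact fun _ _ => rfl
  | succ n ih =>
    intro y hy
    have h : step k' n y = step k n y := by rw [step, step, hy n n.lt_succ_self]
    rw [compDown, compDown, Function.comp_apply, Function.comp_apply, h]
    refine ih _ fun i hi => ?_
    rw [time_step hi.le, time_step hi.le, hy i (hi.trans n.lt_succ_self)]

/-- Widening the band by a Lipschitz function is a homeomorphism fixing the points over which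
that function vanishes. -/
theorem exists_homeoOn_max (hk : ∀ a b, k a ≤ k b + dist a b)
    (hkc : Continuous k) {τ : L1 ℕ E → ℝ} (hτ : ∀ a b, τ a ≤ τ b + dist a b)
    (hτc : Continuous τ) :
    ∃ F G : L1 ℕ E × E → L1 ℕ E × E, HomeoOn (openBand E k) (openBand E fun x => max (k x) (τ x)) F G ∧
      ∀ p ∈ openBand E k, τ p.1 = 0 → F p = p := by
  have hk' : ∀ a b, max (k a) (τ a) ≤ max (k b) (τ b) + dist a b := fun a b =>
    max_le ((hk a b).trans (add_le_add_left (le_max_left _ _) _))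
      ((hτ a b).trans (add_le_add_left (le_max_right _ _) _))
  obtain ⟨Φ, Θ, h, hΘ⟩ := exists_homeoOn hk hkc
  obtain ⟨Φ', Θ', h', hΘ'⟩ := exists_homeoOn hk' (hkc.max hτc)
  refine ⟨_, _, h.symm.trans h', fun p hp h0 => ?_⟩
  have hp' : p ∈ openBand E fun x => max (k x) (τ x) := hp.imp id fun h => h.trans_le (le_max_left _ _)
  have ht : ∀ i, time k i p = time (fun x => max (k x) (τ x)) i p := by
    intro i
    rcases le_total (τ (head i p.1)) (k (head i p.1)) with hle | hle
    · simp [time, lvl, max_eq_left hle]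
    · have h1 := hτ (head i p.1) p.1
      rw [h0, zero_add, dist_comm, dist_eq_norm] at h1
      have h2 := h1.trans (norm_sub_head_le_mass i p)
      rw [time_of_lvl_nonpos, time_of_lvl_nonpos]
      · simp only [lvl, max_eq_right hle]
        linarith
      · simp only [lvl]
        linarith
  obtain ⟨n, hn, hn'⟩ := ((hΘ p hp).and (hΘ' p hp')).exists
  rw [Function.comp_apply, ← hn, compDown_congr n p fun i _ => ht i, hn', h'.right p hp']

end Absorb

section Extend

variable {Z : Type*} [TopologicalSpace Z] {A B W : Set Z} {F G : Z → Z} {m : Z → Prop}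

namespace HomeoOn

lemma fixed_symm (h : HomeoOn A B F G) (hAB : ∀ z, ¬ m z → (z ∈ A ↔ z ∈ B))
    (hfix : ∀ p ∈ A, ¬ m p → F p = p) : ∀ q ∈ B, ¬ m q → G q = q := fun q hq hm => by
  have hA := (hAB q hm).2 hq
  have := h.left q hA
  rwa [hfix q hA hm] at this

lemma moving_of_moving (h : HomeoOn A B F G) (hAB : ∀ z, ¬ m z → (z ∈ A ↔ z ∈ B))
    (hfix : ∀ p ∈ A, ¬ m p → F p = p) {p : Z} (hp : p ∈ A) (hm : m p) : m (F p) := by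
  by_contra hm'
  have h1 := h.fixed_symm hAB hfix _ (h.mapsF hp) hm'
  rw [h.left p hp] at h1
  exact hm' (h1 ▸ hm)

end HomeoOn

lemma continuousOn_extend [DecidablePred m] (hc : ContinuousOn F (A ∩ W)) (hW : IsOpen W)
    (hcl : closure {z | m z} ⊆ W) (hfix : ∀ z ∈ A ∩ W, ¬ m z → F z = z) :
    ContinuousOn (fun z => if m z then F z else z) A := by
  intro z hz
  by_cases hzW : z ∈ W
  · have h1 : ContinuousWithinAt F A z :=
      (continuousWithinAt_inter (hW.mem_nhds hzW)).1 (hc z ⟨hz, hzW⟩)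
    have h2 : (fun z => if m z then F z else z) =ᶠ[nhdsWithin z A] F := by
      filter_upwards [self_mem_nhdsWithin, mem_nhdsWithin_of_mem_nhds (hW.mem_nhds hzW)]
        with y hy hyW
      split_ifs with hm
      · rfl
      · exact (hfix y ⟨hy, hyW⟩ hm).symm
    exact h1.congr_of_eventuallyEq h2 (h2.self_of_nhdsWithin hz)
  · have h1 : z ∉ closure {z | m z} := fun h => hzW (hcl h)
    have h2 : (fun z => if m z then F z else z) =ᶠ[nhdsWithin z A] id := by
      filter_upwards [mem_nhdsWithin_of_mem_nhds (isClosed_closure.isOpen_compl.mem_nhds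
        (mem_compl h1))] with y hy
      have : ¬ m y := fun h => hy (subset_closure h)
      simp [this]
    exact continuousWithinAt_id.congr_of_eventuallyEq h2 (h2.self_of_nhdsWithin hz)

theorem HomeoOn.exists_extend (h : HomeoOn (A ∩ W) (B ∩ W) F G) (hW : IsOpen W)
    (hcl : closure {z | m z} ⊆ W) (hAB : ∀ z, ¬ m z → (z ∈ A ↔ z ∈ B))
    (hfix : ∀ z ∈ A ∩ W, ¬ m z → F z = z) :
    ∃ F' G' : Z → Z, HomeoOn A B F' G' ∧ ∀ z ∈ A, ¬ m z → F' z = z := by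
  classical
  have hAB' : ∀ z, ¬ m z → (z ∈ A ∩ W ↔ z ∈ B ∩ W) := fun z hz => and_congr_left' (hAB z hz)
  have hfix' := h.fixed_symm hAB' hfix
  have hmW : ∀ {z}, m z → z ∈ W := fun hz => hcl (subset_closure hz)
  have hmF := fun z hz => h.moving_of_moving hAB' hfix (p := z) hz
  have hmG := fun z hz => h.symm.moving_of_moving (fun z hz => (hAB' z hz).symm) hfix' (p := z) hz
  refine ⟨fun z => if m z then F z else z, fun z => if m z then G z else z,
    ⟨continuousOn_extend h.contF hW hcl hfix, continuousOn_extend h.contG hW hcl hfix',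
      fun z hz => ?_, fun z hz => ?_, fun z hz => ?_, fun z hz => ?_⟩,
      fun z _ hm => if_neg hm⟩
  · by_cases hm : m z
    · simpa only [if_pos hm] using (h.mapsF ⟨hz, hmW hm⟩).1
    · simpa only [if_neg hm] using (hAB z hm).1 hz
  · by_cases hm : m z
    · simpa only [if_pos hm] using (h.mapsG ⟨hz, hmW hm⟩).1
    · simpa only [if_neg hm] using (hAB z hm).2 hz
  · by_cases hm : m z
    · simp only [if_pos hm, if_pos (hmF z ⟨hz, hmW hm⟩ hm)]
      exact h.left z ⟨hz, hmW hm⟩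
    · simp only [if_neg hm]
  · by_cases hm : m z
    · simp only [if_pos hm, if_pos (hmG z ⟨hz, hmW hm⟩ hm)]
      exact h.right z ⟨hz, hmW hm⟩
    · simp only [if_neg hm]

end Extend

section Rescale

variable {Y Y' E : Type*} [TopologicalSpace Y] [TopologicalSpace Y'] [NormedAddCommGroup E]
  [NormedSpace ℝ E]

lemma continuousOn_rescale {a c : Y → ℝ} {W : Set Y} (ha : ContinuousOn a W)
    (hc : ContinuousOn c W) (hac : ∀ y ∈ W, 0 ≤ a y ∧ 0 ≤ c y ∧ (0 < a y ↔ 0 < c y)) :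
    ContinuousOn (fun p : Y × E => (c p.1 / a p.1) • p.2) (openBand E a ∩ Prod.fst ⁻¹' W) := by
  rintro ⟨y, e⟩ ⟨hye, hy⟩
  have hm : MapsTo Prod.fst (openBand E a ∩ Prod.fst ⁻¹' W) W := fun p hp => hp.2
  have hc1 : ContinuousWithinAt (fun p : Y × E => c p.1) (openBand E a ∩ Prod.fst ⁻¹' W) (y, e) :=
    (hc.comp continuousOn_fst hm) (y, e) ⟨hye, hy⟩
  have ha1 : ContinuousWithinAt (fun p : Y × E => a p.1) (openBand E a ∩ Prod.fst ⁻¹' W) (y, e) :=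
    (ha.comp continuousOn_fst hm) (y, e) ⟨hye, hy⟩
  rcases (hac y hy).1.eq_or_lt with h0 | h0
  · have hc0 : c y = 0 := le_antisymm
      (not_lt.1 fun h => (((hac y hy).2.2.2 h).ne h0)) (hac y hy).2.1
    have he : e = 0 := hye.resolve_right fun h => (norm_nonneg e).not_gt (h.trans_eq h0.symm)
    rw [ContinuousWithinAt, hc0] at hc1
    rw [ContinuousWithinAt]
    change Tendsto _ _ (nhds ((c y / a y) • e))
    rw [he, smul_zero]
    refine squeeze_zero_norm' ?_ (he ▸ hc1)
    filter_upwards [self_mem_nhdsWithin] with p hp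
    obtain ⟨h1, h2, -⟩ := hac p.1 hp.2
    rw [norm_smul, Real.norm_of_nonneg (div_nonneg h2 h1), div_mul_eq_mul_div]
    refine div_le_of_le_mul₀ h1 h2 (mul_le_mul_of_nonneg_left ?_ h2)
    rcases hp.1 with h | h
    · rw [h, norm_zero]; exact h1
    · exact h.le
  · exact (hc1.div ha1 h0.ne').smul continuousWithinAt_snd

lemma rescale_mem {a c : ℝ} (hac : 0 < a → 0 < c) {e : E} (he : e = 0 ∨ ‖e‖ < a) :
    (c / a) • e = 0 ∨ ‖(c / a) • e‖ < c := by
  rcases he with rfl | he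
  · exact Or.inl (smul_zero _)
  · have ha := (norm_nonneg e).trans_lt he
    refine Or.inr ?_
    rw [norm_smul, Real.norm_of_nonneg (div_nonneg (hac ha).le ha.le), div_mul_eq_mul_div,
      div_lt_iff₀ ha]
    exact mul_lt_mul_of_pos_left he (hac ha)

lemma rescale_rescale {a c : ℝ} (hac : 0 < a → 0 < c) {e : E} (he : e = 0 ∨ ‖e‖ < a) :
    (a / c) • (c / a) • e = e := by
  rcases he with rfl | he
  · simp
  · have ha := (norm_nonneg e).trans_lt he
    rw [smul_smul, div_mul_div_cancel₀ (hac ha).ne', div_self ha.ne', one_smul]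

theorem homeoOn_rescale (h : OpenPartialHomeomorph Y Y') {a : Y → ℝ} {b : Y' → ℝ}
    (ha : Continuous a) (hb : Continuous b) (ha0 : ∀ y, 0 ≤ a y) (hb0 : ∀ y, 0 ≤ b y)
    (hab : ∀ y ∈ h.source, 0 < a y ↔ 0 < b (h y)) :
    HomeoOn (openBand E a ∩ Prod.fst ⁻¹' h.source) (openBand E b ∩ Prod.fst ⁻¹' h.target)
      (fun p => (h p.1, (b (h p.1) / a p.1) • p.2))
      (fun q => (h.symm q.1, (a (h.symm q.1) / b q.1) • q.2)) where
  contF := (h.continuousOn.comp continuousOn_fst fun p hp => hp.2).prodMk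
    (continuousOn_rescale ha.continuousOn (hb.comp_continuousOn h.continuousOn)
      fun y hy => ⟨ha0 y, hb0 _, hab y hy⟩)
  contG := (h.symm.continuousOn.comp continuousOn_fst fun p hp => hp.2).prodMk
    (continuousOn_rescale hb.continuousOn (ha.comp_continuousOn h.symm.continuousOn)
      fun y hy => ⟨hb0 y, ha0 _, by
        have := hab _ (h.map_target hy)
        rw [h.right_inv hy] at this
        exact this.symm⟩)
  mapsF p hp := ⟨rescale_mem (hab _ hp.2).1 hp.1, h.map_source hp.2⟩
  mapsG q hq := by
    have := hab _ (h.map_target hq.2)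
    rw [h.right_inv hq.2] at this
    exact ⟨rescale_mem this.2 hq.1, h.map_target hq.2⟩
  left p hp := by
    refine Prod.ext (h.left_inv hp.2) ?_
    simp only [h.left_inv hp.2]
    exact rescale_rescale (hab _ hp.2).1 hp.1
  right q hq := by
    have := hab _ (h.map_target hq.2)
    rw [h.right_inv hq.2] at this
    refine Prod.ext (h.right_inv hq.2) ?_
    simp only [h.right_inv hq.2]
    exact rescale_rescale this.2 hq.1

end Rescale

section Absorbable

variable {X : Type*} [TopologicalSpace X] (E : Type*) [NormedAddCommGroup E]

/-- Every open band can be enlarged by the function `μ` up to a homeomorphism which does not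
move the points above the zeros of `μ`. -/
def BandAbsorbs (μ : X → ℝ) : Prop :=
  ∀ l : X → ℝ, Continuous l → (∀ x, 0 ≤ l x) → ∃ F G : X × E → X × E,
    HomeoOn (openBand E l) (openBand E fun x => max (l x) (μ x)) F G ∧
      ∀ p ∈ openBand E l, μ p.1 = 0 → F p = p

/-- All continuous truncations of the nonnegative continuous function `μ` satisfy
`BandAbsorbs`. -/
structure HeredAbsorbs (μ : X → ℝ) : Prop where
  cont : Continuous μ
  nonneg : ∀ x, 0 ≤ μ x
  absorbs : ∀ χ : X → ℝ, Continuous χ → (∀ x, 0 ≤ χ x) → BandAbsorbs E fun x => min (μ x) (χ x)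

variable {E} {l μ : X → ℝ}

omit [TopologicalSpace X] in
lemma mem_openBand_max_iff (hl : ∀ x, 0 ≤ l x) {p : X × E} (hp : μ p.1 = 0) :
    p ∈ openBand E l ↔ p ∈ openBand E fun x => max (l x) (μ x) := by
  change _ ∨ _ ↔ _ ∨ _ < max (l p.1) (μ p.1)
  rw [hp, max_eq_left (hl p.1)]

theorem BandAbsorbs.of_chart [NormedSpace ℝ E] (h : OpenPartialHomeomorph X (L1 ℕ E)) (hμ : Continuous μ)
    (hcl : closure {x | μ x ≠ 0} ⊆ h.source) : BandAbsorbs E μ := by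
  intro l hl hl0
  have hopen : ∀ a : X → ℝ, Continuous a → IsOpen (h '' (h.source ∩ {x | 0 < a x})) := fun a ha =>
    h.isOpen_image_of_subset_source (h.open_source.inter (isOpen_lt continuous_const ha))
      inter_subset_left
  have hpos : ∀ a : X → ℝ, Continuous a → ∀ y ∈ h.source,
      0 < a y ↔ 0 < openGauge (h '' (h.source ∩ {x | 0 < a x})) (h y) := by
    intro a ha y hy
    rw [openGauge_pos (hopen a ha)]
    refine ⟨fun h' => mem_image_of_mem _ ⟨hy, h'⟩, ?_⟩
    rintro ⟨z, ⟨hz, hz'⟩, hzy⟩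
    rwa [← h.injOn hz hy hzy]
  set k := openGauge (h '' (h.source ∩ {x | 0 < l x})) with hk
  set τ := openGauge (h '' (h.source ∩ {x | 0 < μ x})) with hτ
  have hk0 : ∀ y, 0 ≤ k y := openGauge_nonneg _
  have hkc : Continuous k := continuous_openGauge _
  have hτc : Continuous τ := continuous_openGauge _
  have hτT : ∀ y, τ y ≠ 0 → y ∈ h.target := by
    intro y hy
    by_contra hyT
    refine hy (openGauge_eq_zero (hopen μ hμ) ?_)
    rintro ⟨z, ⟨hz, -⟩, rfl⟩
    exact hyT (h.map_source hz)
  have hR1 := homeoOn_rescale (E := E) h hl hkc hl0 hk0 (hpos l hl)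
  have hR2 := homeoOn_rescale (E := E) h (hl.max hμ) (hkc.max hτc)
    (fun x => le_max_of_le_left (hl0 x)) (fun x => le_max_of_le_left (hk0 x)) (fun y hy => by
      rw [lt_max_iff, lt_max_iff, hpos l hl y hy, hpos μ hμ y hy])
  obtain ⟨F, G, hFG, hfix⟩ := Absorb.exists_homeoOn_max (E := E) (openGauge_le_add _) hkc
    (openGauge_le_add _) hτc
  rw [← hk, ← hτ] at hFG
  rw [← hk, ← hτ] at hfix
  have hAB : ∀ z : L1 ℕ E × E, ¬ τ z.1 ≠ 0 →
      (z ∈ openBand E k ↔ z ∈ openBand E fun x => max (k x) (τ x)) := fun z hz =>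
    mem_openBand_max_iff hk0 (not_not.1 hz)
  have hfix1 : ∀ p ∈ openBand E k, ¬ τ p.1 ≠ 0 → F p = p := fun p hp hm =>
    hfix p hp (not_not.1 hm)
  have hfix2 := hFG.fixed_symm hAB hfix1
  have hF' : HomeoOn (openBand E k ∩ Prod.fst ⁻¹' h.target)
      ((openBand E fun x => max (k x) (τ x)) ∩ Prod.fst ⁻¹' h.target) F G := by
    refine hFG.restrict inter_subset_left inter_subset_left ?_ ?_
    · intro p hp
      by_cases hm : τ p.1 ≠ 0
      · exact ⟨hFG.mapsF hp.1, hτT _ (hFG.moving_of_moving hAB hfix1 hp.1 hm)⟩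
      · exact ⟨hFG.mapsF hp.1, by rw [hfix1 p hp.1 hm]; exact hp.2⟩
    · intro p hp
      by_cases hm : τ p.1 ≠ 0
      · exact ⟨hFG.mapsG hp.1,
          hτT _ (hFG.symm.moving_of_moving (fun z hz => (hAB z hz).symm) hfix2 hp.1 hm)⟩
      · exact ⟨hFG.mapsG hp.1, by rw [hfix2 p hp.1 hm]; exact hp.2⟩
  have hcomp := hR1.trans (hF'.trans hR2.symm)
  obtain ⟨F', G', h1, h2⟩ := hcomp.exists_extend (m := fun p : X × E => μ p.1 ≠ 0)
    (h.open_source.preimage continuous_fst)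
    ((continuous_fst.closure_preimage_subset _).trans (preimage_mono hcl))
    (fun z hz => mem_openBand_max_iff hl0 (not_not.1 hz)) (by
      rintro ⟨x, e⟩ ⟨hz, hx⟩ h0
      replace h0 : μ x = 0 := not_not.1 h0
      have hτ0 : τ (h x) = 0 := by
        refine le_antisymm (not_lt.1 fun h' => ?_) (openGauge_nonneg _ _)
        exact ((hpos μ hμ x hx).2 h').ne' h0
      simp only [Function.comp]
      rw [hfix _ (hR1.mapsF ⟨hz, hx⟩).1 hτ0]
      refine Prod.ext (h.left_inv hx) ?_
      simp only [h.left_inv hx, h0, hτ0, max_eq_left (hl0 x), max_eq_left (hk0 (h x))]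
      exact rescale_rescale (hpos l hl x hx).1 hz)
  exact ⟨F', G', h1, fun p hp h0 => h2 p hp (not_not.2 h0)⟩

theorem BandAbsorbs.max {μ ν : X → ℝ} (hμ : BandAbsorbs E μ) (hν : BandAbsorbs E ν)
    (hμc : Continuous μ) (hμ0 : ∀ x, 0 ≤ μ x) (hν0 : ∀ x, 0 ≤ ν x) :
    BandAbsorbs E fun x => max (μ x) (ν x) := by
  intro l hl hl0
  obtain ⟨F, G, h, hf⟩ := hμ l hl hl0
  obtain ⟨F', G', h', hf'⟩ := hν (fun x => Max.max (l x) (μ x)) (hl.max hμc)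
    (fun x => le_max_of_le_left (hl0 x))
  refine ⟨F' ∘ F, G ∘ G', ?_, fun p hp h0 => ?_⟩
  · simpa only [max_assoc] using h.trans h'
  · have h1 : μ p.1 = 0 := le_antisymm ((le_max_left _ _).trans_eq h0) (hμ0 _)
    have h2 : ν p.1 = 0 := le_antisymm ((le_max_right _ _).trans_eq h0) (hν0 _)
    rw [Function.comp, hf p hp h1, hf' p ((mem_openBand_max_iff hl0 h1).1 hp) h2]

section LocallyOne

variable {ι : Type*} {m : ι → X → ℝ}

omit [TopologicalSpace X] in
lemma finsum_eq_of_forall_ne {x : X} {i : ι} (h : ∀ j ≠ i, m j x = 0) :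
    ∑ᶠ j, m j x = m i x := finsum_eq_single _ _ h

lemma continuous_finsum_of_locally_one (hm : ∀ i, Continuous (m i))
    (hloc : ∀ x, ∃ i, ∀ᶠ y in nhds x, ∀ j ≠ i, m j y = 0) :
    Continuous fun x => ∑ᶠ j, m j x := by
  refine continuous_iff_continuousAt.2 fun x => ?_
  obtain ⟨i, hi⟩ := hloc x
  exact (hm i).continuousAt.congr (hi.mono fun y hy => (finsum_eq_of_forall_ne hy).symm)

theorem BandAbsorbs.finsum (hm : ∀ i, BandAbsorbs E (m i))
    (hloc : ∀ x, ∃ i, ∀ᶠ y in nhds x, ∀ j ≠ i, m j y = 0) :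
    BandAbsorbs E fun x => ∑ᶠ j, m j x := by
  intro l hl hl0
  choose idx hidx using hloc
  have hself : ∀ x, ∀ j ≠ idx x, m j x = 0 := fun x => (hidx x).self_of_nhds
  choose F G h hfix using fun i => hm i l hl hl0
  have hAB : ∀ i, ∀ z : X × E, ¬ m i z.1 ≠ 0 →
      (z ∈ openBand E l ↔ z ∈ openBand E fun x => Max.max (l x) (m i x)) := fun i z hz =>
    mem_openBand_max_iff hl0 (not_not.1 hz)
  have hfixF : ∀ i, ∀ p ∈ openBand E l, ¬ m i p.1 ≠ 0 → F i p = p := fun i p hp hz =>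
    hfix i p hp (not_not.1 hz)
  have hfixG := fun i => (h i).fixed_symm (hAB i) (hfixF i)
  have hband : ∀ {i} {p : X × E}, (∀ j ≠ i, m j p.1 = 0) →
      (p ∈ (openBand E fun x => Max.max (l x) (∑ᶠ j, m j x)) ↔
        p ∈ openBand E fun x => Max.max (l x) (m i x)) := by
    intro i p hp
    change _ ∨ _ < Max.max (l p.1) (∑ᶠ j, m j p.1) ↔ _
    rw [finsum_eq_of_forall_ne hp]
    rfl
  have hF : ∀ {i} {p : X × E}, p ∈ openBand E l → (∀ j ≠ i, m j p.1 = 0) →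
      F (idx p.1) p = F i p := by
    intro i p hp hi
    by_cases hij : idx p.1 = i
    · rw [hij]
    · rw [hfixF _ p hp (not_not.2 (hi _ hij)),
        hfixF _ p hp (not_not.2 (hself _ _ (Ne.symm hij)))]
  have hG : ∀ {i} {p : X × E}, p ∈ (openBand E fun x => Max.max (l x) (∑ᶠ j, m j x)) →
      (∀ j ≠ i, m j p.1 = 0) → G (idx p.1) p = G i p := by
    intro i p hp hi
    by_cases hij : idx p.1 = i
    · rw [hij]
    · rw [hfixG _ p ((hband (hself p.1)).1 hp) (not_not.2 (hi _ hij)),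
        hfixG _ p ((hband hi).1 hp) (not_not.2 (hself _ _ (Ne.symm hij)))]
  have hne : ∀ {i x}, m i x ≠ 0 → ∀ j ≠ i, m j x = 0 := by
    intro i x hi j hj
    have : i = idx x := by
      by_contra h'
      exact hi (hself x i h')
    exact hself x j (this ▸ hj)
  have hFne : ∀ {i} {p : X × E}, p ∈ openBand E l → (∀ j ≠ i, m j p.1 = 0) →
      ∀ j ≠ i, m j (F i p).1 = 0 := by
    intro i p hp hi
    by_cases h0 : m i p.1 ≠ 0
    · exact hne ((h i).moving_of_moving (hAB i) (hfixF i) hp h0)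
    · rwa [hfixF i p hp h0]
  have hGne : ∀ {i} {p : X × E}, p ∈ (openBand E fun x => Max.max (l x) (m i x)) →
      (∀ j ≠ i, m j p.1 = 0) → ∀ j ≠ i, m j (G i p).1 = 0 := by
    intro i p hp hi
    by_cases h0 : m i p.1 ≠ 0
    · exact hne ((h i).symm.moving_of_moving (fun z hz => (hAB i z hz).symm) (hfixG i) hp h0)
    · rwa [hfixG i p hp h0]
  have hmF : MapsTo (fun p : X × E => F (idx p.1) p) (openBand E l)
      (openBand E fun x => Max.max (l x) (∑ᶠ j, m j x)) := fun p hp =>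
    (hband (hFne hp (hself p.1))).2 ((h _).mapsF hp)
  have hmG : MapsTo (fun p : X × E => G (idx p.1) p)
      (openBand E fun x => Max.max (l x) (∑ᶠ j, m j x)) (openBand E l) := fun p hp =>
    (h _).mapsG ((hband (hself p.1)).1 hp)
  refine ⟨fun p => F (idx p.1) p, fun p => G (idx p.1) p,
    ⟨fun p hp => ?_, fun p hp => ?_, hmF, hmG, fun p hp => ?_, fun p hp => ?_⟩, fun p hp h0 => ?_⟩
  · refine ((h (idx p.1)).contF p hp).congr_of_eventuallyEq ?_ rfl
    filter_upwards [self_mem_nhdsWithin,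
      mem_nhdsWithin_of_mem_nhds (continuous_fst.continuousAt.eventually (hidx p.1))] with q hq hq'
    exact hF hq hq'
  · have hev : ∀ᶠ q : X × E in nhds p, ∀ j ≠ idx p.1, m j q.1 = 0 :=
      continuous_fst.continuousAt.eventually (hidx p.1)
    have h1 : ContinuousWithinAt (G (idx p.1))
        (openBand E fun x => Max.max (l x) (∑ᶠ j, m j x)) p := by
      refine ((h (idx p.1)).contG p ((hband (hself p.1)).1 hp)).mono_of_mem_nhdsWithin ?_
      filter_upwards [self_mem_nhdsWithin, mem_nhdsWithin_of_mem_nhds hev] with q hq hq'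
      exact (hband hq').1 hq
    refine h1.congr_of_eventuallyEq ?_ rfl
    filter_upwards [self_mem_nhdsWithin, mem_nhdsWithin_of_mem_nhds hev] with q hq hq'
    exact hG hq hq'
  · change G (idx (F (idx p.1) p).1) (F (idx p.1) p) = p
    rw [hG (hmF hp) (hFne hp (hself p.1)), (h _).left p hp]
  · have hp' := (hband (hself p.1)).1 hp
    change F (idx (G (idx p.1) p).1) (G (idx p.1) p) = p
    rw [hF (hmG hp) (hGne hp' (hself p.1)), (h _).right p hp']
  · refine hfix _ p hp ?_
    exact (finsum_eq_of_forall_ne (hself p.1)).symm.trans h0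

end LocallyOne

namespace HeredAbsorbs

theorem of_chart [NormedSpace ℝ E] (h : OpenPartialHomeomorph X (L1 ℕ E)) (hμ : Continuous μ)
    (hμ0 : ∀ x, 0 ≤ μ x) (hcl : closure {x | μ x ≠ 0} ⊆ h.source) : HeredAbsorbs E μ where
  cont := hμ
  nonneg := hμ0
  absorbs χ hχ hχ0 := .of_chart h (hμ.min hχ) <| by
    refine (closure_mono ?_).trans hcl
    intro x hx h0
    exact hx (by rw [h0, min_eq_left (hχ0 x)])

lemma bandAbsorbs (h : HeredAbsorbs E μ) : BandAbsorbs E μ := by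
  simpa using h.absorbs μ h.cont h.nonneg

lemma min (h : HeredAbsorbs E μ) {χ : X → ℝ} (hχ : Continuous χ) (hχ0 : ∀ x, 0 ≤ χ x) :
    HeredAbsorbs E fun x => min (μ x) (χ x) where
  cont := h.cont.min hχ
  nonneg x := le_min (h.nonneg x) (hχ0 x)
  absorbs χ' h1 h2 := by
    simpa only [min_assoc] using h.absorbs _ (hχ.min h1) fun x => le_min (hχ0 x) (h2 x)

lemma max {ν : X → ℝ} (h : HeredAbsorbs E μ) (h' : HeredAbsorbs E ν) :
    HeredAbsorbs E fun x => max (μ x) (ν x) where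
  cont := h.cont.max h'.cont
  nonneg x := le_max_of_le_left (h.nonneg x)
  absorbs χ h1 h2 := by
    simpa only [min_max_distrib_right] using (h.absorbs χ h1 h2).max (h'.absorbs χ h1 h2)
      (h.cont.min h1) (fun x => le_min (h.nonneg x) (h2 x)) fun x => le_min (h'.nonneg x) (h2 x)

lemma finsum {ι : Type*} {m : ι → X → ℝ} (h : ∀ i, HeredAbsorbs E (m i))
    (hloc : ∀ x, ∃ i, ∀ᶠ y in nhds x, ∀ j ≠ i, m j y = 0) :
    HeredAbsorbs E fun x => ∑ᶠ j, m j x where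
  cont := continuous_finsum_of_locally_one (fun i => (h i).cont) hloc
  nonneg x := finsum_nonneg fun i => (h i).nonneg x
  absorbs χ h1 h2 := by
    have hz : ∀ {x j}, m j x = 0 → Min.min (m j x) (χ x) = 0 := fun {x j} h' => by
      rw [h', min_eq_left (h2 x)]
    convert BandAbsorbs.finsum (fun i => (h i).absorbs χ h1 h2) (fun x => ?_) using 2 with x
    · obtain ⟨i, hi⟩ := hloc x
      rw [finsum_eq_of_forall_ne hi.self_of_nhds,
        finsum_eq_single _ i fun j hj => hz (hi.self_of_nhds j hj)]
    · obtain ⟨i, hi⟩ := hloc x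
      exact ⟨i, hi.mono fun y hy j hj => hz (hy j hj)⟩

end HeredAbsorbs

end Absorbable

section Globalize

variable {X : Type*} [MetricSpace X]

lemma openGauge_mono {Ω Ω' : Set X} (h : Ω ⊆ Ω') (p : X) : openGauge Ω p ≤ openGauge Ω' p :=
  ENNReal.toReal_mono (ne_top_of_le_ne_top ENNReal.one_ne_top (min_le_left _ _))
    (min_le_min le_rfl (infEDist_anti (compl_subset_compl.2 h)))

section Stratum

variable {ι : Type*} [LinearOrder ι] (U : ι → Set X)

/-- The `n`-th layer of a well-ordered open cover: functions with uniformly separated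
cozero sets subordinate to the cover. -/
noncomputable def stratum (n : ℕ) (i : ι) (x : X) : ℝ :=
  min (max 0 (openGauge (U i) x - (1 / 2) ^ n))
    (max 0 ((1 / 2) ^ n / 2 - openGauge (⋃ j, ⋃ (_ : j < i), U j) x))

variable {U}

lemma continuous_stratum (n : ℕ) (i : ι) : Continuous (stratum U n i) :=
  (continuous_const.max ((continuous_openGauge _).sub continuous_const)).min
    (continuous_const.max (continuous_const.sub (continuous_openGauge _)))

lemma stratum_nonneg (n : ℕ) (i : ι) (x : X) : 0 ≤ stratum U n i x :=
  le_min (le_max_left _ _) (le_max_left _ _)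

lemma stratum_pos_iff {n : ℕ} {i : ι} {x : X} : 0 < stratum U n i x ↔
    (1 / 2) ^ n < openGauge (U i) x ∧
      openGauge (⋃ j, ⋃ (_ : j < i), U j) x < (1 / 2) ^ n / 2 := by
  simp only [stratum, lt_min_iff, lt_max_iff, lt_irrefl, false_or, sub_pos]

lemma stratum_ne_zero_iff {n : ℕ} {i : ι} {x : X} :
    stratum U n i x ≠ 0 ↔ 0 < stratum U n i x := (stratum_nonneg n i x).lt_iff_ne'.symm

lemma closure_stratum_subset (hU : ∀ i, IsOpen (U i)) (n : ℕ) (i : ι) :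
    closure {x | stratum U n i x ≠ 0} ⊆ U i := by
  have h : {x | stratum U n i x ≠ 0} ⊆ {x | (1 / 2 : ℝ) ^ n ≤ openGauge (U i) x} := fun x hx =>
    (stratum_pos_iff.1 (stratum_ne_zero_iff.1 hx)).1.le
  refine (closure_minimal h (isClosed_le continuous_const (continuous_openGauge _))).trans
    fun x hx => (openGauge_pos (hU i)).1 (lt_of_lt_of_le ?_ hx)
  positivity

lemma lt_dist_of_stratum_pos {n : ℕ} {i j : ι} {x y : X} (hij : j ≠ i)
    (hx : 0 < stratum U n i x) (hy : 0 < stratum U n j y) : (1 / 2) ^ n / 2 < dist x y := by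
  wlog h : j < i generalizing i j x y
  · rw [dist_comm]
    exact this hij.symm hy hx (lt_of_le_of_ne (not_lt.1 h) hij.symm)
  have h1 := openGauge_le_add (⋃ j, ⋃ (_ : j < i), U j) y x
  have h2 := openGauge_mono (subset_iUnion₂ (s := fun j (_ : j < i) => U j) j h) y
  have h3 := (stratum_pos_iff.1 hx).2
  have h4 := (stratum_pos_iff.1 hy).1
  rw [dist_comm] at h1
  linarith

lemma stratum_locally_one [Nonempty ι] (n : ℕ) (x : X) :
    ∃ i, ∀ᶠ y in nhds x, ∀ j ≠ i, stratum U n j y = 0 := by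
  have hc : (0 : ℝ) < (1 / 2) ^ n / 4 := by positivity
  by_cases h : ∃ y ∈ ball x ((1 / 2) ^ n / 4), ∃ i, 0 < stratum U n i y
  · obtain ⟨y, hy, i, hi⟩ := h
    refine ⟨i, ?_⟩
    filter_upwards [ball_mem_nhds x hc] with z hz j hj
    by_contra hz0
    have h1 := lt_dist_of_stratum_pos hj hi (stratum_ne_zero_iff.1 hz0)
    have h2 := dist_triangle_right y z x
    rw [mem_ball] at hy hz
    linarith
  · refine ⟨Classical.arbitrary ι, ?_⟩
    filter_upwards [ball_mem_nhds x hc] with z hz j _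
    by_contra hz0
    exact h ⟨z, hz, j, stratum_ne_zero_iff.1 hz0⟩

lemma exists_stratum_pos [WellFoundedLT ι] (hU : ∀ i, IsOpen (U i)) {x : X}
    (hx : ∃ i, x ∈ U i) : ∃ n i, 0 < stratum U n i x := by
  obtain ⟨i, hi, hmin⟩ := WellFounded.has_min (wellFounded_lt (α := ι)) {i | x ∈ U i} hx
  obtain ⟨n, hn⟩ := exists_pow_lt_of_lt_one ((openGauge_pos (hU i)).2 hi)
    (by norm_num : (1 / 2 : ℝ) < 1)
  refine ⟨n, i, stratum_pos_iff.2 ⟨hn, ?_⟩⟩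
  rw [openGauge_eq_zero (isOpen_iUnion fun j => isOpen_iUnion fun _ => hU j)]
  · positivity
  · simp only [mem_iUnion, not_exists]
    exact fun j hj hxj => hmin j hxj hj

end Stratum

variable {E : Type*} [NormedAddCommGroup E]

omit [MetricSpace X] in
lemma finsum_pos_of_locally_one {ι : Type*} {m : ι → X → ℝ} {x : X}
    (hloc : ∃ i, ∀ j ≠ i, m j x = 0) {j : ι} (hj : 0 < m j x) : 0 < ∑ᶠ j, m j x := by
  obtain ⟨i, hi⟩ := hloc
  have hij : j = i := by
    by_contra h
    exact hj.ne' (hi j h)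
  rw [finsum_eq_of_forall_ne hi, ← hij]
  exact hj

/-- Tent functions of an unbounded parameter `t`, centred at natural numbers. -/
noncomputable def tent (m : ℕ) (t : ℝ) : ℝ := max 0 (1 - 4 / 3 * |t - m|)

lemma continuous_tent (m : ℕ) : Continuous (tent m) := by unfold tent; fun_prop

lemma tent_nonneg (m : ℕ) (t : ℝ) : 0 ≤ tent m t := le_max_left _ _

lemma tent_pos_iff {m : ℕ} {t : ℝ} : 0 < tent m t ↔ |t - m| < 3 / 4 := by
  rw [tent, lt_max_iff, or_iff_right (lt_irrefl _)]
  constructor <;> intro h <;> linarith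

lemma tent_locally_one {b : ℕ} (hb : b ≤ 1) {t : ℝ} (ht : 0 ≤ t) :
    ∃ i : ℕ, ∀ᶠ u in nhds t, ∀ j ≠ i, tent (2 * j + b) u = 0 := by
  have hb' : (b : ℝ) ≤ 1 := by exact_mod_cast hb
  refine ⟨⌊(t - b + 1) / 2⌋₊, ?_⟩
  filter_upwards [ball_mem_nhds t (by norm_num : (0 : ℝ) < 1 / 4)] with u hu j hj
  have h1 := Nat.floor_le (a := (t - b + 1) / 2) (by linarith)
  have h2 := Nat.lt_floor_add_one ((t - b + 1) / 2)
  rw [mem_ball, Real.dist_eq, abs_lt] at hu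
  refine le_antisymm (not_lt.1 fun h => ?_) (tent_nonneg _ _)
  rw [tent_pos_iff, abs_lt] at h
  push_cast at h
  rcases lt_or_gt_of_ne hj with h' | h'
  · have : (j : ℝ) + 1 ≤ ⌊(t - b + 1) / 2⌋₊ := by exact_mod_cast h'
    linarith [h.1, h.2]
  · have : (⌊(t - b + 1) / 2⌋₊ : ℝ) + 1 ≤ j := by exact_mod_cast h'
    linarith [h.1, h.2]

theorem HeredAbsorbs.exists_pos {ν : ℕ → X → ℝ} (hν : ∀ n, HeredAbsorbs E (ν n))
    (hpos : ∀ x, ∃ n, 0 < ν n x) : ∃ μ : X → ℝ, HeredAbsorbs E μ ∧ ∀ x, 0 < μ x := by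
  have hs : ∀ m, ∃ s : X → ℝ, HeredAbsorbs E s ∧ ∀ k ≤ m, ∀ x, ν k x ≤ s x := by
    intro m
    induction m with
    | zero => exact ⟨ν 0, hν 0, fun k hk x => by rw [Nat.le_zero.1 hk]⟩
    | succ m ih =>
      obtain ⟨s, h1, h2⟩ := ih
      refine ⟨_, h1.max (hν (m + 1)), fun k hk x => ?_⟩
      rcases Nat.le_succ_iff.1 hk with h | rfl
      · exact (h2 k h x).trans (le_max_left _ _)
      · exact le_max_right _ _
  choose s hs hsν using hs
  obtain ⟨φ, hφ⟩ := exists_continuous_forall_mem_convex_of_local_const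
    (t := fun y : X => {c : ℝ | ∃ k : ℕ, (k : ℝ) ≤ c ∧ 0 < ν k y})
    (fun y => by
      have : IsUpperSet {c : ℝ | ∃ k : ℕ, (k : ℝ) ≤ c ∧ 0 < ν k y} := fun a b hab hk =>
        hk.imp fun k h => ⟨h.1.trans hab, h.2⟩
      exact this.ordConnected.convex)
    (fun x => by
      obtain ⟨n, hn⟩ := hpos x
      exact ⟨n, ((hν n).cont.continuousAt.eventually_const_lt hn).mono fun y hy => ⟨n, le_rfl, hy⟩⟩)
  have hφ0 : ∀ x, 0 ≤ φ x := fun x => by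
    obtain ⟨k, hk, -⟩ := hφ x
    exact (Nat.cast_nonneg k).trans hk
  have hloc : ∀ b ≤ 1, ∀ x, ∃ i, ∀ᶠ y in nhds x, ∀ j ≠ i,
      Min.min (s (2 * j + b) y) (tent (2 * j + b) (φ y)) = 0 := by
    intro b hb x
    obtain ⟨i, hi⟩ := tent_locally_one hb (hφ0 x)
    refine ⟨i, (φ.continuous.continuousAt.eventually hi).mono fun y hy j hj => ?_⟩
    rw [hy j hj, min_eq_right ((hs _).nonneg y)]
  have hmin : ∀ m, HeredAbsorbs E fun x => Min.min (s m x) (tent m (φ x)) := fun m =>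
    (hs m).min ((continuous_tent m).comp φ.continuous) fun x => tent_nonneg m _
  refine ⟨_, (HeredAbsorbs.finsum (fun j => hmin (2 * j + 0)) (hloc 0 zero_le_one)).max
    (HeredAbsorbs.finsum (fun j => hmin (2 * j + 1)) (hloc 1 le_rfl)), fun x => ?_⟩
  have key : ∃ m, 0 < Min.min (s m x) (tent m (φ x)) := by
    have h1 := Nat.floor_le (a := φ x + 1 / 2) (by linarith [hφ0 x])
    have h2 := Nat.lt_floor_add_one (φ x + 1 / 2)
    obtain ⟨k, hk, hk'⟩ := hφ x
    refine ⟨⌊φ x + 1 / 2⌋₊, lt_min (hk'.trans_le (hsν _ k ?_ x)) (tent_pos_iff.2 ?_)⟩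
    · exact Nat.le_floor (by linarith)
    · rw [abs_lt]
      constructor <;> linarith
  obtain ⟨m, hm⟩ := key
  rw [lt_max_iff]
  rcases Nat.even_or_odd' m with ⟨j, rfl | rfl⟩
  · exact Or.inl (finsum_pos_of_locally_one
      (m := fun j x => Min.min (s (2 * j + 0) x) (tent (2 * j + 0) (φ x)))
      ((hloc 0 zero_le_one x).imp fun i hi => hi.self_of_nhds) hm)
  · exact Or.inr (finsum_pos_of_locally_one
      (m := fun j x => Min.min (s (2 * j + 1) x) (tent (2 * j + 1) (φ x)))
      ((hloc 1 le_rfl x).imp fun i hi => hi.self_of_nhds) hm)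

theorem HeredAbsorbs.exists_pos_of_charts [NormedSpace ℝ E]
    (hX : ∀ x : X, ∃ h : OpenPartialHomeomorph X (L1 ℕ E), x ∈ h.source) :
    ∃ μ : X → ℝ, HeredAbsorbs E μ ∧ ∀ x, 0 < μ x := by
  choose h hh using hX
  obtain ⟨_, _⟩ := exists_wellFoundedLT X
  have hU : ∀ i, IsOpen (h i).source := fun i => (h i).open_source
  rcases isEmpty_or_nonempty X with hX | hX
  · exact HeredAbsorbs.exists_pos (ν := fun _ _ => 0)
      (fun n => ⟨continuous_const, fun _ => le_rfl, fun χ _ _ l _ _ =>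
        ⟨id, id, ⟨continuousOn_id, continuousOn_id, fun p => (IsEmpty.false p.1).elim,
          fun p => (IsEmpty.false p.1).elim, fun _ _ => rfl, fun _ _ => rfl⟩, fun _ _ _ => rfl⟩⟩)
      (fun x => (IsEmpty.false x).elim)
  refine HeredAbsorbs.exists_pos (ν := fun n x => ∑ᶠ i, stratum (fun i => (h i).source) n i x)
    (fun n => HeredAbsorbs.finsum (fun i => .of_chart (h i) (continuous_stratum n i)
      (stratum_nonneg n i) (closure_stratum_subset hU n i)) (stratum_locally_one n)) fun x => ?_
  obtain ⟨n, i, hi⟩ := exists_stratum_pos (U := fun i => (h i).source) hU ⟨x, hh x⟩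
  exact ⟨n, finsum_pos_of_locally_one
    ((stratum_locally_one n x).imp fun i hi => hi.self_of_nhds) hi⟩

lemma homeoOn_openBand_univ [NormedSpace ℝ E] {μ : X → ℝ} (hμ : Continuous μ) (h0 : ∀ x, 0 < μ x) :
    HomeoOn (openBand E μ) (univ : Set (X × E))
      (fun p => (p.1, (μ p.1 - ‖p.2‖)⁻¹ • p.2))
      (fun q => (q.1, (μ q.1 / (1 + ‖q.2‖)) • q.2)) := by
  have hlt : ∀ p ∈ openBand E μ, 0 < μ p.1 - ‖p.2‖ := by
    rintro p (hp | hp)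
    · rw [hp, norm_zero, sub_zero]; exact h0 _
    · exact sub_pos.2 hp
  have hn : ∀ q : X × E, 0 < 1 + ‖q.2‖ := fun q => by positivity
  refine ⟨?_, ?_, fun _ _ => mem_univ _, fun q _ => Or.inr ?_, fun p hp => ?_, fun q _ => ?_⟩
  · refine continuousOn_fst.prodMk (ContinuousOn.smul (ContinuousOn.inv₀ ?_ fun p hp =>
      (hlt p hp).ne') continuousOn_snd)
    exact ((hμ.comp continuous_fst).sub continuous_snd.norm).continuousOn
  · refine (continuous_fst.prodMk (Continuous.smul ?_ continuous_snd)).continuousOn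
    exact (hμ.comp continuous_fst).div (continuous_const.add continuous_snd.norm)
      fun q => (hn q).ne'
  · change ‖(μ q.1 / (1 + ‖q.2‖)) • q.2‖ < μ q.1
    rw [norm_smul, Real.norm_of_nonneg (div_pos (h0 _) (hn q)).le, div_mul_eq_mul_div,
      div_lt_iff₀ (hn q)]
    exact mul_lt_mul_of_pos_left (by linarith) (h0 _)
  · refine Prod.ext rfl ?_
    have h1 := hlt p hp
    simp only [norm_smul, norm_inv, Real.norm_of_nonneg h1.le, smul_smul]
    have h2 : μ p.1 / (1 + (μ p.1 - ‖p.2‖)⁻¹ * ‖p.2‖) * (μ p.1 - ‖p.2‖)⁻¹ = 1 := by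
      have h3 : 1 + (μ p.1 - ‖p.2‖)⁻¹ * ‖p.2‖ = μ p.1 * (μ p.1 - ‖p.2‖)⁻¹ := by
        field_simp
        ring
      rw [h3, div_mul_eq_mul_div, div_self (mul_pos (h0 _) (inv_pos.2 h1)).ne']
    rw [h2, one_smul]
  · refine Prod.ext rfl ?_
    have h1 := hn q
    simp only [norm_smul, Real.norm_of_nonneg (div_pos (h0 q.1) h1).le, smul_smul]
    have h2 : (μ q.1 - μ q.1 / (1 + ‖q.2‖) * ‖q.2‖)⁻¹ * (μ q.1 / (1 + ‖q.2‖)) = 1 := by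
      have h3 : μ q.1 - μ q.1 / (1 + ‖q.2‖) * ‖q.2‖ = μ q.1 / (1 + ‖q.2‖) := by
        field_simp
        ring
      rw [h3, inv_mul_cancel₀ (div_pos (h0 _) h1).ne']
    rw [h2, one_smul]

/-- Stability: a metrizable manifold modeled on a countable `L1`-power of the normed space `E`
is homeomorphic to its product with `E`. -/
theorem nonempty_homeomorph_prod_of_charts [NormedSpace ℝ E]
    (hX : ∀ x : X, ∃ h : OpenPartialHomeomorph X (L1 ℕ E), x ∈ h.source) :
    Nonempty (X ≃ₜ X × E) := by
  obtain ⟨μ, hμ, hpos⟩ := HeredAbsorbs.exists_pos_of_charts hX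
  obtain ⟨F, G, hFG, -⟩ := hμ.bandAbsorbs (fun _ => 0) continuous_const fun _ => le_rfl
  have h1 : HomeoOn (univ : Set X) (openBand E fun _ : X => 0) (fun x => (x, 0)) Prod.fst :=
    ⟨(continuous_id.prodMk continuous_const).continuousOn, continuousOn_fst,
      fun _ _ => Or.inl rfl, fun _ _ => mem_univ _, fun _ _ => rfl, fun p hp =>
        Prod.ext rfl (hp.resolve_right (norm_nonneg _).not_gt).symm⟩
  have h2 : HomeoOn (univ : Set X) (univ : Set (X × E)) _ _ :=
    (h1.trans hFG).trans (by
      simp only [max_eq_right (hpos _).le]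
      exact homeoOn_openBand_univ hμ.cont hpos)
  exact ⟨(Homeomorph.Set.univ X).symm.trans (h2.toHomeomorph.trans (Homeomorph.Set.univ _))⟩

end Globalize

lemma exists_openPartialHomeomorph_of_subtype {X Y : Type*} [TopologicalSpace X]
    [TopologicalSpace Y] {U : Set X} {V : Set Y} (hU : IsOpen U) (hV : IsOpen V) (e : U ≃ₜ V)
    {x : X} (hx : x ∈ U) : ∃ h : OpenPartialHomeomorph X Y, x ∈ h.source := by
  have : Nonempty U := ⟨⟨x, hx⟩⟩
  have hf : Topology.IsOpenEmbedding (Subtype.val ∘ e : U → Y) :=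
    hV.isOpenEmbedding_subtypeVal.comp e.isOpenEmbedding
  have : Nonempty (⟨U, hU⟩ : Opens X) := ⟨⟨x, hx⟩⟩
  refine ⟨((⟨U, hU⟩ : Opens X).openPartialHomeomorphSubtypeCoe this).symm.trans
    (hf.toOpenPartialHomeomorph _), ?_⟩
  rw [OpenPartialHomeomorph.trans_source]
  refine ⟨?_, mem_univ _⟩
  rw [OpenPartialHomeomorph.symm_source, Opens.openPartialHomeomorphSubtypeCoe_target]
  exact hx

lemma locallyPathConnectedSpace_of_charts {X H : Type*} [TopologicalSpace X] [TopologicalSpace H]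
    [LocallyPathConnectedSpace H] (hX : ∀ x : X, ∃ h : OpenPartialHomeomorph X H, x ∈ h.source) :
    LocallyPathConnectedSpace X := by
  choose h hh using hX
  let _ : ChartedSpace H X := ⟨range h, h, hh, fun x => mem_range_self x⟩
  exact ChartedSpace.locallyPathConnectedSpace H X

/-- (Mine–Sakai–Yaguchi) Let `κ` be an infinite cardinal (realized as an infinite index
type) and let `X` be a connected metrizable manifold modeled on `ℓ₂^f(κ)`, i.e. every
point of `X` has an open neighborhood homeomorphic to an open subset of `ℓ₂^f(κ)`.
Then the hyperspace `Fin(X)` is homeomorphic to `ℓ₂^f(κ)`. -/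
theorem finHyp_homeomorph_l2Fin_of_manifold (κ : Type*) [Infinite κ]
    (X : Type*) [MetricSpace X] [ConnectedSpace X]
    (hX : ∀ x : X, ∃ U : Set X, IsOpen U ∧ x ∈ U ∧
      ∃ V : Set (l2Fin κ), IsOpen V ∧ Nonempty (↥U ≃ₜ ↥V)) :
    Nonempty (FinHyp X ≃ₜ l2Fin κ) := by
  have h0 : ∀ x : X, ∃ h : OpenPartialHomeomorph X (l2Fin κ), x ∈ h.source := fun x => by
    obtain ⟨U, hU, hx, V, hV, ⟨e⟩⟩ := hX x
    exact exists_openPartialHomeomorph_of_subtype hU hV e hx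
  let η : C00 κ ℝ ≃ₜ l2Fin κ := (layerHomeo κ).symm.trans (mazurHomeo κ).symm
  have h1 : ∀ x : X, ∃ h : OpenPartialHomeomorph X (C00 κ ℝ), x ∈ h.source := fun x =>
    let ⟨h, hx⟩ := h0 x
    ⟨h.transHomeomorph η.symm, hx⟩
  have h2 : ∀ x : X, ∃ h : OpenPartialHomeomorph X (L1 ℕ (L1 κ ℝ)), x ∈ h.source := fun x =>
    let ⟨h, hx⟩ := h0 x
    ⟨h.transHomeomorph ((mazurHomeo κ).trans (L1.natHomeo κ).symm), hx⟩
  have := locallyPathConnectedSpace_of_charts h1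
  have : PathConnectedSpace X := pathConnectedSpace_iff_connectedSpace.2 ‹_›
  obtain ⟨e⟩ := nonempty_homeomorph_prod_of_charts h2
  obtain ⟨j, hj⟩ := FinHyp.exists_isClosedEmbedding_of_charts h1
  obtain ⟨Φ⟩ := FinHyp.nonempty_homeomorph_of_stable
    (e.trans ((Homeomorph.refl X).prodCongr (layerHomeo κ))) hj
  exact ⟨Φ.trans η⟩
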